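/- Assume every singular point of C has multiplicity 2 (i.e., m_P(C) ≤ 2 for all P ∈ ℙ²(K)). Then the map P ↦ [G_P] is a bijection from the set of singular points of C onto X_2(K), and for every singular point P the length of X_2 at [G_P] equals δ_P. -/

import Mathlib

open MvPolynomial

noncomputable section

/-- The coefficient `a_i` of `s^(n-i) t^i` in a binary form `f` of degree `n`. -/
def bcoeff {K : Type*} [Field K] (n : ℕ) (f : MvPolynomial (Fin 2) K) (i : Fin (n + 1)) : K :=
  MvPolynomial.coeff (Finsupp.single 0 (n - (i : ℕ)) + Finsupp.single 1 (i : ℕ)) f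

/-- The binary form of degree `k` with coefficient vector `x`. -/
def formOf {K : Type*} [Field K] (k : ℕ) (x : Fin (k + 1) → K) : MvPolynomial (Fin 2) K :=
  ∑ i : Fin (k + 1),
    MvPolynomial.C (x i) * MvPolynomial.X 0 ^ (k - (i : ℕ)) * MvPolynomial.X 1 ^ (i : ℕ)

/-- The matrix `M_k` associated to the parameterization `f`: the first `n-k+1` rows contain
the variables `x_0, …, x_k` in staircase position, the last three rows are the coefficient
vectors of `f_0, f_1, f_2`. -/
def Mmat {K : Type*} [Field K] (n k : ℕ) (f : Fin 3 → MvPolynomial (Fin 2) K) :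
    Matrix (Fin (n - k + 4)) (Fin (n + 1)) (MvPolynomial (Fin (k + 1)) K) :=
  fun j c =>
    if hj : (j : ℕ) ≤ n - k then
      if h : (j : ℕ) ≤ (c : ℕ) ∧ (c : ℕ) ≤ (j : ℕ) + k then
        MvPolynomial.X ⟨(c : ℕ) - (j : ℕ), by omega⟩
      else 0
    else
      MvPolynomial.C (bcoeff n (f ⟨(j : ℕ) - (n - k + 1), by have := j.isLt; omega⟩) c)

/-- The set of `(n-k+3) × (n-k+3)` minors of the matrix `M_k`; it generates the ideal
`I_{X_k}`. -/
def minorsSet {K : Type*} [Field K] (n k : ℕ) (f : Fin 3 → MvPolynomial (Fin 2) K) :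
    Set (MvPolynomial (Fin (k + 1)) K) :=
  { g | ∃ (r : Fin (n - k + 3) → Fin (n - k + 4)) (c : Fin (n - k + 3) → Fin (n + 1)),
      Function.Injective r ∧ Function.Injective c ∧
      g = ((Mmat n k f).submatrix r c).det }

/-- The projective zero locus `X_k(K) ⊆ ℙ^k(K)` of the ideal of minors of `M_k`. -/
def XkSet {K : Type*} [Field K] (n k : ℕ) (f : Fin 3 → MvPolynomial (Fin 2) K) :
    Set (Projectivization K (Fin (k + 1) → K)) :=
  { P | ∀ g ∈ minorsSet n k f, MvPolynomial.eval P.rep g = 0 }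

/-- Evaluation of the parameterization at a vector `v ∈ K²`. -/
def evalVec {K : Type*} [Field K] (f : Fin 3 → MvPolynomial (Fin 2) K) (v : Fin 2 → K) :
    Fin 3 → K :=
  fun u => MvPolynomial.eval v (f u)

/-- The induced map `f : ℙ¹(K) → ℙ²(K)` (with a junk value where undefined). -/
def projMap {K : Type*} [Field K] (f : Fin 3 → MvPolynomial (Fin 2) K)
    (P : Projectivization K (Fin 2 → K)) : Projectivization K (Fin 3 → K) :=
  haveI := Classical.propDecidable (evalVec f P.rep ≠ 0)
  if h : evalVec f P.rep ≠ 0 then Projectivization.mk K _ h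
  else Projectivization.mk K (fun _ => 1) (fun hc => one_ne_zero (congrFun hc 0))

/-- `f = (f_0, f_1, f_2)` is a proper parameterization of degree `n`: the `f_u` are
homogeneous of degree `n`, have no common zero outside the origin, and the induced map
`ℙ¹(K) → ℙ²(K)` is injective outside some finite set. -/
structure IsProperParam {K : Type*} [Field K] (n : ℕ)
    (f : Fin 3 → MvPolynomial (Fin 2) K) : Prop where
  homog : ∀ u, (f u).IsHomogeneous n
  no_common_zero : ∀ v : Fin 2 → K, v ≠ 0 → evalVec f v ≠ 0
  gen_injective : ∃ S : Set (Projectivization K (Fin 2 → K)), S.Finite ∧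
    Set.InjOn (projMap f) Sᶜ

/-- The homogeneous vanishing ideal of the point `p ∈ ℙ²(K)`. -/
def pointIdeal {K : Type*} [Field K] (p : Fin 3 → K) : Ideal (MvPolynomial (Fin 3) K) :=
  Ideal.span { L | L.IsHomogeneous 1 ∧ MvPolynomial.eval p L = 0 }

/-- The multiplicity of the curve `{F = 0}` at the point `p`:
the largest `m` with `F ∈ I(p)^m`. -/
def multAt {K : Type*} [Field K] (F : MvPolynomial (Fin 3) K) (p : Fin 3 → K) : ℕ :=
  sSup { m | F ∈ pointIdeal p ^ m }

/-- The cross difference `p_i f_j - p_j f_i`. -/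
def crossDiff {K : Type*} [Field K] (f : Fin 3 → MvPolynomial (Fin 2) K) (p : Fin 3 → K)
    (i j : Fin 3) : MvPolynomial (Fin 2) K :=
  MvPolynomial.C (p i) * f j - MvPolynomial.C (p j) * f i

/-- `G` is a greatest common divisor of the three cross differences `p_i f_j - p_j f_i`,
`0 ≤ i < j ≤ 2`. -/
def IsGcdOfCross {K : Type*} [Field K] (f : Fin 3 → MvPolynomial (Fin 2) K) (p : Fin 3 → K)
    (G : MvPolynomial (Fin 2) K) : Prop :=
  (∀ i j : Fin 3, i < j → G ∣ crossDiff f p i j) ∧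
  (∀ D : MvPolynomial (Fin 2) K, (∀ i j : Fin 3, i < j → D ∣ crossDiff f p i j) → D ∣ G)

/-- The linear binary form with root `v = (v 0 : v 1)`. -/
def linFormOf {K : Type*} [Field K] (v : Fin 2 → K) : MvPolynomial (Fin 2) K :=
  MvPolynomial.C (v 1) * MvPolynomial.X 0 - MvPolynomial.C (v 0) * MvPolynomial.X 1

/-- The multiplicity of `v` as a root of the binary form `h`. -/
def ordAt {K : Type*} [Field K] (v : Fin 2 → K) (h : MvPolynomial (Fin 2) K) : ℕ :=
  sSup { e | linFormOf v ^ e ∣ h }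

/-- The point `x ∈ ℙ²` lies on the conic `4 x₀ x₂ - x₁² = 0`. -/
def onConic {K : Type*} [Field K] (x : Fin 3 → K) : Prop :=
  4 * x 0 * x 2 - x 1 ^ 2 = 0

/-- The embedding of chart indices: the two coordinates other than `c`. -/
def chartEmb (c : Fin 3) (i : Fin 2) : Fin 3 :=
  if (i : ℕ) < (c : ℕ) then ⟨(i : ℕ), by have := i.isLt; omega⟩
  else ⟨(i : ℕ) + 1, by have := i.isLt; omega⟩

/-- Dehomogenization substitution for the affine chart `{x_c ≠ 0}` of `ℙ²`:
the variable `x_c` is sent to `1`, the other two variables to the affine coordinates. -/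
def dehomMap {K : Type*} [Field K] (c : Fin 3) (j : Fin 3) : MvPolynomial (Fin 2) K :=
  if j = c then 1
  else if h2 : (j : ℕ) < (c : ℕ) then MvPolynomial.X ⟨(j : ℕ), by have := c.isLt; omega⟩
  else MvPolynomial.X ⟨(j : ℕ) - 1, by have := j.isLt; omega⟩

/-- The affine coordinates, in the chart `{x_c ≠ 0}`, of the projective point with
homogeneous coordinates `q`. -/
def affOf {K : Type*} [Field K] (q : Fin 3 → K) (c : Fin 3) : Fin 2 → K :=
  fun i => q (chartEmb c i) / q c

/-- The dehomogenization of a homogeneous ideal of `K[x_0,x_1,x_2]` in the chart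
`{x_c ≠ 0}`. -/
def dehomIdeal {K : Type*} [Field K] (c : Fin 3) (I : Ideal (MvPolynomial (Fin 3) K)) :
    Ideal (MvPolynomial (Fin 2) K) :=
  I.map (MvPolynomial.aeval (dehomMap c) : MvPolynomial (Fin 3) K →ₐ[K] MvPolynomial (Fin 2) K)

instance kerEvalMaximal {K : Type*} [Field K] (a : Fin 2 → K) :
    (RingHom.ker (MvPolynomial.eval a : MvPolynomial (Fin 2) K →+* K)).IsMaximal :=
  RingHom.ker_isMaximal_of_surjective _ (fun r => ⟨MvPolynomial.C r, by simp⟩)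

/-- The local ring at the point `a ∈ 𝔸²` of the subscheme of the affine plane defined by the
ideal `I`: the localization, at (the image of) the maximal ideal of `a`, of the quotient of
the affine coordinate ring `K[x,y]` by `I`. -/
def LocalRingAt {K : Type*} [Field K] (I : Ideal (MvPolynomial (Fin 2) K))
    (a : Fin 2 → K) : Type _ :=
  Localization
    (((RingHom.ker (MvPolynomial.eval a : MvPolynomial (Fin 2) K →+* K)).primeCompl).map
      (Ideal.Quotient.mk I))

noncomputable instance {K : Type*} [Field K] (I : Ideal (MvPolynomial (Fin 2) K))
    (a : Fin 2 → K) : CommRing (LocalRingAt I a) :=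
  inferInstanceAs (CommRing (Localization _))

noncomputable instance {K : Type*} [Field K] (I : Ideal (MvPolynomial (Fin 2) K))
    (a : Fin 2 → K) : Algebra K (LocalRingAt I a) :=
  inferInstanceAs (Algebra K (Localization _))

noncomputable instance {K : Type*} [Field K] (I : Ideal (MvPolynomial (Fin 2) K))
    (a : Fin 2 → K) : Algebra (MvPolynomial (Fin 2) K) (LocalRingAt I a) :=
  inferInstanceAs (Algebra (MvPolynomial (Fin 2) K) (Localization _))

/-- The length at the point `a` of the subscheme of `𝔸²` defined by `I`: the `K`-dimension
of the local ring of the subscheme at `a`. -/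
noncomputable def lengthAt {K : Type*} [Field K] (I : Ideal (MvPolynomial (Fin 2) K))
    (a : Fin 2 → K) : ℕ :=
  Module.finrank K (LocalRingAt I a)

/-- The delta invariant `dim_K (Ō/O)` of the local ring `O` at `a` of the plane curve defined
by `I`, computed in a field of fractions `L` of `O`. -/
noncomputable def deltaAt {K : Type*} [Field K] (I : Ideal (MvPolynomial (Fin 2) K))
    (a : Fin 2 → K) (L : Type*) [Field L] [Algebra (LocalRingAt I a) L]
    [IsFractionRing (LocalRingAt I a) L] [Algebra K L]
    [IsScalarTower K (LocalRingAt I a) L] : ℕ :=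
  Module.finrank K
    ((integralClosure (LocalRingAt I a) L) ⧸
      LinearMap.range ((Algebra.linearMap (LocalRingAt I a)
        (integralClosure (LocalRingAt I a) L)).restrictScalars K))

/-- The completion of the local ring at `a` of the plane subscheme defined by `I`, with
respect to its maximal ideal. -/
def LocalCompletion {K : Type*} [Field K] (I : Ideal (MvPolynomial (Fin 2) K))
    (a : Fin 2 → K) : Type _ :=
  AdicCompletion
    ((RingHom.ker (MvPolynomial.eval a : MvPolynomial (Fin 2) K →+* K)).map
      (algebraMap (MvPolynomial (Fin 2) K) (LocalRingAt I a)))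
    (LocalRingAt I a)

noncomputable instance {K : Type*} [Field K] (I : Ideal (MvPolynomial (Fin 2) K))
    (a : Fin 2 → K) : CommRing (LocalCompletion I a) :=
  inferInstanceAs (CommRing (AdicCompletion _ _))

noncomputable instance {K : Type*} [Field K] (I : Ideal (MvPolynomial (Fin 2) K))
    (a : Fin 2 → K) : Algebra (LocalRingAt I a) (LocalCompletion I a) :=
  inferInstanceAs (Algebra _ (AdicCompletion _ _))

/-- `p` is an `A_s` singularity of the projective plane curve `{F = 0}`: in every affine chart
containing `p`, the completion of the local ring of the curve at `p` is isomorphic, as a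
`K`-algebra, to `K[[u,v]]/(v² - u^(s+1))`. -/
def IsAsSing {K : Type*} [Field K] (F : MvPolynomial (Fin 3) K) (p : Fin 3 → K)
    (s : ℕ) : Prop :=
  ∀ c : Fin 3, p c ≠ 0 →
    ∃ e : LocalCompletion (Ideal.span {MvPolynomial.aeval (dehomMap c) F}) (affOf p c) ≃+*
        (MvPowerSeries (Fin 2) K ⧸ Ideal.span
          {(MvPowerSeries.X 1 : MvPowerSeries (Fin 2) K) ^ 2 - MvPowerSeries.X 0 ^ (s + 1)}),
      ∀ r : K,
        e (algebraMap (LocalRingAt (Ideal.span {MvPolynomial.aeval (dehomMap c) F}) (affOf p c))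
            (LocalCompletion (Ideal.span {MvPolynomial.aeval (dehomMap c) F}) (affOf p c))
            (algebraMap K _ r))
          = algebraMap K _ r


section P1
variable {K : Type*} [Field K]

theorem aeval_smul_homog {σ : Type*} {A : Type*} [CommRing A] [Algebra K A]
    (y : σ → A) (a : A) (n : ℕ) (F : MvPolynomial σ K) (hF : F.IsHomogeneous n) :
    aeval (fun i => a * y i) F = a ^ n * aeval y F := by
  rw [aeval_def, aeval_def, eval₂_eq, eval₂_eq, Finset.mul_sum]
  refine Finset.sum_congr rfl fun d hd => ?_
  have := hF.degree_eq_sum_deg_support hd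
  simp only [mul_pow, Finset.prod_mul_distrib]
  rw [Finset.prod_pow_eq_pow_sum]
  rw [this]
  ring

theorem dehomMap_self (c : Fin 3) : dehomMap (K := K) c c = 1 := by simp [dehomMap]

theorem dehomMap_emb (c : Fin 3) (i : Fin 2) : dehomMap (K := K) c (chartEmb c i) = X i := by
  fin_cases c <;> fin_cases i <;> simp [dehomMap, chartEmb]

theorem chartEmb_ne (c : Fin 3) (i : Fin 2) : chartEmb c i ≠ c := by
  revert c i; decide

theorem chartEmb_cases (c j : Fin 3) : j = c ∨ j = chartEmb c 0 ∨ j = chartEmb c 1 := by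
  revert c j; decide

theorem chartEmb_ne01 (c : Fin 3) : chartEmb c 0 ≠ chartEmb c 1 := by
  revert c; decide

/-- evaluation of a homogeneous form in terms of the dehomogenization -/
theorem aeval_eq_dehom {A : Type*} [CommRing A] [Algebra K A] (c : Fin 3)
    (y : Fin 3 → A) (x : Fin 2 → A) (hx : ∀ i, y (chartEmb c i) = y c * x i)
    (n : ℕ) (F : MvPolynomial (Fin 3) K) (hF : F.IsHomogeneous n) :
    aeval y F = y c ^ n * aeval x (aeval (dehomMap c) F : MvPolynomial (Fin 2) K) := by
  have h1 : y = fun j => y c * aeval x (dehomMap (K := K) c j) := by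
    funext j
    rcases chartEmb_cases c j with h | h | h
    · subst h; simp [dehomMap_self]
    · subst h; rw [dehomMap_emb, aeval_X]; exact hx 0
    · subst h; rw [dehomMap_emb, aeval_X]; exact hx 1
  conv_lhs => rw [h1]
  rw [aeval_smul_homog _ _ n F hF]
  congr 1
  rw [← AlgHom.comp_apply, comp_aeval]

theorem dehom_inj (c : Fin 3) (n : ℕ) (F : MvPolynomial (Fin 3) K) (hF : F.IsHomogeneous n)
    (h : aeval (dehomMap c) F = (0 : MvPolynomial (Fin 2) K)) : F = 0 := by
  let Q := FractionRing (MvPolynomial (Fin 3) K)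
  let y : Fin 3 → Q := fun j => algebraMap (MvPolynomial (Fin 3) K) Q (X j)
  have hy : y c ≠ 0 := by
    simp only [y]
    rw [Ne, IsFractionRing.to_map_eq_zero_iff]
    exact X_ne_zero c
  have := aeval_eq_dehom c y (fun i => y (chartEmb c i) / y c)
    (fun i => by rw [mul_div_assoc', mul_div_cancel_left₀ _ hy]) n F hF
  rw [h, map_zero, mul_zero] at this
  have h2 : aeval y F = algebraMap (MvPolynomial (Fin 3) K) Q F := by
    have : aeval y = (IsScalarTower.toAlgHom K (MvPolynomial (Fin 3) K) Q) := by
      ext j; simp [y]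
    rw [this]; rfl
  rw [h2] at this
  exact (IsFractionRing.to_map_eq_zero_iff).1 this

theorem exists_hom (c : Fin 3) (H : MvPolynomial (Fin 2) K) :
    ∃ N0 : ℕ, ∀ N, N0 ≤ N → ∃ A : MvPolynomial (Fin 3) K, A.IsHomogeneous N ∧
      aeval (dehomMap c) A = H := by
  induction H using MvPolynomial.induction_on with
  | C a =>
    refine ⟨0, fun N _ => ⟨C a * X c ^ N, isHomogeneous_C_mul_X_pow a c N, ?_⟩⟩
    simp [dehomMap_self]
  | add p q hp hq =>
    obtain ⟨N1, h1⟩ := hp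
    obtain ⟨N2, h2⟩ := hq
    refine ⟨max N1 N2, fun N hN => ?_⟩
    obtain ⟨A, hA, hA'⟩ := h1 N (le_trans (le_max_left _ _) hN)
    obtain ⟨B, hB, hB'⟩ := h2 N (le_trans (le_max_right _ _) hN)
    exact ⟨A + B, hA.add hB, by rw [map_add, hA', hB']⟩
  | mul_X p i hp =>
    obtain ⟨N1, h1⟩ := hp
    refine ⟨N1 + 1, fun N hN => ?_⟩
    obtain ⟨A, hA, hA'⟩ := h1 (N - 1) (by omega)
    refine ⟨A * X (chartEmb c i), ?_, by rw [map_mul, hA', aeval_X, dehomMap_emb]⟩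
    have := hA.mul (isHomogeneous_X K (chartEmb c i))
    rwa [Nat.sub_add_cancel (by omega)] at this

theorem dehom_eq_of (c : Fin 3) (n : ℕ) (F G : MvPolynomial (Fin 3) K) (hF : F.IsHomogeneous n)
    (hG : G.IsHomogeneous n)
    (h : aeval (dehomMap c) F = (aeval (dehomMap c) G : MvPolynomial (Fin 2) K)) : F = G := by
  rw [← sub_eq_zero]
  exact dehom_inj c n _ (hF.sub hG) (by rw [map_sub, h, sub_self])

theorem not_dvd_X (c : Fin 3) (n : ℕ) (hn : 2 ≤ n) (F : MvPolynomial (Fin 3) K)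
    (hF : F.IsHomogeneous n) (hirr : Irreducible F) : ¬ F ∣ X c := by
  intro h
  have h1 : (X c : MvPolynomial (Fin 3) K) ≠ 0 := X_ne_zero c
  have h3 := hF.totalDegree hirr.ne_zero
  have h4 : F.totalDegree ≤ (X c : MvPolynomial (Fin 3) K).totalDegree := by
    obtain ⟨q, hq⟩ := h
    have hq0 : q ≠ 0 := by rintro rfl; simp at hq
    rw [hq, totalDegree_mul_of_isDomain hirr.ne_zero hq0]
    omega
  rw [totalDegree_X] at h4
  omega

theorem dehom_prime (c : Fin 3) (n : ℕ) (hn : 2 ≤ n) (F : MvPolynomial (Fin 3) K)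
    (hF : F.IsHomogeneous n) (hirr : Irreducible F) :
    Prime (aeval (dehomMap c) F : MvPolynomial (Fin 2) K) := by
  have hnX := not_dvd_X c n hn F hF hirr
  have hp : Prime F := hirr.prime
  refine ⟨fun h => hirr.ne_zero (dehom_inj c n F hF h), ?_, ?_⟩
  · intro hu
    rw [MvPolynomial.isUnit_iff_eq_C_of_isReduced] at hu
    obtain ⟨r, hr, h⟩ := hu
    have : F = C r * X c ^ n := dehom_eq_of c n _ _ hF (isHomogeneous_C_mul_X_pow r c n) (by
      rw [h]; simp [dehomMap_self])
    have h2 : F ∣ X c ^ n := by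
      refine ⟨C r⁻¹, ?_⟩
      rw [this, mul_right_comm, ← C_mul, mul_inv_cancel₀ hr.ne_zero]
      simp
    exact hnX (hp.dvd_of_dvd_pow h2)
  · rintro A B ⟨D, hD⟩
    obtain ⟨N1, h1⟩ := exists_hom c A
    obtain ⟨N2, h2⟩ := exists_hom c B
    obtain ⟨N3, h3⟩ := exists_hom c D
    obtain ⟨A', hA, hA'⟩ := h1 (N1 + N3 + n) (by omega)
    obtain ⟨B', hB, hB'⟩ := h2 (N2 + N3 + n) (by omega)
    obtain ⟨D', hD1, hD'⟩ := h3 (N1 + N2 + N3 + N3 + n) (by omega)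
    have key : A' * B' = F * D' := by
      have e : N1 + N3 + n + (N2 + N3 + n) = n + (N1 + N2 + N3 + N3 + n) := by ring
      refine dehom_eq_of c (n + (N1 + N2 + N3 + N3 + n)) _ _ (e ▸ hA.mul hB) (hF.mul hD1) ?_
      rw [map_mul, map_mul, hA', hB', hD', hD]
    rcases hp.dvd_or_dvd ⟨D', key⟩ with ⟨q, hq⟩ | ⟨q, hq⟩
    · left; refine ⟨aeval (dehomMap c) q, ?_⟩; rw [← hA', hq, map_mul]
    · right; refine ⟨aeval (dehomMap c) q, ?_⟩; rw [← hB', hq, map_mul]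

end P1


section P2
variable {K : Type*} [Field K]

/-- The kernel of evaluation at a point of the plane over an extension field is generated by any
prime element it contains, unless both coordinates are constants. -/
theorem ker_eq_span [IsAlgClosed K] {E : Type*} [Field E] [Algebra K E] (x : Fin 2 → E)
    (hx : ∃ i, ∀ a : K, x i ≠ algebraMap K E a)
    (Φ : MvPolynomial (Fin 2) K) (hΦ : Prime Φ) (h0 : aeval x Φ = 0)
    (H : MvPolynomial (Fin 2) K) (hH : aeval x H = 0) : Φ ∣ H := by
  set P : Ideal (MvPolynomial (Fin 2) K) := RingHom.ker (aeval x : MvPolynomial (Fin 2) K →ₐ[K] E)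
    with hP
  have hPp : P.IsPrime := RingHom.ker_isPrime _
  by_contra hnd
  have hlt : Ideal.span {Φ} < P := by
    refine lt_of_le_of_ne ?_ ?_
    · rw [Ideal.span_singleton_le_iff_mem]; exact h0
    · intro h
      apply hnd
      rw [← Ideal.mem_span_singleton, h]; exact hH
  have hsp : (Ideal.span {Φ}).IsPrime := (Ideal.span_singleton_prime hΦ.ne_zero).2 hΦ
  have hbot : (⊥ : Ideal (MvPolynomial (Fin 2) K)) < Ideal.span {Φ} := by
    rw [bot_lt_iff_ne_bot, Ne, Ideal.span_singleton_eq_bot]; exact hΦ.ne_zero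
  have hPmax : P.IsMaximal := by
    by_contra hnm
    obtain ⟨M, hM, hPM⟩ := Ideal.exists_le_maximal P hPp.ne_top
    have hPM' : P < M := lt_of_le_of_ne hPM (fun h => hnm (h ▸ hM))
    have := hM.isPrime
    have h1 : (⊥ : Ideal (MvPolynomial (Fin 2) K)).height + 1 ≤
        (Ideal.span {Φ}).height := Ideal.height_add_one_le_of_lt_of_isPrime hbot
    have h2 := Ideal.height_add_one_le_of_lt_of_isPrime hlt
    have h3 := Ideal.height_add_one_le_of_lt_of_isPrime hPM'
    have h4 : (M.height : WithBot ℕ∞) ≤ ringKrullDim (MvPolynomial (Fin 2) K) :=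
      Ideal.height_le_ringKrullDim_of_isPrime
    rw [MvPolynomial.ringKrullDim_of_isNoetherianRing, ringKrullDim_eq_zero_of_field] at h4
    have h5 : M.height ≤ 2 := by
      have : (M.height : WithBot ℕ∞) ≤ ((2 : ℕ∞) : WithBot ℕ∞) := by simpa using h4
      exact_mod_cast this
    have h6 : (1 : ℕ∞) + 1 + 1 ≤ 2 := by
      refine le_trans ?_ h5
      refine le_trans ?_ h3
      gcongr
      refine le_trans ?_ h2
      gcongr
      exact le_trans (by simp) h1
    exact absurd h6 (by decide)
  obtain ⟨a, ha⟩ := (MvPolynomial.isMaximal_iff_eq_vanishingIdeal_singleton (K := K)).1 hPmax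
  obtain ⟨i, hi⟩ := hx
  apply hi (a i)
  have : (X i - C (a i) : MvPolynomial (Fin 2) K) ∈ P := by
    rw [ha]; simp
  rw [hP, RingHom.mem_ker] at this
  simpa [sub_eq_zero, algebraMap_eq] using this


open IntermediateField IntermediateField.algebraAdjoinAdjoin in
theorem finrank_adjoin_eq {E : Type*} [Field E] [Algebra K E] (u w : E)
    (hu : Transcendental K u) (Ψ : MvPolynomial (Fin 2) K) (hΨ : Prime Ψ)
    (h0 : aeval ![u, w] Ψ = 0)
    (hd : 0 < ((Polynomial.Bivariate.equivMvPolynomial K).symm Ψ).natDegree) :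
    Module.finrank K⟮u⟯ K⟮u⟯⟮w⟯ = ((Polynomial.Bivariate.equivMvPolynomial K).symm Ψ).natDegree := by
  set Q := (Polynomial.Bivariate.equivMvPolynomial K).symm Ψ with hQ
  have hQi : Irreducible Q := by
    rw [hQ, MulEquiv.irreducible_iff]; exact hΨ.irreducible
  let e := Polynomial.algEquivOfTranscendental K u hu
  have : UniqueFactorizationMonoid (Algebra.adjoin K {u}) :=
    hu.uniqueFactorizationMonoid_adjoin
  let Q' := Q.mapEquiv e.toRingEquiv
  have hQ'i : Irreducible Q' := by
    simp only [Q']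
    rw [MulEquiv.irreducible_iff]; exact hQi
  have hQ'd : Q'.natDegree = Q.natDegree := by
    simp only [Q', Polynomial.mapEquiv_apply]
    exact Polynomial.natDegree_map_eq_of_injective e.toRingEquiv.injective _
  have hprim : Q'.IsPrimitive := hQ'i.isPrimitive (by omega)
  let Q'' := Q'.map (algebraMap (Algebra.adjoin K {u}) K⟮u⟯)
  have hQ''i : Irreducible Q'' :=
    (hprim.irreducible_iff_irreducible_map_fraction_map).1 hQ'i
  have hQ''d : Q''.natDegree = Q.natDegree := by
    rw [← hQ'd]
    exact Polynomial.natDegree_map_eq_of_injective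
      (FaithfulSMul.algebraMap_injective (Algebra.adjoin K {u}) K⟮u⟯) _
  have hev : Polynomial.aeval w Q'' = 0 := by
    have key : ∀ P : Polynomial (Polynomial K), Polynomial.aeval w
        ((P.mapEquiv e.toRingEquiv).map (algebraMap (Algebra.adjoin K {u}) K⟮u⟯)) =
        aeval ![u, w] (Polynomial.Bivariate.equivMvPolynomial K P) := by
      intro P
      induction P using Polynomial.induction_on' with
      | add p q hp hq =>
        simp only [map_add, Polynomial.map_add, hp, hq]
      | monomial k a =>
        rw [← Polynomial.C_mul_X_pow_eq_monomial]
        have h1 : ∀ a : Polynomial K, algebraMap K⟮u⟯ E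
            (algebraMap (Algebra.adjoin K {u}) K⟮u⟯ (e a)) = 
            aeval ![u, w] (Polynomial.Bivariate.equivMvPolynomial K (Polynomial.C a)) := by
          intro a
          rw [← IsScalarTower.algebraMap_apply]
          have h2 : algebraMap (Algebra.adjoin K {u}) E (e a) = Polynomial.aeval u a := by
            simp [e]
          rw [h2]
          clear h2
          induction a using Polynomial.induction_on' with
          | add p q hp hq => simp only [map_add, hp, hq]
          | monomial k a =>
            rw [← Polynomial.C_mul_X_pow_eq_monomial]
            simp
        simp only [map_mul, map_pow, Polynomial.mapEquiv_apply, Polynomial.map_mul,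
          Polynomial.map_C, Polynomial.map_pow, Polynomial.map_X, Polynomial.aeval_C,
          Polynomial.aeval_X, Polynomial.Bivariate.equivMvPolynomial_X, aeval_X]
        congr 1
        exact h1 a
    have := key Q
    rw [hQ, AlgEquiv.apply_symm_apply, h0] at this
    exact this
  have hQ0 : Q'' ≠ 0 := hQ''i.ne_zero
  have hintg : IsIntegral K⟮u⟯ w := by
    rw [← isAlgebraic_iff_isIntegral]
    exact ⟨Q'', hQ0, hev⟩
  rw [adjoin.finrank hintg, ← minpoly.eq_of_irreducible hQ''i hev, mul_comm,
    Polynomial.natDegree_C_mul (inv_ne_zero (Polynomial.leadingCoeff_ne_zero.2 hQ0)), hQ''d]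

end P2


section P3
variable {K : Type*} [Field K]

/-- dehomogenization of binary forms along a parameterized line `v z + w` -/
def tl (v w : Fin 2 → K) : MvPolynomial (Fin 2) K →ₐ[K] Polynomial K :=
  aeval (fun i => Polynomial.C (v i) * Polynomial.X + Polynomial.C (w i))

def bdet (v w : Fin 2 → K) : K := v 0 * w 1 - v 1 * w 0

def lone (v w : Fin 2 → K) : MvPolynomial (Fin 2) K :=
  C (bdet v w)⁻¹ * (C (w 1) * X 0 - C (w 0) * X 1)

def ltwo (v w : Fin 2 → K) : MvPolynomial (Fin 2) K :=
  C (bdet v w)⁻¹ * (C (v 0) * X 1 - C (v 1) * X 0)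

def hz (v w : Fin 2 → K) (k : ℕ) (P : Polynomial K) : MvPolynomial (Fin 2) K :=
  ∑ i ∈ Finset.range (k + 1), C (P.coeff i) * lone v w ^ i * ltwo v w ^ (k - i)

theorem tl_lone (v w : Fin 2 → K) (h : bdet v w ≠ 0) : tl v w (lone v w) = Polynomial.X := by
  simp only [tl, lone, map_mul, map_sub, aeval_X, aeval_C, Polynomial.algebraMap_eq]
  have : Polynomial.C (bdet v w)⁻¹ * Polynomial.C (bdet v w) = 1 := by
    rw [← Polynomial.C_mul, inv_mul_cancel₀ h, Polynomial.C_1]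
  have h2 : Polynomial.C (bdet v w) = Polynomial.C (v 0) * Polynomial.C (w 1) -
    Polynomial.C (v 1) * Polynomial.C (w 0) := by simp [bdet]
  rw [h2] at this
  linear_combination Polynomial.X * this

theorem tl_ltwo (v w : Fin 2 → K) (h : bdet v w ≠ 0) : tl v w (ltwo v w) = 1 := by
  simp only [tl, ltwo, map_mul, map_sub, aeval_X, aeval_C, Polynomial.algebraMap_eq]
  have : Polynomial.C (bdet v w)⁻¹ * Polynomial.C (bdet v w) = 1 := by
    rw [← Polynomial.C_mul, inv_mul_cancel₀ h, Polynomial.C_1]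
  have h2 : Polynomial.C (bdet v w) = Polynomial.C (v 0) * Polynomial.C (w 1) -
    Polynomial.C (v 1) * Polynomial.C (w 0) := by simp [bdet]
  rw [h2] at this
  linear_combination this

theorem lone_homog (v w : Fin 2 → K) : (lone v w).IsHomogeneous 1 := by
  have := (isHomogeneous_C (Fin 2) (bdet v w)⁻¹).mul
    (((isHomogeneous_C (Fin 2) (w 1)).mul (isHomogeneous_X K 0)).sub
    ((isHomogeneous_C (Fin 2) (w 0)).mul (isHomogeneous_X K 1)))
  simpa [lone] using this

theorem ltwo_homog (v w : Fin 2 → K) : (ltwo v w).IsHomogeneous 1 := by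
  have := (isHomogeneous_C (Fin 2) (bdet v w)⁻¹).mul
    (((isHomogeneous_C (Fin 2) (v 0)).mul (isHomogeneous_X K 1)).sub
    ((isHomogeneous_C (Fin 2) (v 1)).mul (isHomogeneous_X K 0)))
  simpa [ltwo] using this

theorem hz_homog (v w : Fin 2 → K) (k : ℕ) (P : Polynomial K) : (hz v w k P).IsHomogeneous k := by
  refine IsHomogeneous.sum _ _ _ fun i hi => ?_
  have := ((isHomogeneous_C (Fin 2) (P.coeff i)).mul ((lone_homog v w).pow i)).mul
    ((ltwo_homog v w).pow (k - i))
  have h2 : 0 + 1 * i + 1 * (k - i) = k := by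
    have := Finset.mem_range.1 hi
    omega
  rwa [h2] at this

theorem tl_hz (v w : Fin 2 → K) (h : bdet v w ≠ 0) (k : ℕ) (P : Polynomial K)
    (hP : P.natDegree ≤ k) : tl v w (hz v w k P) = P := by
  simp only [hz, map_sum, map_mul, map_pow, tl_lone v w h, tl_ltwo v w h, one_pow, mul_one]
  conv_rhs => rw [P.as_sum_range' (k + 1) (by omega)]
  refine Finset.sum_congr rfl fun i _ => ?_
  rw [← Polynomial.C_mul_X_pow_eq_monomial]
  simp [tl, Polynomial.algebraMap_eq]

theorem ltwo_ne_zero (v w : Fin 2 → K) (h : bdet v w ≠ 0) : ltwo v w ≠ 0 := by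
  intro h0
  have := tl_ltwo v w h
  rw [h0, map_zero] at this
  exact zero_ne_one this

theorem X_eq_lone (v w : Fin 2 → K) (h : bdet v w ≠ 0) (i : Fin 2) :
    (X i : MvPolynomial (Fin 2) K) = C (v i) * lone v w + C (w i) * ltwo v w := by
  have : (C (bdet v w)⁻¹ * C (bdet v w) : MvPolynomial (Fin 2) K) = 1 := by
    rw [← C_mul, inv_mul_cancel₀ h, C_1]
  have h2 : (C (bdet v w) : MvPolynomial (Fin 2) K) = C (v 0) * C (w 1) - C (v 1) * C (w 0) := by
    simp [bdet]
  rw [h2] at this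
  simp only [lone, ltwo]
  fin_cases i
  · simp only [Fin.zero_eta]
    linear_combination (-X 0) * this
  · simp only [Fin.mk_one]
    linear_combination (-X 1) * this

theorem tl_inj (v w : Fin 2 → K) (h : bdet v w ≠ 0) (k : ℕ) (P : MvPolynomial (Fin 2) K)
    (hP : P.IsHomogeneous k) (h0 : tl v w P = 0) : P = 0 := by
  let Q := FractionRing (MvPolynomial (Fin 2) K)
  let al := algebraMap (MvPolynomial (Fin 2) K) Q
  let l2 : Q := al (ltwo v w)
  have hl2 : l2 ≠ 0 := by
    simp only [l2, al]
    rw [Ne, IsFractionRing.to_map_eq_zero_iff]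
    exact ltwo_ne_zero v w h
  let ζ : Q := al (lone v w) / l2
  have h1 : al P = aeval (fun i => l2 * (algebraMap K Q (v i) * ζ + algebraMap K Q (w i))) P := by
    have : (fun i => l2 * (algebraMap K Q (v i) * ζ + algebraMap K Q (w i))) =
        fun i => al (X i) := by
      funext i
      rw [X_eq_lone v w h i]
      simp only [map_add, map_mul, ζ]
      have : ∀ r : K, al (C r) = algebraMap K Q r := fun r => by
        rw [IsScalarTower.algebraMap_apply K (MvPolynomial (Fin 2) K) Q]; rfl
      rw [this, this]
      have h5 : l2 * (al (lone v w) / l2) = al (lone v w) := mul_div_cancel₀ _ hl2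
      calc l2 * (algebraMap K Q (v i) * (al (lone v w) / l2) + algebraMap K Q (w i)) =
          algebraMap K Q (v i) * (l2 * (al (lone v w) / l2)) + algebraMap K Q (w i) * l2 := by ring
        _ = _ := by rw [h5]
    rw [this]
    have h3 := comp_aeval_apply X (IsScalarTower.toAlgHom K (MvPolynomial (Fin 2) K) Q) P
    rw [aeval_X_left_apply] at h3
    exact h3
  rw [aeval_smul_homog _ _ k P hP] at h1
  have h2 : aeval (fun i => algebraMap K Q (v i) * ζ + algebraMap K Q (w i)) P =
      Polynomial.aeval ζ (tl v w P) := by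
    rw [tl, comp_aeval_apply]
    simp
  rw [h2, h0, map_zero, mul_zero] at h1
  simpa [al] using h1

theorem tl_inj' (v w : Fin 2 → K) (h : bdet v w ≠ 0) (k : ℕ) (P Q : MvPolynomial (Fin 2) K)
    (hP : P.IsHomogeneous k) (hQ : Q.IsHomogeneous k) (h0 : tl v w P = tl v w Q) : P = Q := by
  rw [← sub_eq_zero]
  exact tl_inj v w h k _ (hP.sub hQ) (by rw [map_sub, h0, sub_self])

theorem formOf_homog (k : ℕ) (x : Fin (k + 1) → K) : (formOf k x).IsHomogeneous k := by
  refine IsHomogeneous.sum _ _ _ fun i _ => ?_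
  have := ((isHomogeneous_C (Fin 2) (x i)).mul ((isHomogeneous_X K 0).pow (k - i))).mul
    ((isHomogeneous_X K 1).pow (i : ℕ))
  have h2 : 0 + 1 * (k - i) + 1 * (i : ℕ) = k := by omega
  rwa [h2] at this

theorem bcoeff_formOf (k : ℕ) (x : Fin (k + 1) → K) (i : Fin (k + 1)) :
    bcoeff k (formOf k x) i = x i := by
  simp only [bcoeff, formOf, coeff_sum]
  rw [Finset.sum_eq_single i]
  · rw [mul_assoc, coeff_C_mul, X_pow_eq_monomial, X_pow_eq_monomial, monomial_mul]
    simp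
  · intro j _ hj
    rw [mul_assoc, coeff_C_mul, X_pow_eq_monomial, X_pow_eq_monomial, monomial_mul, coeff_monomial,
      if_neg, mul_zero]
    intro h
    apply hj
    have := DFunLike.congr_fun h 1
    simp at this
    exact Fin.ext this
  · simp

theorem formOf_bcoeff (k : ℕ) (P : MvPolynomial (Fin 2) K) (hP : P.IsHomogeneous k) :
    formOf k (bcoeff k P) = P := by
  ext d
  by_cases hd : d 0 + d 1 = k
  · have h1 : d = Finsupp.single 0 (k - d 1) + Finsupp.single 1 (d 1) := by
      ext i; fin_cases i
      · simp; omega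
      · simp
    have h2 := bcoeff_formOf k (bcoeff k P) ⟨d 1, by omega⟩
    simp only [bcoeff] at h2
    rw [← h1] at h2
    exact h2
  · have h3 : ∀ Q : MvPolynomial (Fin 2) K, Q.IsHomogeneous k → coeff d Q = 0 := by
      intro Q hQ
      refine hQ.coeff_eq_zero ?_
      rw [Finsupp.degree_eq_sum]
      simpa [Fin.sum_univ_two] using hd
    rw [h3 P hP, h3 _ (formOf_homog k _)]

theorem natDegree_tl_le (v w : Fin 2 → K) (k : ℕ) (P : MvPolynomial (Fin 2) K)
    (hP : P.IsHomogeneous k) : (tl v w P).natDegree ≤ k := by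
  rw [← formOf_bcoeff k P hP]
  simp only [formOf, map_sum]
  refine Polynomial.natDegree_sum_le_of_forall_le _ _ fun i _ => ?_
  simp only [map_mul, map_pow, tl, aeval_X, aeval_C, Polynomial.algebraMap_eq]
  have := i.isLt
  have h1 : ∀ j : Fin 2, ∀ m, ((Polynomial.C (v j) * Polynomial.X + Polynomial.C (w j)) ^ m).natDegree ≤ m := by
    intro j m
    refine Polynomial.natDegree_pow_le_of_le m (Polynomial.natDegree_linear_le) |>.trans (by simp)
  refine Polynomial.natDegree_mul_le_of_le (Polynomial.natDegree_mul_le_of_le 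
    (Polynomial.natDegree_C _).le (h1 0 _)) (h1 1 _) |>.trans (by omega)

theorem coeff_tl_top (v w : Fin 2 → K) (k : ℕ) (P : MvPolynomial (Fin 2) K)
    (hP : P.IsHomogeneous k) : (tl v w P).coeff k = eval v P := by
  rw [← formOf_bcoeff k P hP]
  simp only [formOf, map_sum, Polynomial.finsetSum_coeff]
  refine Finset.sum_congr rfl fun i _ => ?_
  simp only [map_mul, map_pow, tl, aeval_X, aeval_C, Polynomial.algebraMap_eq, eval_C, eval_X]
  have := i.isLt
  have h1 : ∀ j : Fin 2, ∀ m, ((Polynomial.C (v j) * Polynomial.X + Polynomial.C (w j)) ^ m).natDegree ≤ m := by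
    intro j m
    refine Polynomial.natDegree_pow_le_of_le m (Polynomial.natDegree_linear_le) |>.trans (by simp)
  have h2 : ∀ j : Fin 2, ∀ m, ((Polynomial.C (v j) * Polynomial.X + Polynomial.C (w j)) ^ m).coeff m = v j ^ m := by
    intro j m
    have := Polynomial.coeff_pow_of_natDegree_le (m := m) (n := 1) (p := Polynomial.C (v j) * Polynomial.X + Polynomial.C (w j))
      (Polynomial.natDegree_linear_le)
    simpa using this
  rw [mul_assoc, Polynomial.coeff_C_mul, mul_assoc]
  congr 1
  have h3 := Polynomial.coeff_mul_add_eq_of_natDegree_le (h1 0 (k - i)) (h1 1 i)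
  rw [h2, h2] at h3
  rw [← h3]
  congr 1
  omega

theorem eval_tl (v w : Fin 2 → K) (r : K) (P : MvPolynomial (Fin 2) K) :
    (tl v w P).eval r = eval (fun i => v i * r + w i) P := by
  rw [tl, ← Polynomial.coe_aeval_eq_eval, ← MvPolynomial.coe_aeval_eq_eval]
  simp only [RingHom.coe_coe]
  rw [comp_aeval_apply]
  simp

theorem natDegree_tl (v w : Fin 2 → K) (k : ℕ) (P : MvPolynomial (Fin 2) K)
    (hP : P.IsHomogeneous k) (h0 : eval v P ≠ 0) : (tl v w P).natDegree = k := 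
  le_antisymm (natDegree_tl_le v w k P hP)
    (Polynomial.le_natDegree_of_ne_zero (by rwa [coeff_tl_top v w k P hP]))

theorem hom_dvd (v w : Fin 2 → K) (h : bdet v w ≠ 0) (k l : ℕ) (P Q : MvPolynomial (Fin 2) K)
    (hP : P.IsHomogeneous k) (hQ : Q.IsHomogeneous l) (h0 : eval v P ≠ 0)
    (hd : tl v w P ∣ tl v w Q) : P ∣ Q := by
  obtain ⟨R, hR⟩ := hd
  by_cases hR0 : R = 0
  · rw [hR0, mul_zero] at hR
    rw [tl_inj v w h l Q hQ hR]; exact dvd_zero _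
  have hP0 : tl v w P ≠ 0 := fun h1 => h0 (by rw [← coeff_tl_top v w k P hP, h1]; simp)
  have hdeg := Polynomial.natDegree_mul hP0 hR0
  rw [← hR, natDegree_tl v w k P hP h0] at hdeg
  have hl := natDegree_tl_le v w l Q hQ
  refine ⟨hz v w (l - k) R, tl_inj' v w h l _ _ hQ ?_ ?_⟩
  · have := hP.mul (hz_homog v w (l - k) R)
    rwa [show k + (l - k) = l by omega] at this
  · rw [map_mul, tl_hz v w h _ _ (by omega), hR]

/-- divisors of homogeneous polynomials are homogeneous -/
theorem homog_of_dvd {σ : Type*} (P Q : MvPolynomial σ K) (k : ℕ) (hQ : Q.IsHomogeneous k)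
    (hQ0 : Q ≠ 0) (hd : P ∣ Q) : ∃ d, P.IsHomogeneous d := by
  obtain ⟨R, rfl⟩ := hd
  have hP0 : P ≠ 0 := left_ne_zero_of_mul hQ0
  have hR0 : R ≠ 0 := right_ne_zero_of_mul hQ0
  let θ : MvPolynomial σ K →ₐ[K] Polynomial (MvPolynomial σ K) :=
    aeval (fun i => Polynomial.X * Polynomial.C (X i))
  have hc : ∀ (A : MvPolynomial σ K) , θ A =
      ∑ i ∈ Finset.range (A.totalDegree + 1), Polynomial.C (homogeneousComponent i A) * Polynomial.X ^ i := by
    intro A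
    conv_lhs => rw [← sum_homogeneousComponent A, map_sum]
    refine Finset.sum_congr rfl fun i _ => ?_
    have := aeval_smul_homog (fun j : σ => (Polynomial.C (X j) : Polynomial (MvPolynomial σ K))) Polynomial.X i _
      (homogeneousComponent_isHomogeneous i A)
    rw [this, mul_comm]
    congr 1
    have h3 := comp_aeval_apply (X : σ → MvPolynomial σ K) (Polynomial.CAlgHom (R := K) (A := MvPolynomial σ K)) (homogeneousComponent i A)
    rw [aeval_X_left_apply] at h3
    exact h3.symm
  have hco : ∀ (A : MvPolynomial σ K) i, (θ A).coeff i = homogeneousComponent i A := by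
    intro A i
    rw [hc, Polynomial.finsetSum_coeff]
    simp only [Polynomial.coeff_C_mul_X_pow]
    rw [Finset.sum_ite_eq]
    split_ifs with h
    · rfl
    · rw [homogeneousComponent_eq_zero]
      simpa using h
  have hinj : ∀ A, θ A = 0 → A = 0 := by
    intro A h
    rw [← sum_homogeneousComponent A]
    refine Finset.sum_eq_zero fun i _ => ?_
    rw [← hco, h]; simp
  have hm : θ P * θ R = Polynomial.C (P * R) * Polynomial.X ^ k := by
    rw [← map_mul]
    ext1 i
    rw [hco, Polynomial.coeff_C_mul_X_pow, homogeneousComponent_of_mem ((mem_homogeneousSubmodule _ _).2 hQ)]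
  have h1 := Polynomial.natDegree_mul (fun h => hP0 (hinj P h)) (fun h => hR0 (hinj R h))
  have h2 := Polynomial.natTrailingDegree_mul (fun h => hP0 (hinj P h)) (fun h => hR0 (hinj R h))
  rw [hm, Polynomial.natDegree_C_mul_X_pow _ _ hQ0] at h1
  rw [hm, Polynomial.natTrailingDegree_mul_X_pow (by simpa using hQ0), Polynomial.natTrailingDegree_C, zero_add] at h2
  have h3 := (θ P).natTrailingDegree_le_natDegree
  have h4 := (θ R).natTrailingDegree_le_natDegree
  refine ⟨(θ P).natDegree, ?_⟩
  have : P = homogeneousComponent (θ P).natDegree P := by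
    conv_lhs => rw [← sum_homogeneousComponent P]
    have h6 : ∀ i, i ≠ (θ P).natDegree → homogeneousComponent i P = 0 := by
      intro i hi
      rw [← hco]
      rcases lt_or_gt_of_ne hi with h | h
      · exact Polynomial.coeff_eq_zero_of_lt_natTrailingDegree (by omega)
      · exact Polynomial.coeff_eq_zero_of_natDegree_lt h
    rw [Finset.sum_eq_single (θ P).natDegree (fun i _ hi => h6 i hi)]
    intro h
    exact homogeneousComponent_eq_zero _ _ (by simpa using h)
  have h9 := homogeneousComponent_isHomogeneous (θ P).natDegree P
  generalize (θ P).natDegree = d at this h9 ⊢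
  rw [← this] at h9
  exact h9
end P3


section P4
variable {K : Type*} [Field K]

structure CurH (n : ℕ) (f : Fin 3 → MvPolynomial (Fin 2) K) (F : MvPolynomial (Fin 3) K) : Prop where
  hn : 3 ≤ n
  hf : IsProperParam n f
  irr : Irreducible F
  hom : F.IsHomogeneous n
  van : aeval f F = 0

theorem exists_eval_ne [Infinite K] {σ : Type*} (h : MvPolynomial σ K) (h0 : h ≠ 0) : ∃ v, eval v h ≠ 0 := by
  by_contra hc
  push Not at hc
  exact h0 (MvPolynomial.funext fun x => by rw [hc x, map_zero])

theorem good_basis [Infinite K] (h : MvPolynomial (Fin 2) K) (h0 : h ≠ 0) :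
    ∃ v w : Fin 2 → K, bdet v w ≠ 0 ∧ eval v h ≠ 0 := by
  obtain ⟨v, hv⟩ := exists_eval_ne (h * X 0) (mul_ne_zero h0 (X_ne_zero 0))
  rw [map_mul, eval_X] at hv
  exact ⟨v, ![0, 1], by simpa [bdet] using right_ne_zero_of_mul hv, left_ne_zero_of_mul hv⟩

theorem line_ne_zero (v w : Fin 2 → K) (h : bdet v w ≠ 0) (r : K) :
    (fun i => v i * r + w i) ≠ 0 := by
  intro h0
  have h1 := congrFun h0 0
  have h2 := congrFun h0 1
  simp only [Pi.zero_apply] at h1 h2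
  apply h
  simp only [bdet]
  linear_combination (v 0) * h2 - v 1 * h1

theorem exists_zero [IsAlgClosed K] (n : ℕ) (hn : 0 < n) (h : MvPolynomial (Fin 2) K)
    (hh : h.IsHomogeneous n) : ∃ v : Fin 2 → K, v ≠ 0 ∧ eval v h = 0 := by
  have := IsAlgClosed.instInfinite (K := K)
  by_cases h0 : h = 0
  · exact ⟨fun _ => 1, fun hc => one_ne_zero (congrFun hc 0), by rw [h0, map_zero]⟩
  obtain ⟨v, w, hb, hv⟩ := good_basis h h0
  have hd := natDegree_tl v w n h hh hv
  obtain ⟨r, hr⟩ := IsAlgClosed.exists_root (tl v w h) (by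
    rw [Polynomial.degree_eq_natDegree (by rintro h1; rw [h1] at hd; simp at hd; omega), hd]
    exact_mod_cast hn.ne')
  exact ⟨_, line_ne_zero v w hb r, by rw [← eval_tl]; exact hr⟩

theorem not_both_const [IsAlgClosed K] {n : ℕ} {f : Fin 3 → MvPolynomial (Fin 2) K}
    {F : MvPolynomial (Fin 3) K} (H : CurH n f F) (b : Fin 3) (a : Fin 2 → K)
    (h : ∀ i, f (chartEmb b i) = C (a i) * f b) : False := by
  obtain ⟨v, hv, h0⟩ := exists_zero n (by have := H.hn; omega) (f b) (H.hf.homog b)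
  apply H.hf.no_common_zero v hv
  funext u
  simp only [evalVec, Pi.zero_apply]
  rcases chartEmb_cases b u with h1 | h1 | h1
  · rw [h1, h0]
  · rw [h1, h, map_mul, h0, mul_zero]
  · rw [h1, h, map_mul, h0, mul_zero]

theorem exists_fne {n : ℕ} {f : Fin 3 → MvPolynomial (Fin 2) K}
    {F : MvPolynomial (Fin 3) K} (H : CurH n f F) : ∃ b, f b ≠ 0 := by
  by_contra hc
  push Not at hc
  exact H.hf.no_common_zero (fun _ => 1) (fun hc => one_ne_zero (congrFun hc 0))
    (by funext u; simp [evalVec, hc])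

theorem F_dvd [IsAlgClosed K] {n : ℕ} {f : Fin 3 → MvPolynomial (Fin 2) K}
    {F : MvPolynomial (Fin 3) K} (H : CurH n f F) (m : ℕ) (A : MvPolynomial (Fin 3) K)
    (hA : A.IsHomogeneous m) (hAf : aeval f A = 0) : F ∣ A := by
  obtain ⟨b, hb⟩ := exists_fne H
  let Q := FractionRing (MvPolynomial (Fin 2) K)
  let y : Fin 3 → Q := fun j => algebraMap (MvPolynomial (Fin 2) K) Q (f j)
  have hy : y b ≠ 0 := by
    simp only [y]
    rw [Ne, IsFractionRing.to_map_eq_zero_iff]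
    exact hb
  let x : Fin 2 → Q := fun i => y (chartEmb b i) / y b
  have hx : ∀ i, y (chartEmb b i) = y b * x i := fun i => (mul_div_cancel₀ _ hy).symm
  have hyA : ∀ (k : ℕ) (B : MvPolynomial (Fin 3) K), B.IsHomogeneous k → aeval f B = 0 →
      aeval x (aeval (dehomMap b) B : MvPolynomial (Fin 2) K) = 0 := by
    intro k B hB hB0
    have h1 := aeval_eq_dehom b y x hx k B hB
    have h2 := comp_aeval_apply f (IsScalarTower.toAlgHom K (MvPolynomial (Fin 2) K) Q) B
    rw [hB0, map_zero] at h2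
    have h3 : aeval y B = 0 := h2.symm
    rw [h3] at h1
    exact (mul_eq_zero.1 h1.symm).resolve_left (pow_ne_zero _ hy)
  have hP := dehom_prime b n (by have := H.hn; omega) F H.hom H.irr
  have hd := ker_eq_span x (by
    by_contra hc
    push Not at hc
    choose a ha using hc
    apply not_both_const H b a
    intro i
    apply IsFractionRing.injective (MvPolynomial (Fin 2) K) Q
    have := hx i
    rw [ha i] at this
    rw [map_mul]
    rw [show (algebraMap (MvPolynomial (Fin 2) K) Q) (C (a i)) = algebraMap K Q (a i) by
      rw [IsScalarTower.algebraMap_apply K (MvPolynomial (Fin 2) K) Q]; rfl]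
    rw [mul_comm]
    exact this) _ hP (hyA n F H.hom H.van) _ (hyA m A hA hAf)
  obtain ⟨R, hR⟩ := hd
  obtain ⟨N0, hN⟩ := exists_hom b R
  obtain ⟨B, hB, hBR⟩ := hN (N0 + m) (by omega)
  have heq : F * B = A * X b ^ (n + N0) := by
    refine dehom_eq_of b (n + (N0 + m)) _ _ (H.hom.mul hB) ?_ ?_
    · have := hA.mul ((isHomogeneous_X K b).pow (n + N0))
      rwa [show m + 1 * (n + N0) = n + (N0 + m) by ring] at this
    · rw [map_mul, map_mul, map_pow, aeval_X, dehomMap_self, one_pow, mul_one, hBR, hR]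
  have hp : Prime F := H.irr.prime
  rcases hp.dvd_or_dvd (Dvd.intro _ heq) with h | h
  · exact h
  · exact absurd (hp.dvd_of_dvd_pow h) (not_dvd_X b n (by have := H.hn; omega) F H.hom H.irr)

theorem f_LI [IsAlgClosed K] {n : ℕ} {f : Fin 3 → MvPolynomial (Fin 2) K}
    {F : MvPolynomial (Fin 3) K} (H : CurH n f F) (μ : Fin 3 → K)
    (h : ∑ u, C (μ u) * f u = 0) : μ = 0 := by
  let A : MvPolynomial (Fin 3) K := ∑ u, C (μ u) * X u
  have hA : A.IsHomogeneous 1 := IsHomogeneous.sum _ _ _ fun u _ => isHomogeneous_C_mul_X _ _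
  have hd := F_dvd H 1 A hA (by simpa [A, algebraMap_eq] using h)
  have hA0 : A = 0 := by
    by_contra h0
    obtain ⟨R, hR⟩ := hd
    have hR0 : R ≠ 0 := by rintro rfl; rw [mul_zero] at hR; exact h0 hR
    have h2 := totalDegree_mul_of_isDomain H.irr.ne_zero hR0
    rw [← hR, hA.totalDegree h0, H.hom.totalDegree H.irr.ne_zero] at h2
    have := H.hn
    omega
  funext u
  have : eval (Pi.single u 1) A = 0 := by rw [hA0, map_zero]
  simpa [A, Pi.single_apply] using this

/-- the forms `f_{e_i} - a_i f_c` -/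
def fp (f : Fin 3 → MvPolynomial (Fin 2) K) (p : Fin 3 → K) (c : Fin 3) (i : Fin 2) :
    MvPolynomial (Fin 2) K := f (chartEmb c i) - C (affOf p c i) * f c

theorem fp_homog {n : ℕ} {f : Fin 3 → MvPolynomial (Fin 2) K}
    {F : MvPolynomial (Fin 3) K} (H : CurH n f F) (p : Fin 3 → K) (c : Fin 3) (i : Fin 2) :
    (fp f p c i).IsHomogeneous n := by
  have := (isHomogeneous_C (Fin 2) (affOf p c i)).mul (H.hf.homog c)
  rw [zero_add] at this
  exact (H.hf.homog _).sub this

theorem fp_LI [IsAlgClosed K] {n : ℕ} {f : Fin 3 → MvPolynomial (Fin 2) K}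
    {F : MvPolynomial (Fin 3) K} (H : CurH n f F) (p : Fin 3 → K) (c : Fin 3) (s t r : K)
    (h : C s * fp f p c 0 + C t * fp f p c 1 + C r * f c = 0) : s = 0 ∧ t = 0 ∧ r = 0 := by
  let μ : Fin 3 → K := fun u => if u = c then r - s * affOf p c 0 - t * affOf p c 1
    else if u = chartEmb c 0 then s else t
  have h1 : μ c = r - s * affOf p c 0 - t * affOf p c 1 := by simp [μ]
  have h2 : μ (chartEmb c 0) = s := by simp [μ, chartEmb_ne]
  have h3 : μ (chartEmb c 1) = t := by
    simp only [μ]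
    rw [if_neg (chartEmb_ne c 1), if_neg (chartEmb_ne01 c).symm]
  have hs : ∀ g : Fin 3 → MvPolynomial (Fin 2) K, ∑ u, g u = g c + g (chartEmb c 0) + g (chartEmb c 1) := by
    intro g
    fin_cases c <;> simp [Fin.sum_univ_three, chartEmb] <;> ring
  have hμ := f_LI H μ (by
    rw [hs, h1, h2, h3]
    simp only [fp, C_sub, C_mul] at h ⊢
    linear_combination h)
  rw [hμ] at h1 h2 h3
  simp only [Pi.zero_apply] at h1 h2 h3
  subst h2; subst h3
  refine ⟨rfl, rfl, ?_⟩
  simpa using h1.symm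

theorem dvd_cross_iff (f : Fin 3 → MvPolynomial (Fin 2) K) (p : Fin 3 → K) (c : Fin 3)
    (hc : p c ≠ 0) (D : MvPolynomial (Fin 2) K) :
    (∀ i j : Fin 3, i < j → D ∣ crossDiff f p i j) ↔ ∀ i, D ∣ fp f p c i := by
  have hanti : ∀ i j, crossDiff f p i j = - crossDiff f p j i := by
    intro i j; simp [crossDiff]
  have hself : ∀ i, crossDiff f p i i = 0 := by
    intro i; simp [crossDiff]
  have h1 : (∀ i j : Fin 3, i < j → D ∣ crossDiff f p i j) ↔ ∀ i j, D ∣ crossDiff f p i j := by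
    refine ⟨fun h i j => ?_, fun h i j _ => h i j⟩
    rcases lt_trichotomy i j with h2 | h2 | h2
    · exact h i j h2
    · rw [h2, hself]; exact dvd_zero _
    · rw [hanti]; exact (dvd_neg).2 (h j i h2)
  rw [h1]
  have h2 : ∀ i, crossDiff f p c (chartEmb c i) = C (p c) * fp f p c i := by
    intro i
    simp only [crossDiff, fp, affOf, mul_sub, ← mul_assoc, ← C_mul]
    rw [mul_div_cancel₀ _ hc]
  constructor
  · intro h i
    have := h c (chartEmb c i)
    rw [h2] at this
    have h3 : fp f p c i = C (p c)⁻¹ * (C (p c) * fp f p c i) := by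
      rw [← mul_assoc, ← C_mul, inv_mul_cancel₀ hc, C_1, one_mul]
    rw [h3]
    exact this.mul_left _
  · intro h i j
    have h4 : ∀ i, D ∣ crossDiff f p c i := by
      intro i
      rcases chartEmb_cases c i with h5 | h5 | h5
      · rw [h5, hself]; exact dvd_zero _
      · rw [h5, h2]; exact (h 0).mul_left _
      · rw [h5, h2]; exact (h 1).mul_left _
    have h6 : crossDiff f p i j = C (p c)⁻¹ * (C (p i) * crossDiff f p c j - C (p j) * crossDiff f p c i) := by
      have : (C (p c)⁻¹ * C (p c) : MvPolynomial (Fin 2) K) = 1 := by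
        rw [← C_mul, inv_mul_cancel₀ hc, C_1]
      simp only [crossDiff]
      linear_combination (-(C (p i) * f j - C (p j) * f i)) * this
    rw [h6]
    exact (((h4 j).mul_left _).sub ((h4 i).mul_left _)).mul_left _

theorem exists_gcd (f : Fin 3 → MvPolynomial (Fin 2) K) (p : Fin 3 → K) :
    ∃ G, IsGcdOfCross f p G := by
  classical
  let _ := UniqueFactorizationMonoid.toGCDMonoid (MvPolynomial (Fin 2) K)
  refine ⟨gcd (crossDiff f p 0 1) (gcd (crossDiff f p 0 2) (crossDiff f p 1 2)), ?_, ?_⟩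
  · intro i j hij
    have h1 := gcd_dvd_left (crossDiff f p 0 1) (gcd (crossDiff f p 0 2) (crossDiff f p 1 2))
    have h2 := gcd_dvd_right (crossDiff f p 0 1) (gcd (crossDiff f p 0 2) (crossDiff f p 1 2))
    have h3 := h2.trans (gcd_dvd_left (crossDiff f p 0 2) (crossDiff f p 1 2))
    have h4 := h2.trans (gcd_dvd_right (crossDiff f p 0 2) (crossDiff f p 1 2))
    fin_cases i <;> fin_cases j <;> first | exact h1 | exact h3 | exact h4 | (exact absurd hij (by decide))
  · intro D hD
    exact dvd_gcd (hD 0 1 (by decide)) (dvd_gcd (hD 0 2 (by decide)) (hD 1 2 (by decide)))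

/-- Structure of the gcd -/
theorem gcd_struct [IsAlgClosed K] {n : ℕ} {f : Fin 3 → MvPolynomial (Fin 2) K}
    {F : MvPolynomial (Fin 3) K} (H : CurH n f F) (p : Fin 3 → K) (c : Fin 3) (hc : p c ≠ 0)
    (G : MvPolynomial (Fin 2) K) (hG : IsGcdOfCross f p G) :
    ∃ (d : ℕ) (A : Fin 2 → MvPolynomial (Fin 2) K), d ≤ n ∧ G.IsHomogeneous d ∧ G ≠ 0 ∧
      (∀ i, (A i).IsHomogeneous (n - d)) ∧ (∀ i, fp f p c i = G * A i) ∧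
      (∀ v w, bdet v w ≠ 0 → IsCoprime (tl v w (A 0)) (tl v w (A 1))) := by
  have hne : ∀ i, fp f p c i ≠ 0 := by
    intro i h
    have h1 := fp_LI H p c 1 0 0
    have h2 := fp_LI H p c 0 1 0
    fin_cases i
    · simp only [Fin.zero_eta] at h; simp [h] at h1
    · simp only [Fin.mk_one] at h; simp [h] at h2
  have hdv := (dvd_cross_iff f p c hc G).1 hG.1
  have huniv : ∀ D, (∀ i, D ∣ fp f p c i) → D ∣ G := fun D hD =>
    hG.2 D ((dvd_cross_iff f p c hc D).2 hD)
  obtain ⟨d, hd⟩ := homog_of_dvd G _ n (fp_homog H p c 0) (hne 0) (hdv 0)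
  have hG0 : G ≠ 0 := by
    rintro rfl; exact hne 0 (zero_dvd_iff.1 (hdv 0))
  choose A hA using hdv
  have hA0 : ∀ i, A i ≠ 0 := by
    intro i h; apply hne i; rw [hA, h, mul_zero]
  have hAh : ∀ i, ∃ e, d + e = n ∧ (A i).IsHomogeneous e := by
    intro i
    obtain ⟨e, he⟩ := homog_of_dvd (A i) _ n (fp_homog H p c i) (hne i) ⟨G, by rw [hA i]; ring⟩
    refine ⟨e, ?_, he⟩
    have h1 := (hd.mul he)
    rw [← hA i] at h1
    exact h1.inj_right (fp_homog H p c i) (hne i)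
  have hdn : d ≤ n := by obtain ⟨e, he, _⟩ := hAh 0; omega
  have hAh' : ∀ i, (A i).IsHomogeneous (n - d) := by
    intro i; obtain ⟨e, he, h⟩ := hAh i; rwa [show n - d = e by omega]
  refine ⟨d, A, hdn, hd, hG0, hAh', hA, fun v w hb => ?_⟩
  rw [Polynomial.isCoprime_iff_aeval_ne_zero_of_isAlgClosed K K]
  intro r
  by_contra hcon
  push Not at hcon
  have hℓ : tl v w (hz v w 1 (Polynomial.X - Polynomial.C r)) = Polynomial.X - Polynomial.C r :=
    tl_hz v w hb 1 _ (Polynomial.natDegree_X_sub_C r).le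
  set ℓ := hz v w 1 (Polynomial.X - Polynomial.C r) with hℓd
  have hℓh : ℓ.IsHomogeneous 1 := hz_homog _ _ _ _
  have hℓv : eval v ℓ ≠ 0 := by
    rw [← coeff_tl_top v w 1 ℓ hℓh, hℓ]; simp
  have hdiv : ∀ i, ℓ ∣ A i := by
    intro i
    refine hom_dvd v w hb 1 (n - d) _ _ hℓh (hAh' i) hℓv ?_
    rw [hℓ, Polynomial.dvd_iff_isRoot, Polynomial.IsRoot, ← Polynomial.coe_aeval_eq_eval]
    fin_cases i
    · exact hcon.1
    · exact hcon.2
  have h1 : G * ℓ ∣ G := huniv _ fun i => by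
    rw [hA i]; exact mul_dvd_mul_left G (hdiv i)
  have hℓ0 : ℓ ≠ 0 := by rintro h; rw [h] at hℓv; simp at hℓv
  have h2 : IsUnit ℓ := by
    obtain ⟨R, hR⟩ := h1
    have : G * (ℓ * R) = G * 1 := by rw [← mul_assoc, ← hR, mul_one]
    exact IsUnit.of_mul_eq_one _ (mul_left_cancel₀ hG0 this)
  rw [MvPolynomial.isUnit_iff_eq_C_of_isReduced] at h2
  obtain ⟨s, _, hs⟩ := h2
  have h3 := hℓh.totalDegree hℓ0
  rw [hs, totalDegree_C] at h3
  omega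
end P4


section P5
variable {K : Type*} [Field K]

/-- linear change of coordinates moving the point `p` to `(0:0:1)`. -/
def csub (p : Fin 3 → K) (c : Fin 3) (j : Fin 3) : MvPolynomial (Fin 3) K :=
  if j = c then X 2 else if j = chartEmb c 0 then X 0 + C (affOf p c 0) * X 2
    else X 1 + C (affOf p c 1) * X 2

def csubinv (p : Fin 3 → K) (c : Fin 3) : Fin 3 → MvPolynomial (Fin 3) K :=
  ![X (chartEmb c 0) - C (affOf p c 0) * X c, X (chartEmb c 1) - C (affOf p c 1) * X c, X c]

theorem csub_c (p : Fin 3 → K) (c : Fin 3) : csub p c c = X 2 := by simp [csub]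
theorem csub_0 (p : Fin 3 → K) (c : Fin 3) :
    csub p c (chartEmb c 0) = X 0 + C (affOf p c 0) * X 2 := by
  simp [csub, chartEmb_ne]
theorem csub_1 (p : Fin 3 → K) (c : Fin 3) :
    csub p c (chartEmb c 1) = X 1 + C (affOf p c 1) * X 2 := by
  simp only [csub]
  rw [if_neg (chartEmb_ne c 1), if_neg (chartEmb_ne01 c).symm]

def cequiv (p : Fin 3 → K) (c : Fin 3) : MvPolynomial (Fin 3) K ≃ₐ[K] MvPolynomial (Fin 3) K :=
  AlgEquiv.ofAlgHom (aeval (csub p c)) (aeval (csubinv p c))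
    (by
      ext1 j
      fin_cases j <;>
      simp [csubinv, csub_c, csub_0, csub_1, algebraMap_eq])
    (by
      ext1 j
      simp only [AlgHom.comp_apply, aeval_X, AlgHom.id_apply]
      rcases chartEmb_cases c j with h | h | h
      · rw [h, csub_c]; simp [csubinv]
      · rw [h, csub_0]; simp [csubinv, algebraMap_eq]
      · rw [h, csub_1]; simp [csubinv, algebraMap_eq])

theorem cequiv_apply (p : Fin 3 → K) (c : Fin 3) (A : MvPolynomial (Fin 3) K) :
    cequiv p c A = aeval (csub p c) A := rfl

theorem cequiv_homog (p : Fin 3 → K) (c : Fin 3) (n : ℕ) (A : MvPolynomial (Fin 3) K)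
    (hA : A.IsHomogeneous n) : (cequiv p c A).IsHomogeneous n := by
  rw [cequiv_apply]
  have := hA.aeval (S := K) (n := 1) (csub p c) (by
    intro j
    rcases chartEmb_cases c j with h | h | h
    · rw [h, csub_c]; exact isHomogeneous_X _ _
    · rw [h, csub_0]; exact (isHomogeneous_X _ _).add (isHomogeneous_C_mul_X _ _)
    · rw [h, csub_1]; exact (isHomogeneous_X _ _).add (isHomogeneous_C_mul_X _ _))
  rwa [one_mul] at this

theorem linear_form_eq (A : MvPolynomial (Fin 3) K) (hA : A.IsHomogeneous 1) :
    ∃ l : Fin 3 → K, A = ∑ u, C (l u) * X u := by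
  have h1 : A ∈ homogeneousSubmodule (Fin 3) K 1 := (mem_homogeneousSubmodule _ _).2 hA
  rw [homogeneousSubmodule_one_eq_span_X] at h1
  obtain ⟨l, hl⟩ := (Submodule.mem_span_range_iff_exists_fun K).1 h1
  exact ⟨l, by rw [← hl]; simp [smul_eq_C_mul]⟩

abbrev J01 (K : Type*) [Field K] : Ideal (MvPolynomial (Fin 3) K) := Ideal.span (X '' ({0, 1} : Set (Fin 3)))

theorem sum_chart {M : Type*} [AddCommMonoid M] (c : Fin 3) (g : Fin 3 → M) :
    ∑ u, g u = g c + g (chartEmb c 0) + g (chartEmb c 1) := by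
  fin_cases c <;> simp [Fin.sum_univ_three, chartEmb] <;> abel

theorem pointIdeal_map (p : Fin 3 → K) (c : Fin 3) (hc : p c ≠ 0) :
    (pointIdeal p).map (cequiv p c : MvPolynomial (Fin 3) K →+* MvPolynomial (Fin 3) K) = J01 K := by
  have ha : ∀ i, p (chartEmb c i) = affOf p c i * p c := fun i => by
    simp only [affOf]; rw [div_mul_cancel₀ _ hc]
  apply le_antisymm
  · rw [pointIdeal, Ideal.map_span, Ideal.span_le]
    rintro _ ⟨L, ⟨hL, hLp⟩, rfl⟩
    obtain ⟨l, rfl⟩ := linear_form_eq L hL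
    have h0 : (X 0 : MvPolynomial (Fin 3) K) ∈ J01 K := Ideal.subset_span ⟨0, by simp, rfl⟩
    have h1 : (X 1 : MvPolynomial (Fin 3) K) ∈ J01 K := Ideal.subset_span ⟨1, by simp, rfl⟩
    have h2 : cequiv p c (∑ u, C (l u) * X u) =
        C (l (chartEmb c 0)) * X 0 + C (l (chartEmb c 1)) * X 1 := by
      rw [cequiv_apply]
      rw [sum_chart c] at hLp ⊢
      simp only [map_add, map_mul, aeval_X, eval_X, eval_C, aeval_C, algebraMap_eq, ha] at hLp ⊢
      rw [csub_c, csub_0, csub_1]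
      have h3 : l c + l (chartEmb c 0) * affOf p c 0 + l (chartEmb c 1) * affOf p c 1 = 0 := by
        apply mul_right_cancel₀ hc
        linear_combination hLp
      have h4 : (C (l c + l (chartEmb c 0) * affOf p c 0 + l (chartEmb c 1) * affOf p c 1) : MvPolynomial (Fin 3) K) = 0 := by
        rw [h3, C_0]
      simp only [C_add, C_mul] at h4
      linear_combination X 2 * h4
    simp only [SetLike.mem_coe]
    change cequiv p c _ ∈ _
    rw [h2]
    exact Ideal.add_mem _ (Ideal.mul_mem_left _ _ h0) (Ideal.mul_mem_left _ _ h1)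
  · have key : ∀ i : Fin 2, X (chartEmb c i) - C (affOf p c i) * X c ∈ pointIdeal p := by
      intro i
      apply Ideal.subset_span
      refine ⟨(isHomogeneous_X _ _).sub (isHomogeneous_C_mul_X _ _), ?_⟩
      simp [ha]
    rw [J01, Ideal.span_le]
    rintro _ ⟨j, hj, rfl⟩
    simp only [Set.mem_insert_iff, Set.mem_singleton_iff] at hj
    rcases hj with rfl | rfl
    · have := Ideal.mem_map_of_mem (cequiv p c : MvPolynomial (Fin 3) K →+* MvPolynomial (Fin 3) K) (key 0)
      have h2 : cequiv p c (X (chartEmb c 0) - C (affOf p c 0) * X c) = X 0 := by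
        rw [cequiv_apply]
        simp [csub_0, csub_c, algebraMap_eq]
      rw [← h2]
      exact this
    · have := Ideal.mem_map_of_mem (cequiv p c : MvPolynomial (Fin 3) K →+* MvPolynomial (Fin 3) K) (key 1)
      have h2 : cequiv p c (X (chartEmb c 1) - C (affOf p c 1) * X c) = X 1 := by
        rw [cequiv_apply]
        simp [csub_1, csub_c, algebraMap_eq]
      rw [← h2]
      exact this

theorem mem_pointIdeal_pow (p : Fin 3 → K) (c : Fin 3) (hc : p c ≠ 0) (m : ℕ)
    (A : MvPolynomial (Fin 3) K) : A ∈ pointIdeal p ^ m ↔ cequiv p c A ∈ J01 K ^ m := by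
  rw [← pointIdeal_map p c hc, ← Ideal.map_pow]
  constructor
  · exact fun h => Ideal.mem_map_of_mem (cequiv p c : MvPolynomial (Fin 3) K →+* MvPolynomial (Fin 3) K) h
  · intro h
    have h2 := (Ideal.mem_map_iff_of_surjective (cequiv p c : MvPolynomial (Fin 3) K →+* MvPolynomial (Fin 3) K)
      (cequiv p c).surjective).1 h
    obtain ⟨B, hB, hBA⟩ := h2
    rwa [(cequiv p c).injective hBA] at hB

theorem mem_J_pow_iff (m : ℕ) (A : MvPolynomial (Fin 3) K) :
    A ∈ J01 K ^ m ↔ ∀ d ∈ A.support, m ≤ d 0 + d 1 := by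
  constructor
  · induction m generalizing A with
    | zero => intros; omega
    | succ m ih =>
      intro h
      rw [pow_succ] at h
      refine Submodule.mul_induction_on h ?_ ?_
      · intro B hB E hE d hd
        have h1 := support_mul B E hd
        rw [Finset.mem_add] at h1
        obtain ⟨d1, hd1, d2, hd2, rfl⟩ := h1
        have h2 := ih B hB d1 hd1
        obtain ⟨i, hi, hi0⟩ := mem_ideal_span_X_image.1 hE d2 hd2
        simp only [Set.mem_insert_iff, Set.mem_singleton_iff] at hi
        simp only [Finsupp.add_apply]
        rcases hi with rfl | rfl <;> omega
      · intro B E hB hE d hd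
        have := support_add hd
        rw [Finset.mem_union] at this
        rcases this with h | h
        · exact hB d h
        · exact hE d h
  · intro h
    rw [A.as_sum]
    refine Ideal.sum_mem _ fun d hd => ?_
    have h0 : (X 0 : MvPolynomial (Fin 3) K) ∈ J01 K := Ideal.subset_span ⟨0, by simp, rfl⟩
    have h1 : (X 1 : MvPolynomial (Fin 3) K) ∈ J01 K := Ideal.subset_span ⟨1, by simp, rfl⟩
    rw [monomial_eq, Finsupp.prod_fintype _ _ (by simp), Fin.prod_univ_three]
    have h2 := Ideal.mul_mem_mul (Ideal.pow_mem_pow h0 (d 0)) (Ideal.pow_mem_pow h1 (d 1))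
    rw [← pow_add] at h2
    have h3 := Ideal.pow_le_pow_right (h d hd) h2
    exact Ideal.mul_mem_left _ _ (Ideal.mul_mem_right _ _ h3)

theorem multAt_eq (n : ℕ) (F : MvPolynomial (Fin 3) K) (hF : F.IsHomogeneous n) (hF0 : F ≠ 0)
    (p : Fin 3 → K) (c : Fin 3) (hc : p c ≠ 0) :
    degreeOf 2 (cequiv p c F) + multAt F p = n ∧ F ∈ pointIdeal p ^ multAt F p := by
  set F' := cequiv p c F with hF'
  have hh : F'.IsHomogeneous n := cequiv_homog p c n F hF
  have hF'0 : F' ≠ 0 := by simpa [F'] using hF0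
  have hdeg : ∀ d ∈ F'.support, d 0 + d 1 + d 2 = n := by
    intro d hd
    have := hh.degree_eq_sum_deg_support hd
    rw [this, Finset.sum_subset (Finset.subset_univ _), Fin.sum_univ_three]
    intro i _ hi
    simpa using hi
  have hD : degreeOf 2 F' ≤ n := by
    rw [degreeOf_le_iff]
    intro d hd
    have := hdeg d hd
    omega
  have hset : {m | F ∈ pointIdeal p ^ m} = Set.Iic (n - degreeOf 2 F') := by
    ext m
    rw [Set.mem_ofPred_eq, mem_pointIdeal_pow p c hc, mem_J_pow_iff, Set.mem_Iic]
    constructor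
    · intro h
      have hne : F'.support.Nonempty := by simpa [Finset.nonempty_iff_ne_empty] using hF'0
      have hmn : m ≤ n := by
        obtain ⟨d, hd⟩ := hne
        have := h d hd
        have := hdeg d hd
        omega
      have : degreeOf 2 F' ≤ n - m := by
        rw [degreeOf_le_iff]
        intro d hd
        have := h d hd
        have := hdeg d hd
        omega
      omega
    · intro h d hd
      have h1 := (degreeOf_le_iff (n := 2) (f := F') (d := degreeOf 2 F')).1 le_rfl d hd
      have := hdeg d hd
      omega
  have hm : multAt F p = n - degreeOf 2 F' := by
    rw [multAt, hset, csSup_Iic]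
  refine ⟨by omega, ?_⟩
  have : multAt F p ∈ {m | F ∈ pointIdeal p ^ m} := by rw [hset, hm]; exact Set.mem_Iic.2 le_rfl
  exact this

theorem natDegree_dehom1 (n : ℕ) (A : MvPolynomial (Fin 3) K) (hA : A.IsHomogeneous n) :
    ((Polynomial.Bivariate.equivMvPolynomial K).symm
      (aeval (dehomMap 1) A : MvPolynomial (Fin 2) K)).natDegree = degreeOf 2 A := by
  by_cases hA0 : A = 0
  · simp [hA0]
  let e := (Polynomial.Bivariate.equivMvPolynomial K).symm
  have he0 : e (X 0) = Polynomial.C Polynomial.X := by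
    simp [e]
  have he1 : e (X 1) = Polynomial.X := by
    simp [e]
  have heC : ∀ r, e (C r) = Polynomial.C (Polynomial.C r) := by
    intro r
    exact e.commutes r
  have hd0 : dehomMap (K := K) 1 0 = X 0 := dehomMap_emb 1 0
  have hd2 : dehomMap (K := K) 1 2 = X 1 := dehomMap_emb 1 1
  have hmon : ∀ d : Fin 3 →₀ ℕ, ∀ r : K, e (aeval (dehomMap 1) (monomial d r)) =
      Polynomial.C (Polynomial.C r * Polynomial.X ^ d 0) * Polynomial.X ^ d 2 := by
    intro d r
    rw [monomial_eq, Finsupp.prod_fintype _ _ (by simp), Fin.prod_univ_three]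
    simp only [map_mul, map_pow, aeval_X, aeval_C, algebraMap_eq, hd0, hd2, dehomMap_self, he0, he1, heC,
      one_pow, map_one, one_mul, mul_assoc]
  have hsum : e (aeval (dehomMap 1) A) = ∑ d ∈ A.support,
      Polynomial.C (Polynomial.C (coeff d A) * Polynomial.X ^ d 0) * Polynomial.X ^ d 2 := by
    conv_lhs => rw [A.as_sum, map_sum, map_sum]
    exact Finset.sum_congr rfl fun d _ => hmon d _
  change (e (aeval (dehomMap 1) A)).natDegree = _
  have hdeg : ∀ d ∈ A.support, d 0 + d 1 + d 2 = n := by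
    intro d hd
    have := hA.degree_eq_sum_deg_support hd
    rw [this, Finset.sum_subset (Finset.subset_univ _), Fin.sum_univ_three]
    intro i _ hi
    simpa using hi
  apply le_antisymm
  · rw [hsum]
    refine Polynomial.natDegree_sum_le_of_forall_le _ _ fun d hd => ?_
    refine (Polynomial.natDegree_C_mul_X_pow_le _ _).trans ?_
    exact (degreeOf_le_iff (n := 2) (f := A) (d := degreeOf 2 A)).1 le_rfl d hd
  · have hne : A.support.Nonempty := by simpa [Finset.nonempty_iff_ne_empty] using hA0
    obtain ⟨d, hd, hdD⟩ := Finset.exists_mem_eq_sup A.support hne (fun m => m 2)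
    rw [degreeOf_eq_sup, hdD]
    apply Polynomial.le_natDegree_of_ne_zero
    intro h0
    have h1 : ((e (aeval (dehomMap 1) A)).coeff (d 2)).coeff (d 0) = coeff d A := by
      rw [hsum, Polynomial.finsetSum_coeff, Polynomial.finsetSum_coeff, Finset.sum_eq_single d]
      · rw [Polynomial.coeff_C_mul_X_pow, if_pos rfl, Polynomial.coeff_C_mul_X_pow, if_pos rfl]
      · intro b hb hbd
        rw [Polynomial.coeff_C_mul_X_pow]
        split_ifs with h
        · rw [Polynomial.coeff_C_mul_X_pow, if_neg]
          intro h'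
          apply hbd
          have h3 := hdeg b hb
          have h4 := hdeg d hd
          ext i
          fin_cases i
          · simpa using h'.symm
          · simp; omega
          · simpa using h.symm
        · simp
      · intro h; exact absurd hd h
    rw [h0] at h1
    simp only [Polynomial.coeff_zero] at h1
    exact (mem_support_iff.1 hd) h1.symm
end P5


section P6
variable {K : Type*} [Field K]

open IntermediateField

/-- image of a binary form in the field of rational functions -/
def rf (v w : Fin 2 → K) : MvPolynomial (Fin 2) K →ₐ[K] RatFunc K :=
  (IsScalarTower.toAlgHom K (Polynomial K) (RatFunc K)).comp (tl v w)

theorem rf_apply (v w : Fin 2 → K) (h : MvPolynomial (Fin 2) K) :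
    rf v w h = algebraMap (Polynomial K) (RatFunc K) (tl v w h) := rfl

theorem rf_inj (v w : Fin 2 → K) (hb : bdet v w ≠ 0) (k : ℕ) (h : MvPolynomial (Fin 2) K)
    (hh : h.IsHomogeneous k) (h0 : rf v w h = 0) : h = 0 := by
  rw [rf_apply] at h0
  exact tl_inj v w hb k h hh (by simpa using h0)

theorem finrank_coprime (A B : Polynomial K) (hB : B ≠ 0) (h : IsCoprime A B) (e : ℕ)
    (hA : A.natDegree = e) (hBe : B.natDegree ≤ e) :
    Module.finrank K⟮(algebraMap (Polynomial K) (RatFunc K) A / algebraMap (Polynomial K) (RatFunc K) B)⟯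
      (RatFunc K) = e := by
  classical
  rw [RatFunc.finrank_eq_max_natDegree, RatFunc.num_div, RatFunc.denom_div _ hB]
  have hg : gcd A B = 1 := by
    have h1 : IsUnit (gcd A B) := (gcd_isUnit_iff A B).2 h
    rw [← normalize_gcd, normalize_eq_one]
    exact h1
  have h2 : B / (1 : Polynomial K) = B := EuclideanDomain.div_one B
  have h3 : A / (1 : Polynomial K) = A := EuclideanDomain.div_one A
  rw [hg, h2, h3, Polynomial.natDegree_C_mul (inv_ne_zero (Polynomial.leadingCoeff_ne_zero.2 hB)),
    Polynomial.natDegree_C_mul (inv_ne_zero (Polynomial.leadingCoeff_ne_zero.2 hB)), hA]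
  exact max_eq_left hBe

variable [IsAlgClosed K] {n : ℕ} {f : Fin 3 → MvPolynomial (Fin 2) K} {F : MvPolynomial (Fin 3) K}

theorem fp_ne (H : CurH n f F) (p : Fin 3 → K) (c : Fin 3) (i : Fin 2) : fp f p c i ≠ 0 := by
  intro h
  have h1 := fp_LI H p c 1 0 0
  have h2 := fp_LI H p c 0 1 0
  fin_cases i
  · simp only [Fin.zero_eta] at h; simp [h] at h1
  · simp only [Fin.mk_one] at h; simp [h] at h2

theorem finrank_E (H : CurH n f F) (p : Fin 3 → K) (c : Fin 3)
    (G : MvPolynomial (Fin 2) K) (d : ℕ) (A : Fin 2 → MvPolynomial (Fin 2) K) (hG0 : G ≠ 0)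
    (hG : G.IsHomogeneous d)
    (hA : ∀ i, (A i).IsHomogeneous (n - d)) (hfA : ∀ i, fp f p c i = G * A i)
    (v w : Fin 2 → K) (hb : bdet v w ≠ 0) (hcop : IsCoprime (tl v w (A 0)) (tl v w (A 1)))
    (hv : eval v (fp f p c 0) ≠ 0) :
    Module.finrank K⟮rf v w (fp f p c 0) / rf v w (fp f p c 1)⟯ (RatFunc K) = n - d := by
  have hA1 : tl v w (A 1) ≠ 0 := by
    intro h
    have := tl_inj v w hb _ _ (hA 1) h
    apply fp_ne H p c 1
    rw [hfA, this, mul_zero]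
  have h1 : rf v w (fp f p c 0) / rf v w (fp f p c 1) =
      algebraMap (Polynomial K) (RatFunc K) (tl v w (A 0)) / algebraMap (Polynomial K) (RatFunc K) (tl v w (A 1)) := by
    rw [hfA, hfA, map_mul, map_mul, ← rf_apply, ← rf_apply]
    rw [mul_div_mul_left]
    intro h
    exact hG0 (rf_inj v w hb d G hG h)
  rw [h1]
  refine finrank_coprime _ _ hA1 hcop _ ?_ (natDegree_tl_le v w _ _ (hA 1))
  apply natDegree_tl v w _ _ (hA 0)
  intro h
  apply hv
  rw [hfA, map_mul, h, mul_zero]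

theorem transc_u (H : CurH n f F) (p : Fin 3 → K) (c : Fin 3)
    (v w : Fin 2 → K) (hb : bdet v w ≠ 0) :
    Transcendental K (rf v w (fp f p c 0) / rf v w (fp f p c 1)) := by
  apply RatFunc.transcendental_of_ne_C
  rintro ⟨a, ha⟩
  have h1 : rf v w (fp f p c 1) ≠ 0 := fun h =>
    fp_ne H p c 1 (rf_inj v w hb n _ (fp_homog H p c 1) h)
  rw [div_eq_iff h1] at ha
  have h2 : rf v w (C 1 * fp f p c 0 + C (-a) * fp f p c 1 + C 0 * f c) = 0 := by
    have : rf v w (C a) = RatFunc.C a := by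
      rw [← algebraMap_eq, AlgHom.commutes]; rfl
    simp only [map_add, map_mul, map_neg, ha, this]
    simp
  have h3 := fp_LI H p c 1 (-a) 0 (rf_inj v w hb n _ (by
    have := ((isHomogeneous_C (Fin 2) (1 : K)).mul (fp_homog H p c 0)).add
      ((isHomogeneous_C (Fin 2) (-a : K)).mul (fp_homog H p c 1)) |>.add
      ((isHomogeneous_C (Fin 2) (0 : K)).mul (H.hf.homog c))
    rwa [zero_add] at this) h2)
  exact one_ne_zero h3.1

theorem finrank_M (H : CurH n f F) (p : Fin 3 → K) (c : Fin 3) (hc : p c ≠ 0)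
    (hm : multAt F p < n)
    (v w : Fin 2 → K) (hb : bdet v w ≠ 0) :
    Module.finrank K⟮rf v w (fp f p c 0) / rf v w (fp f p c 1)⟯
      K⟮rf v w (fp f p c 0) / rf v w (fp f p c 1)⟯⟮rf v w (f c) / rf v w (fp f p c 1)⟯ =
      n - multAt F p := by
  obtain ⟨hmm, _⟩ := multAt_eq n F H.hom H.irr.ne_zero p c hc
  have hh := cequiv_homog p c n F H.hom
  have hirr : Irreducible (cequiv p c F) := by
    rw [MulEquiv.irreducible_iff]; exact H.irr
  have hpr := dehom_prime 1 n (by have := H.hn; omega) _ hh hirr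
  have hnd := natDegree_dehom1 n _ hh
  have h1 : rf v w (fp f p c 1) ≠ 0 := fun h =>
    fp_ne H p c 1 (rf_inj v w hb n _ (fp_homog H p c 1) h)
  rw [finrank_adjoin_eq _ _ (transc_u H p c v w hb) _ hpr ?_ (by omega), hnd]
  · omega
  · let y : Fin 3 → RatFunc K := ![rf v w (fp f p c 0), rf v w (fp f p c 1), rf v w (f c)]
    have h2 := aeval_eq_dehom 1 y ![rf v w (fp f p c 0) / rf v w (fp f p c 1),
      rf v w (f c) / rf v w (fp f p c 1)] (by
        intro i
        fin_cases i
        · change rf v w (fp f p c 0) = rf v w (fp f p c 1) * (rf v w (fp f p c 0) / rf v w (fp f p c 1))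
          rw [mul_div_cancel₀ _ h1]
        · change rf v w (f c) = rf v w (fp f p c 1) * (rf v w (f c) / rf v w (fp f p c 1))
          rw [mul_div_cancel₀ _ h1]) n _ hh
    have h3 : aeval y (cequiv p c F) = 0 := by
      rw [cequiv_apply, comp_aeval_apply]
      have : (fun i => aeval y (csub p c i)) = fun i => rf v w (f i) := by
        funext j
        rcases chartEmb_cases c j with h | h | h
        · rw [h, csub_c]; simp [y]
        · rw [h, csub_0]
          have : f (chartEmb c 0) = fp f p c 0 + C (affOf p c 0) * f c := by simp [fp]
          rw [this, map_add, map_mul, map_add, map_mul]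
          simp only [aeval_X, ← algebraMap_eq, AlgHom.commutes]
          simp [y]
        · rw [h, csub_1]
          have : f (chartEmb c 1) = fp f p c 1 + C (affOf p c 1) * f c := by simp [fp]
          rw [this, map_add, map_mul, map_add, map_mul]
          simp only [aeval_X, ← algebraMap_eq, AlgHom.commutes]
          simp [y]
      rw [this, ← comp_aeval_apply, H.van, map_zero]
    rw [h3] at h2
    exact (mul_eq_zero.1 h2.symm).resolve_left (pow_ne_zero _ h1)

theorem exists_off (H : CurH n f F) :
    ∃ (p : Fin 3 → K) (c : Fin 3), p c ≠ 0 ∧ eval p F ≠ 0 := by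
  have := IsAlgClosed.instInfinite (K := K)
  obtain ⟨p, hp⟩ := exists_eval_ne F H.irr.ne_zero
  have : p ≠ 0 := by
    rintro rfl
    apply hp
    rw [← MvPolynomial.coe_aeval_eq_eval]
    have h1 := aeval_smul_homog (fun _ : Fin 3 => (0 : K)) 0 n F H.hom
    simp only [mul_zero, zero_pow (show n ≠ 0 by have := H.hn; omega), zero_mul] at h1
    exact h1
  obtain ⟨c, hc⟩ := Function.ne_iff.1 this
  exact ⟨p, c, hc, hp⟩

theorem multAt_off (H : CurH n f F) (p : Fin 3 → K) (c : Fin 3) (hc : p c ≠ 0)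
    (hp : eval p F ≠ 0) : multAt F p = 0 := by
  obtain ⟨_, hm⟩ := multAt_eq n F H.hom H.irr.ne_zero p c hc
  by_contra h
  have h1 : F ∈ pointIdeal p := Ideal.pow_le_self h hm
  have h2 : pointIdeal p ≤ RingHom.ker (eval p) := by
    rw [pointIdeal, Ideal.span_le]
    rintro L ⟨_, hL⟩
    exact hL
  exact hp (h2 h1)

theorem eval_F_f (H : CurH n f F) (v : Fin 2 → K) : eval (fun u => eval v (f u)) F = 0 := by
  have h1 := comp_aeval_apply f (aeval v : MvPolynomial (Fin 2) K →ₐ[K] K) F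
  rw [H.van, map_zero] at h1
  rw [← MvPolynomial.coe_aeval_eq_eval, ← MvPolynomial.coe_aeval_eq_eval]
  exact h1.symm

theorem eval_smul_homog {σ : Type*} (y : σ → K) (a : K) (k : ℕ) (A : MvPolynomial σ K)
    (hA : A.IsHomogeneous k) : eval (fun i => a * y i) A = a ^ k * eval y A := by
  have := aeval_smul_homog y a k A hA
  rwa [← MvPolynomial.coe_aeval_eq_eval, ← MvPolynomial.coe_aeval_eq_eval]

/-- if all `fp` vanish at `r`, then `f(r) = (f_c(r)/p_c) p`. -/
theorem f_prop (p : Fin 3 → K) (c : Fin 3) (hc : p c ≠ 0) (r : Fin 2 → K)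
    (h : ∀ i, eval r (fp f p c i) = 0) (u : Fin 3) :
    eval r (f u) = (eval r (f c) / p c) * p u := by
  have h1 : ∀ i, eval r (f (chartEmb c i)) = (eval r (f c) / p c) * p (chartEmb c i) := by
    intro i
    have := h i
    simp only [fp, map_sub, map_mul, eval_C, affOf] at this
    rw [sub_eq_zero.1 this]
    ring
  rcases chartEmb_cases c u with h2 | h2 | h2
  · rw [h2, div_mul_cancel₀ _ hc]
  · rw [h2]; exact h1 0
  · rw [h2]; exact h1 1

theorem fc_ne (H : CurH n f F) (p : Fin 3 → K) (c : Fin 3) (hc : p c ≠ 0) (r : Fin 2 → K) (hr : r ≠ 0)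
    (h : ∀ i, eval r (fp f p c i) = 0) : eval r (f c) ≠ 0 := by
  intro h0
  apply H.hf.no_common_zero r hr
  funext u
  simp only [evalVec]
  rw [f_prop p c hc r h u, h0]
  simp

theorem on_curve (H : CurH n f F) (p : Fin 3 → K) (c : Fin 3) (hc : p c ≠ 0) (r : Fin 2 → K) (hr : r ≠ 0)
    (h : ∀ i, eval r (fp f p c i) = 0) : eval p F = 0 := by
  have h1 := eval_F_f H r
  have h2 : (fun u => eval r (f u)) = fun u => (eval r (f c) / p c) * p u := by
    funext u; exact f_prop p c hc r h u
  rw [h2, eval_smul_homog _ _ n F H.hom] at h1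
  exact (mul_eq_zero.1 h1).resolve_left (pow_ne_zero _ (div_ne_zero (fc_ne H p c hc r hr h) hc))

/-- The curve is birational to the line: the field generated by the ratios is everything. -/
theorem birational (H : CurH n f F) :
    ∃ h0 : MvPolynomial (Fin 2) K, h0 ≠ 0 ∧ ∀ v w, bdet v w ≠ 0 → eval v h0 ≠ 0 →
      ∀ (S : IntermediateField K (RatFunc K)) (b : Fin 3), f b ≠ 0 →
        (∀ u, rf v w (f u) / rf v w (f b) ∈ S) → S = ⊤ := by
  obtain ⟨p, c, hc, hp⟩ := exists_off H
  have hm := multAt_off H p c hc hp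
  obtain ⟨G, hG⟩ := exists_gcd f p
  obtain ⟨d, A, hdn, hGh, hG0, hA, hfA, hcop⟩ := gcd_struct H p c hc G hG
  have hd : d = 0 := by
    by_contra hd
    obtain ⟨r, hr, hr0⟩ := exists_zero d (by omega) G hGh
    apply hp
    refine on_curve H p c hc r hr fun i => ?_
    rw [hfA, map_mul, hr0, zero_mul]
  refine ⟨fp f p c 0, fp_ne H p c 0, fun v w hb hv S b hfb hS => ?_⟩
  have hE := finrank_E H p c G d A hG0 hGh hA hfA v w hb (hcop v w hb) hv
  have hM := finrank_M H p c hc (by have := H.hn; omega) v w hb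
  set u := rf v w (fp f p c 0) / rf v w (fp f p c 1) with hu
  set x := rf v w (f c) / rf v w (fp f p c 1) with hx
  have hrb : rf v w (f b) ≠ 0 := fun h => hfb (rf_inj v w hb n _ (H.hf.homog b) h)
  have hfd : FiniteDimensional K⟮u⟯ (RatFunc K) := by
    apply Module.finite_of_finrank_pos
    rw [hE]; have := H.hn; omega
  have htop : K⟮u⟯⟮x⟯ = (⊤ : IntermediateField K⟮u⟯ (RatFunc K)) := by
    apply IntermediateField.eq_of_le_of_finrank_eq le_top
    rw [hM, IntermediateField.finrank_top', hE, hm, hd]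
  have hfpS : ∀ i, rf v w (fp f p c i) / rf v w (f b) ∈ S := by
    intro i
    simp only [fp, map_sub, map_mul, ← algebraMap_eq, AlgHom.commutes]
    rw [sub_div, mul_div_assoc]
    exact S.sub_mem (hS _) (S.mul_mem (S.algebraMap_mem _) (hS _))
  have huS : u ∈ S := by
    have := S.div_mem (hfpS 0) (hfpS 1)
    rwa [div_div_div_cancel_right₀ hrb] at this
  have hxS : x ∈ S := by
    have := S.div_mem (hS c) (hfpS 1)
    rwa [div_div_div_cancel_right₀ hrb] at this
  have hle : K⟮u⟯ ≤ S := by rw [adjoin_simple_le_iff]; exact huS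
  have h5 : K⟮u⟯⟮x⟯ ≤ IntermediateField.extendScalars hle := by
    rw [adjoin_simple_le_iff]; exact hxS
  rw [htop] at h5
  rw [eq_top_iff]
  intro z _
  exact h5 (mem_top : z ∈ (⊤ : IntermediateField K⟮u⟯ (RatFunc K)))

theorem deg_eq_mult (H : CurH n f F) (hm2 : ∀ q : Fin 3 → K, q ≠ 0 → multAt F q ≤ 2)
    (p : Fin 3 → K) (c : Fin 3) (hc : p c ≠ 0)
    (G : MvPolynomial (Fin 2) K) (hG : IsGcdOfCross f p G) : G.IsHomogeneous (multAt F p) := by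
  have := IsAlgClosed.instInfinite (K := K)
  obtain ⟨h0, hh0, hbir⟩ := birational H
  obtain ⟨d, A, hdn, hGh, hG0, hA, hfA, hcop⟩ := gcd_struct H p c hc G hG
  by_cases hfc : f c = 0
  · exfalso
    have := fp_LI H p c 0 0 1 (by rw [hfc]; simp)
    exact one_ne_zero this.2.2
  obtain ⟨v, w, hb, hv⟩ := good_basis (h0 * fp f p c 0) (mul_ne_zero hh0 (fp_ne H p c 0))
  rw [map_mul] at hv
  have hv1 := left_ne_zero_of_mul hv
  have hv2 := right_ne_zero_of_mul hv
  have hp0 : p ≠ 0 := fun h => hc (by rw [h]; rfl)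
  have hE := finrank_E H p c G d A hG0 hGh hA hfA v w hb (hcop v w hb) hv2
  have hM := finrank_M H p c hc (by have := H.hn; have := hm2 p hp0; omega) v w hb
  set u := rf v w (fp f p c 0) / rf v w (fp f p c 1) with hu
  set x := rf v w (f c) / rf v w (fp f p c 1) with hx
  have hr1 : rf v w (fp f p c 1) ≠ 0 := fun h => fp_ne H p c 1 (rf_inj v w hb n _ (fp_homog H p c 1) h)
  have hrc : rf v w (f c) ≠ 0 := fun h => hfc (rf_inj v w hb n _ (H.hf.homog c) h)
  have huS : u ∈ (K⟮u⟯⟮x⟯).restrictScalars K := by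
    rw [mem_restrictScalars]
    exact (K⟮u⟯⟮x⟯).algebraMap_mem (⟨u, mem_adjoin_simple_self K u⟩ : K⟮u⟯)
  have hxS : x ∈ (K⟮u⟯⟮x⟯).restrictScalars K := by
    rw [mem_restrictScalars]
    exact mem_adjoin_simple_self _ x
  have htop := hbir v w hb hv1 ((K⟮u⟯⟮x⟯).restrictScalars K) c hfc (by
    have h1 : rf v w (fp f p c 1) / rf v w (f c) ∈ (K⟮u⟯⟮x⟯).restrictScalars K := by
      have := ((K⟮u⟯⟮x⟯).restrictScalars K).inv_mem hxS
      rwa [hx, inv_div] at this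
    have h2 : rf v w (fp f p c 0) / rf v w (f c) ∈ (K⟮u⟯⟮x⟯).restrictScalars K := by
      have := ((K⟮u⟯⟮x⟯).restrictScalars K).mul_mem huS h1
      rwa [hu, div_mul_div_cancel₀ hr1] at this
    have h3 : ∀ i, rf v w (f (chartEmb c i)) / rf v w (f c) =
        rf v w (fp f p c i) / rf v w (f c) + algebraMap K _ (affOf p c i) := by
      intro i
      simp only [fp, map_sub, map_mul, ← algebraMap_eq, AlgHom.commutes]
      rw [sub_div, mul_div_assoc, div_self hrc, mul_one, sub_add_cancel]
    intro j
    rcases chartEmb_cases c j with h | h | h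
    · rw [h, div_self hrc]; exact one_mem _
    · rw [h, h3]; exact add_mem h2 (IntermediateField.algebraMap_mem _ _)
    · rw [h, h3]; exact add_mem h1 (IntermediateField.algebraMap_mem _ _))
  have htop2 : K⟮u⟯⟮x⟯ = (⊤ : IntermediateField K⟮u⟯ (RatFunc K)) := by
    rw [eq_top_iff]
    intro z _
    have : z ∈ (K⟮u⟯⟮x⟯).restrictScalars K := by rw [htop]; exact mem_top
    exact this
  rw [htop2, IntermediateField.finrank_top', hE] at hM
  have := H.hn
  have := hm2 p hp0
  have : d = multAt F p := by omega
  rwa [← this]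
end P6


section P7
variable {K : Type*} [Field K]

/-- images of the monomials under `tl` -/
def mono (v w : Fin 2 → K) (k j : ℕ) : Polynomial K := tl v w (X 0 ^ (k - j) * X 1 ^ j)

theorem tl_formOf (v w : Fin 2 → K) (k : ℕ) (x : Fin (k + 1) → K) :
    tl v w (formOf k x) = ∑ j : Fin (k + 1), Polynomial.C (x j) * mono v w k j := by
  simp only [formOf, map_sum, mono]
  refine Finset.sum_congr rfl fun j _ => ?_
  rw [mul_assoc, map_mul]
  congr 1
  simp [tl, Polynomial.algebraMap_eq]

theorem tl_eq_sum (v w : Fin 2 → K) (k : ℕ) (h : MvPolynomial (Fin 2) K) (hh : h.IsHomogeneous k) :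
    tl v w h = ∑ j : Fin (k + 1), Polynomial.C (bcoeff k h j) * mono v w k j := by
  conv_lhs => rw [← formOf_bcoeff k h hh]
  exact tl_formOf v w k _

theorem mono_natDegree (v w : Fin 2 → K) (k : ℕ) (j : Fin (k + 1)) : (mono v w k j).natDegree ≤ k := by
  apply natDegree_tl_le
  have := ((isHomogeneous_X K (0 : Fin 2)).pow (k - j)).mul ((isHomogeneous_X K (1 : Fin 2)).pow (j : ℕ))
  rwa [show 1 * (k - j) + 1 * (j : ℕ) = k by omega] at this

variable {A : Type*} [CommRing A] [Algebra K A]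

def monoA (A : Type*) [CommRing A] [Algebra K A] (v w : Fin 2 → K) (k j : ℕ) : Polynomial A :=
  (mono v w k j).map (algebraMap K A)

theorem monoA_natDegree (v w : Fin 2 → K) (k : ℕ) (j : Fin (k + 1)) : (monoA A v w k j).natDegree ≤ k :=
  Polynomial.natDegree_map_le.trans (mono_natDegree v w k j)

def Tmat (v w : Fin 2 → K) (n : ℕ) : Matrix (Fin (n + 1)) (Fin (n + 1)) K :=
  fun j l => (mono v w n j).coeff l

def Smat (v w : Fin 2 → K) (n : ℕ) : Matrix (Fin (n + 1)) (Fin (n + 1)) K :=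
  fun l j => bcoeff n (hz v w n (Polynomial.X ^ (l : ℕ))) j

theorem hz_sum (v w : Fin 2 → K) (hb : bdet v w ≠ 0) (k l : ℕ) (hl : l ≤ k) :
    (Polynomial.X ^ l : Polynomial K) = ∑ j : Fin (k + 1),
      Polynomial.C (bcoeff k (hz v w k (Polynomial.X ^ l)) j) * mono v w k j := by
  rw [← tl_eq_sum v w k _ (hz_homog v w k _), tl_hz v w hb]
  simpa using hl

theorem S_mul_T (v w : Fin 2 → K) (hb : bdet v w ≠ 0) (n : ℕ) : Smat v w n * Tmat v w n = 1 := by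
  ext l m
  rw [Matrix.mul_apply, Matrix.one_apply]
  have h := congrArg (fun P => Polynomial.coeff P m) (hz_sum v w hb n l (by omega))
  simp only [Polynomial.coeff_X_pow, Polynomial.finsetSum_coeff, Polynomial.coeff_C_mul] at h
  simp only [Smat, Tmat]
  rw [← h]
  simp [Fin.ext_iff, eq_comm]

theorem T_mul_S (v w : Fin 2 → K) (hb : bdet v w ≠ 0) (n : ℕ) : Tmat v w n * Smat v w n = 1 :=
  mul_eq_one_comm.1 (S_mul_T v w hb n)

theorem exists_B (v w : Fin 2 → K) (hb : bdet v w ≠ 0) (k : ℕ) (P : Polynomial A) (hP : P.natDegree ≤ k) :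
    ∃ B : Fin (k + 1) → A, P = ∑ j : Fin (k + 1), Polynomial.C (B j) * monoA A v w k j := by
  refine ⟨fun j => ∑ l ∈ Finset.range (k + 1), P.coeff l *
    algebraMap K A (bcoeff k (hz v w k (Polynomial.X ^ l)) j), ?_⟩
  conv_lhs => rw [P.as_sum_range' (k + 1) (by omega)]
  simp only [map_sum, Finset.sum_mul]
  rw [Finset.sum_comm]
  refine Finset.sum_congr rfl fun l hl => ?_
  have h := congrArg (Polynomial.map (algebraMap K A)) (hz_sum v w hb k l (by
    have := Finset.mem_range.1 hl; omega))
  simp only [Polynomial.map_pow, Polynomial.map_X, Polynomial.map_sum, Polynomial.map_mul, Polynomial.map_C] at h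
  rw [← Polynomial.C_mul_X_pow_eq_monomial, h, Finset.mul_sum]
  refine Finset.sum_congr rfl fun j _ => ?_
  rw [Polynomial.C_mul, mul_assoc]
  rfl

theorem det_mul_eq_zero {ι κ : Type*} [Fintype ι] [DecidableEq ι] [Fintype κ]
    (h : Fintype.card κ < Fintype.card ι) (V : Matrix ι κ A) (Z : Matrix κ ι A) :
    (V * Z).det = 0 := by
  classical
  obtain ⟨e⟩ := Function.Embedding.nonempty_of_card_le h.le
  have hne : ∃ i0, i0 ∉ Set.range e := by
    by_contra hc
    push Not at hc
    have : Function.Surjective e := hc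
    have := Fintype.card_le_of_surjective e this
    omega
  obtain ⟨i0, hi0⟩ := hne
  let V' : Matrix ι ι A := fun i j => if hj : ∃ k, e k = j then V i hj.choose else 0
  let Z' : Matrix ι ι A := fun j i => if hj : ∃ k, e k = j then Z hj.choose i else 0
  have hV : ∀ i k, V' i (e k) = V i k := by
    intro i k
    have hj : ∃ k', e k' = e k := ⟨k, rfl⟩
    simp only [V', dif_pos hj]
    rw [e.injective hj.choose_spec]
  have hZ : ∀ i k, Z' (e k) i = Z k i := by
    intro i k
    have hj : ∃ k', e k' = e k := ⟨k, rfl⟩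
    simp only [Z', dif_pos hj]
    rw [e.injective hj.choose_spec]
  have h1 : V * Z = V' * Z' := by
    ext i j
    rw [Matrix.mul_apply, Matrix.mul_apply]
    refine Fintype.sum_of_injective e e.injective _ _ ?_ ?_
    · intro l hl
      have hl' : ¬ ∃ k, e k = l := hl
      simp only [V', dif_neg hl', zero_mul]
    · intro k; rw [hV, hZ]
  rw [h1, Matrix.det_mul, Matrix.det_eq_zero_of_column_eq_zero i0, zero_mul]
  intro i
  have hl' : ¬ ∃ k, e k = i0 := hi0
  simp only [V', dif_neg hl']

/-- all the minors vanish at the point `x` -/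
def minv (n : ℕ) (f : Fin 3 → MvPolynomial (Fin 2) K) (x : Fin 3 → A) : Prop :=
  ∀ g ∈ minorsSet n 2 f, aeval x g = 0

def Mx (n : ℕ) (f : Fin 3 → MvPolynomial (Fin 2) K) (x : Fin 3 → A) :
    Matrix (Fin (n - 2 + 4)) (Fin (n + 1)) A := (Mmat n 2 f).map (aeval x)

theorem minv_iff (n : ℕ) (f : Fin 3 → MvPolynomial (Fin 2) K) (x : Fin 3 → A) :
    minv n f x ↔ ∀ (r : Fin (n - 2 + 3) → Fin (n - 2 + 4)) (c : Fin (n - 2 + 3) → Fin (n + 1)),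
      Function.Injective r → Function.Injective c → ((Mx n f x).submatrix r c).det = 0 := by
  have h : ∀ (r : Fin (n - 2 + 3) → Fin (n - 2 + 4)) (c : Fin (n - 2 + 3) → Fin (n + 1)),
      aeval x ((Mmat n 2 f).submatrix r c).det = ((Mx n f x).submatrix r c).det := by
    intro r c
    rw [AlgHom.map_det]
    rfl
  constructor
  · intro hm r c hr hc
    rw [← h]
    exact hm _ ⟨r, c, hr, hc, rfl⟩
  · rintro hm _ ⟨r, c, hr, hc, rfl⟩
    rw [h]
    exact hm r c hr hc

/-- the generic quadratic polynomial -/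
def qt (v w : Fin 2 → K) (x : Fin 3 → A) : Polynomial A :=
  ∑ j : Fin 3, Polynomial.C (x j) * monoA A v w 2 j

def phA (A : Type*) [CommRing A] [Algebra K A] (v w : Fin 2 → K) (h : MvPolynomial (Fin 2) K) : Polynomial A :=
  (tl v w h).map (algebraMap K A)

def rowP (v w : Fin 2 → K) (n : ℕ) (f : Fin 3 → MvPolynomial (Fin 2) K) (x : Fin 3 → A)
    (j : Fin (n - 2 + 4)) : Polynomial A :=
  if (j : ℕ) ≤ n - 2 then qt v w x * monoA A v w (n - 2) j
  else phA A v w (f ⟨(j : ℕ) - (n - 2 + 1), by have := j.isLt; omega⟩)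

theorem mono_mul (v w : Fin 2 → K) (a b i j : ℕ) (hi : i ≤ a) (hj : j ≤ b) :
    mono v w a i * mono v w b j = mono v w (a + b) (i + j) := by
  simp only [mono, map_mul, map_pow]
  rw [show a + b - (i + j) = (a - i) + (b - j) by omega, pow_add, pow_add]
  ring

theorem Mx_mul_T (v w : Fin 2 → K) (n : ℕ) (hn : 3 ≤ n) (f : Fin 3 → MvPolynomial (Fin 2) K)
    (hf : ∀ u, (f u).IsHomogeneous n) (x : Fin 3 → A) (j : Fin (n - 2 + 4)) (l : Fin (n + 1)) :
    (Mx n f x * (Tmat v w n).map (algebraMap K A)) j l = (rowP v w n f x j).coeff l := by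
  rw [Matrix.mul_apply]
  simp only [rowP, Mx, Matrix.map_apply, Mmat, Tmat]
  split_ifs with hj
  · simp only [qt, Finset.sum_mul, Polynomial.finsetSum_coeff]
    symm
    have hlt : ∀ i : Fin 3, (j : ℕ) + i < n + 1 := fun i => by have := i.isLt; omega
    refine Fintype.sum_of_injective (fun i : Fin 3 => (⟨j + i, hlt i⟩ : Fin (n + 1))) ?_ _ _ ?_ ?_
    · intro a b hab
      simp only [Fin.mk.injEq] at hab
      exact Fin.ext (by omega)
    · intro c hc
      rw [dif_neg, map_zero, zero_mul]
      rintro ⟨h1, h2⟩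
      apply hc
      exact ⟨⟨c - j, by omega⟩, Fin.ext (by simp; omega)⟩
    · intro i
      rw [dif_pos ⟨by simp, by have := i.isLt; simp; omega⟩]
      rw [mul_assoc, Polynomial.coeff_C_mul]
      have h1 : monoA A v w 2 i * monoA A v w (n - 2) j = monoA A v w n (j + i) := by
        simp only [monoA]
        rw [← Polynomial.map_mul, mono_mul v w 2 (n - 2) i j (by have := i.isLt; omega) hj]
        rw [show 2 + (n - 2) = n by omega, add_comm]
      rw [h1]
      simp only [monoA, Polynomial.coeff_map, aeval_X]
      congr 2
      exact Fin.ext (by simp)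
  · simp only [phA]
    rw [tl_eq_sum v w n _ (hf _)]
    simp only [Polynomial.map_sum, Polynomial.map_mul, Polynomial.map_C, Polynomial.finsetSum_coeff,
      Polynomial.coeff_C_mul, Polynomial.coeff_map]
    refine Finset.sum_congr rfl fun c _ => ?_
    simp

theorem minv_of_factor (v w : Fin 2 → K) (hb : bdet v w ≠ 0) (n : ℕ) (hn : 3 ≤ n)
    (f : Fin 3 → MvPolynomial (Fin 2) K)
    (hf : ∀ u, (f u).IsHomogeneous n) (x : Fin 3 → A) (κ : Polynomial A) (lam : Fin 3 → A)
    (P : Fin 3 → Polynomial A) (hP : ∀ u, (P u).natDegree ≤ n - 2)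
    (h : ∀ u, phA A v w (f u) = Polynomial.C (lam u) * κ + qt v w x * P u) : minv n f x := by
  rw [minv_iff]
  intro r c hr hc
  choose B hB using fun u => exists_B v w hb (n - 2) (P u) (hP u)
  let Zp : Option (Fin (n - 2 + 1)) → Polynomial A := fun o => o.elim κ (fun j => qt v w x * monoA A v w (n - 2) j)
  let V : Matrix (Fin (n - 2 + 4)) (Option (Fin (n - 2 + 1))) A := fun i o =>
    if hi : (i : ℕ) ≤ n - 2 then o.elim 0 (fun j => if (j : ℕ) = i then 1 else 0)
    else o.elim (lam ⟨(i : ℕ) - (n - 2 + 1), by have := i.isLt; omega⟩)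
      (fun j => B ⟨(i : ℕ) - (n - 2 + 1), by have := i.isLt; omega⟩ j)
  have hrow : ∀ i, rowP v w n f x i = ∑ o, Polynomial.C (V i o) * Zp o := by
    intro i
    rw [Fintype.sum_option]
    simp only [rowP, V, Zp, Option.elim]
    split_ifs with hi
    · rw [Finset.sum_eq_single ⟨i, by omega⟩]
      · simp
      · intro b _ hb
        rw [if_neg]
        · simp
        · intro h; exact hb (Fin.ext h)
      · simp
    · rw [h, hB]
      congr 1
      rw [Finset.mul_sum]
      refine Finset.sum_congr rfl fun j _ => ?_
      ring
  let Zm : Matrix (Option (Fin (n - 2 + 1))) (Fin (n + 1)) A := fun o l => (Zp o).coeff l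
  have h1 : Mx n f x * (Tmat v w n).map (algebraMap K A) = V * Zm := by
    ext i l
    rw [Mx_mul_T v w n hn f hf, hrow, Matrix.mul_apply, Polynomial.finsetSum_coeff]
    simp [Zm]
  have h2 : Mx n f x = V * (Zm * (Smat v w n).map (algebraMap K A)) := by
    rw [← Matrix.mul_assoc, ← h1, Matrix.mul_assoc, ← Matrix.map_mul, T_mul_S v w hb,
      Matrix.map_one _ (map_zero _) (map_one _), Matrix.mul_one]
  rw [h2]
  have h3 : (V * (Zm * (Smat v w n).map (algebraMap K A))).submatrix r c =
      (V.submatrix r id) * ((Zm * (Smat v w n).map (algebraMap K A)).submatrix id c) := by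
    rw [Matrix.submatrix_mul _ _ _ _ _ Function.bijective_id]
  rw [h3]
  apply det_mul_eq_zero
  simp

theorem rowP_of_le (v w : Fin 2 → K) (n : ℕ) (f : Fin 3 → MvPolynomial (Fin 2) K) (x : Fin 3 → A)
    (j : Fin (n - 2 + 4)) (h : (j : ℕ) ≤ n - 2) : rowP v w n f x j = qt v w x * monoA A v w (n - 2) j := by
  unfold rowP; rw [if_pos h]

theorem rowP_of_gt (v w : Fin 2 → K) (n : ℕ) (f : Fin 3 → MvPolynomial (Fin 2) K) (x : Fin 3 → A)
    (j : Fin (n - 2 + 4)) (u : Fin 3) (h : (j : ℕ) = n - 2 + 1 + u) : rowP v w n f x j = phA A v w (f u) := by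
  unfold rowP; rw [if_neg (by omega)]
  congr 2
  exact Fin.ext (by simp; omega)

theorem W_eq_zero (v w : Fin 2 → K) (hb : bdet v w ≠ 0) (n : ℕ) (hn : 3 ≤ n)
    (f : Fin 3 → MvPolynomial (Fin 2) K)
    (hf : ∀ u, (f u).IsHomogeneous n) (x : Fin 3 → A) (hx : minv n f x)
    (ε : Aˣ) (q : Polynomial A) (hq : q.Monic) (hq2 : q.natDegree = 2)
    (hqt : qt v w x = Polynomial.C (ε : A) * q) (u u' : Fin 3) :
    (phA A v w (f u) %ₘ q).coeff 0 * (phA A v w (f u') %ₘ q).coeff 1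
     - (phA A v w (f u) %ₘ q).coeff 1 * (phA A v w (f u') %ₘ q).coeff 0 = 0 := by
  classical
  by_cases huu : u = u'
  · subst huu; ring
  rw [minv_iff] at hx
  let us : Fin 2 → Fin 3 := ![u, u']
  have hus : Function.Injective us := by
    intro a b hab
    fin_cases a <;> fin_cases b <;> simp_all [us]
  let r : Fin 2 ⊕ Fin (n - 2 + 1) → Fin (n - 2 + 4) := Sum.elim (fun s => ⟨n - 2 + 1 + us s, by have := (us s).isLt; omega⟩)
    (fun j => ⟨j, by omega⟩)
  have hr : Function.Injective r := by
    rintro (a | a) (b | b) hab <;> simp only [r, Sum.elim_inl, Sum.elim_inr, Fin.mk.injEq] at hab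
    · rw [hus (Fin.ext (by omega : (us a : ℕ) = us b))]
    · omega
    · omega
    · rw [Fin.ext hab]
  let c : Fin 2 ⊕ Fin (n - 2 + 1) ≃ Fin (n + 1) := finSumFinEquiv.trans (finCongr (by omega))
  have hcl : ∀ s : Fin 2, (c (Sum.inl s) : ℕ) = s := by intro s; simp [c]
  have hcr : ∀ s : Fin (n - 2 + 1), (c (Sum.inr s) : ℕ) = 2 + s := by intro s; simp [c]
  have hdet : ((Mx n f x).submatrix r c).det = 0 := by
    let e : Fin (n - 2 + 3) ≃ Fin 2 ⊕ Fin (n - 2 + 1) := ((finSumFinEquiv (m := 2) (n := n - 2 + 1)).trans (finCongr (by omega))).symm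
    have := hx (r ∘ e) (c ∘ e) (hr.comp e.injective) (c.injective.comp e.injective)
    rw [← Matrix.submatrix_submatrix, Matrix.det_submatrix_equiv_self] at this
    exact this
  have hnd : ∀ h : Fin 3, (phA A v w (f h)).natDegree ≤ n := fun h =>
    Polynomial.natDegree_map_le.trans (natDegree_tl_le v w n _ (hf h))
  -- the reducing matrix
  have hB1 := fun s : Fin 2 => exists_B v w hb (n - 2) (Polynomial.C ((ε⁻¹ : Aˣ) : A) * (phA A v w (f (us s)) /ₘ q)) (by
    refine (Polynomial.natDegree_C_mul_le _ _).trans ?_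
    rw [Polynomial.natDegree_divByMonic _ hq, hq2]
    have := hnd (us s)
    omega)
  choose B1 hB1 using hB1
  have hB2 := fun l : Fin (n - 2 + 1) => exists_B v w hb (n - 2) (Polynomial.C ((ε⁻¹ : Aˣ) : A) * (Polynomial.X ^ (l : ℕ))) (by
    refine (Polynomial.natDegree_C_mul_X_pow_le _ _).trans ?_
    omega)
  choose B2 hB2 using hB2
  let R : Matrix (Fin 2 ⊕ Fin (n - 2 + 1)) (Fin 2 ⊕ Fin (n - 2 + 1)) A := Matrix.fromBlocks 1 (Matrix.of fun s j => - B1 s j) 0 (Matrix.of fun l j => B2 l j)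
  let tg : Fin 2 ⊕ Fin (n - 2 + 1) → Polynomial A := Sum.elim (fun s => phA A v w (f (us s)) %ₘ q) (fun l => q * Polynomial.X ^ (l : ℕ))
  have hrl : ∀ s, rowP v w n f x (r (Sum.inl s)) = phA A v w (f (us s)) := by
    intro s
    apply rowP_of_gt
    simp [r]
  have hrr : ∀ j, rowP v w n f x (r (Sum.inr j)) = qt v w x * monoA A v w (n - 2) j := by
    intro j
    rw [rowP_of_le _ _ _ _ _ _ (by simp only [r, Sum.elim_inr]; omega)]
    simp [r]
  have hεε : Polynomial.C (ε : A) * Polynomial.C ((ε⁻¹ : Aˣ) : A) = 1 := by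
    rw [← Polynomial.C_mul, Units.mul_inv, Polynomial.C_1]
  have htg : ∀ i, tg i = ∑ k, Polynomial.C (R i k) * rowP v w n f x (r k) := by
    rintro (s | l)
    · rw [Fintype.sum_sum_type]
      simp only [R, Matrix.fromBlocks_apply₁₁, Matrix.fromBlocks_apply₁₂, Matrix.of_apply, hrl, hrr, tg, Sum.elim_inl]
      have h1 : ∑ j, Polynomial.C (-B1 s j) * (qt v w x * monoA A v w (n - 2) j) =
          - (q * (phA A v w (f (us s)) /ₘ q)) := by
        have : q * (phA A v w (f (us s)) /ₘ q) = qt v w x *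
          (Polynomial.C ((ε⁻¹ : Aˣ) : A) * (phA A v w (f (us s)) /ₘ q)) := by
          rw [hqt]; linear_combination (- (q * (phA A v w (f (us s)) /ₘ q))) * hεε
        rw [this, hB1, Finset.mul_sum, ← Finset.sum_neg_distrib]
        refine Finset.sum_congr rfl fun j _ => ?_
        rw [Polynomial.C_neg]; ring
      rw [h1, Finset.sum_eq_single s]
      · rw [Matrix.one_apply_eq, Polynomial.C_1, one_mul]
        have := Polynomial.modByMonic_add_div (phA A v w (f (us s))) q
        linear_combination this
      · intro b _ hbs
        rw [Matrix.one_apply_ne (Ne.symm hbs)]; simp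
      · simp
    · rw [Fintype.sum_sum_type]
      simp only [R, Matrix.of_apply, Matrix.fromBlocks_apply₂₁, Matrix.fromBlocks_apply₂₂, hrr, tg, Sum.elim_inr, Matrix.zero_apply]
      have : q * Polynomial.X ^ (l : ℕ) = qt v w x *
          (Polynomial.C ((ε⁻¹ : Aˣ) : A) * Polynomial.X ^ (l : ℕ)) := by
        rw [hqt]; linear_combination (- (q * Polynomial.X ^ (l : ℕ))) * hεε
      rw [this, hB2, Finset.mul_sum]
      simp only [Polynomial.C_0, zero_mul, Finset.sum_const_zero, zero_add]
      refine Finset.sum_congr rfl fun j _ => ?_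
      ring
  have hprod : R * ((Mx n f x).submatrix r c * ((Tmat v w n).map (algebraMap K A)).submatrix c c) =
      fun i k => (tg i).coeff (c k) := by
    rw [Matrix.submatrix_mul_equiv]
    ext i k
    rw [Matrix.mul_apply, htg, Polynomial.finsetSum_coeff]
    refine Finset.sum_congr rfl fun j _ => ?_
    rw [Matrix.submatrix_apply, Mx_mul_T v w n hn f hf, Polynomial.coeff_C_mul]
  have hdet2 : (Matrix.of fun i k : Fin 2 ⊕ Fin (n - 2 + 1) => (tg i).coeff (c k)).det = 0 := by
    have : (Matrix.of fun i k : Fin 2 ⊕ Fin (n - 2 + 1) => (tg i).coeff (c k)) = R * ((Mx n f x).submatrix r c * ((Tmat v w n).map (algebraMap K A)).submatrix c c) := by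
      rw [hprod]; rfl
    rw [this, Matrix.det_mul, Matrix.det_mul, hdet]
    ring
  have hdegr : ∀ s : Fin 2, (tg (Sum.inl s)).natDegree < 2 := by
    intro s
    simp only [tg, Sum.elim_inl]
    rw [← hq2]
    apply Polynomial.natDegree_modByMonic_lt _ hq
    rintro rfl
    simp at hq2
  have hblk : (Matrix.of fun i k : Fin 2 ⊕ Fin (n - 2 + 1) => (tg i).coeff (c k)) =
      Matrix.fromBlocks (Matrix.of fun s t : Fin 2 => (tg (Sum.inl s)).coeff t) 0
        (Matrix.of fun (l : Fin (n - 2 + 1)) (t : Fin 2) => (tg (Sum.inr l)).coeff t)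
        (Matrix.of fun l l' : Fin (n - 2 + 1) => (tg (Sum.inr l)).coeff (2 + l')) := by
    ext i k
    rcases i with s | l <;> rcases k with t | l'
    · simp [hcl]
    · simp only [Matrix.of_apply, Matrix.fromBlocks_apply₁₂, Matrix.zero_apply]
      apply Polynomial.coeff_eq_zero_of_natDegree_lt
      rw [hcr]
      have := hdegr s
      omega
    · simp [hcl]
    · simp [hcr]
  rw [hblk, Matrix.det_fromBlocks_zero₁₂] at hdet2
  have hD : (Matrix.of fun l l' : Fin (n - 2 + 1) => (tg (Sum.inr l)).coeff (2 + l')).det = 1 := by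
    rw [Matrix.det_of_lowerTriangular]
    · apply Finset.prod_eq_one
      intro l _
      simp only [Matrix.of_apply, tg, Sum.elim_inr, Polynomial.coeff_mul_X_pow]
      rw [← hq2]; exact hq
    · intro l l' hll
      simp only [Matrix.of_apply, tg, Sum.elim_inr]
      apply Polynomial.coeff_eq_zero_of_natDegree_lt
      refine Polynomial.natDegree_mul_le.trans_lt ?_
      have hXl := Polynomial.natDegree_X_pow_le (R := A) (l : ℕ)
      have : l < l' := hll
      have : (l : ℕ) < l' := this
      omega
  rw [hD, mul_one, Matrix.det_fin_two] at hdet2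
  simp only [tg, Sum.elim_inl, us] at hdet2
  simpa [sub_eq_zero] using hdet2
end P7


section P8
variable {K : Type*} [Field K]

section modq
variable {A : Type*} [CommRing A]

theorem rem_form (q : Polynomial A) (hq : q.Monic) (hq2 : q.natDegree = 2) (a : Polynomial A) :
    a = Polynomial.C ((a %ₘ q).coeff 0) + Polynomial.C ((a %ₘ q).coeff 1) * Polynomial.X + q * (a /ₘ q) := by
  nontriviality A
  have h1 := Polynomial.modByMonic_add_div a q
  have h2 : (a %ₘ q).natDegree < 2 := by
    rw [← hq2]
    apply Polynomial.natDegree_modByMonic_lt _ hq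
    rintro rfl
    simp at hq2
  have h3 := (a %ₘ q).as_sum_range' 2 h2
  simp only [Finset.sum_range_succ, Finset.sum_range_zero, zero_add, ← Polynomial.C_mul_X_pow_eq_monomial,
    pow_zero, mul_one, pow_one] at h3
  rw [← h3]; exact h1.symm

theorem rem_uniq (q : Polynomial A) (hq : q.Monic) (hq2 : q.natDegree = 2) (a P : Polynomial A) (c0 c1 : A)
    (h : a = Polynomial.C c0 + Polynomial.C c1 * Polynomial.X + q * P) :
    (a %ₘ q).coeff 0 = c0 ∧ (a %ₘ q).coeff 1 = c1 := by
  nontriviality A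
  have : a %ₘ q = Polynomial.C c0 + Polynomial.C c1 * Polynomial.X := by
    refine (Polynomial.div_modByMonic_unique P _ hq ⟨h.symm, ?_⟩).2
    rw [Polynomial.degree_eq_natDegree hq.ne_zero, hq2, add_comm]
    exact Polynomial.degree_linear_lt
  rw [this]
  simp

theorem q_form (q : Polynomial A) (hq : q.Monic) (hq2 : q.natDegree = 2) :
    q = Polynomial.X ^ 2 + Polynomial.C (q.coeff 1) * Polynomial.X + Polynomial.C (q.coeff 0) := by
  have h3 := q.as_sum_range' 3 (by omega)
  simp only [Finset.sum_range_succ, Finset.sum_range_zero, zero_add, ← Polynomial.C_mul_X_pow_eq_monomial,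
    pow_zero, mul_one, pow_one] at h3
  have : q.coeff 2 = 1 := by rw [← hq2]; exact hq
  rw [this, Polynomial.C_1, one_mul] at h3
  conv_lhs => rw [h3]
  ring

/-- product rule modulo a monic quadratic polynomial -/
theorem rem_mul (q : Polynomial A) (hq : q.Monic) (hq2 : q.natDegree = 2) (a b : Polynomial A) :
    ((a * b) %ₘ q).coeff 0 = (a %ₘ q).coeff 0 * (b %ₘ q).coeff 0 - q.coeff 0 * (a %ₘ q).coeff 1 * (b %ₘ q).coeff 1
    ∧ ((a * b) %ₘ q).coeff 1 = (a %ₘ q).coeff 0 * (b %ₘ q).coeff 1 + (a %ₘ q).coeff 1 * (b %ₘ q).coeff 0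
      - q.coeff 1 * (a %ₘ q).coeff 1 * (b %ₘ q).coeff 1 := by
  have ha := rem_form q hq hq2 a
  have hb := rem_form q hq hq2 b
  have hqf := q_form q hq hq2
  generalize (a %ₘ q).coeff 0 = a0 at *
  generalize (a %ₘ q).coeff 1 = a1 at *
  generalize (b %ₘ q).coeff 0 = b0 at *
  generalize (b %ₘ q).coeff 1 = b1 at *
  generalize (a /ₘ q) = a' at *
  generalize (b /ₘ q) = b' at *
  generalize hq0 : q.coeff 0 = q0 at *
  generalize hq1 : q.coeff 1 = q1 at *
  apply rem_uniq q hq hq2 (a * b) (Polynomial.C (a1 * b1) + a' * b + (Polynomial.C a0 + Polynomial.C a1 * Polynomial.X) * b')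
  simp only [Polynomial.C_sub, Polynomial.C_add, Polynomial.C_mul]
  linear_combination b * ha + (Polynomial.C a0 + Polynomial.C a1 * Polynomial.X) * hb - Polynomial.C a1 * Polynomial.C b1 * hqf

theorem exists_scalar (q : Polynomial A) (hq : q.Monic) (hq2 : q.natDegree = 2) (κ φ : Polynomial A)
    (hc : IsCoprime κ q)
    (hW : (φ %ₘ q).coeff 0 * (κ %ₘ q).coeff 1 - (φ %ₘ q).coeff 1 * (κ %ₘ q).coeff 0 = 0) :
    ∃ l : A, ∃ P, φ = Polynomial.C l * κ + q * P := by
  obtain ⟨s, t, hst⟩ := hc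
  obtain ⟨e0, e1⟩ := rem_mul q hq hq2 s κ
  obtain ⟨y0, y1⟩ := rem_mul q hq hq2 φ s
  obtain ⟨o0, o1⟩ := rem_uniq q hq hq2 (s * κ) (-t) 1 0 (by
    simp only [Polynomial.C_1, Polynomial.C_0]; linear_combination hst)
  rw [o0] at e0; rw [o1] at e1
  have hy1 : ((φ * s) %ₘ q).coeff 1 = 0 := by
    rw [y1]
    generalize (φ %ₘ q).coeff 0 = p0 at *
    generalize (φ %ₘ q).coeff 1 = p1 at *
    generalize (κ %ₘ q).coeff 0 = k0 at *
    generalize (κ %ₘ q).coeff 1 = k1 at *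
    generalize (s %ₘ q).coeff 0 = s0 at *
    generalize (s %ₘ q).coeff 1 = s1 at *
    generalize q.coeff 0 = q0 at *
    generalize q.coeff 1 = q1 at *
    have h0 : k0 * (p0 * s1 + p1 * s0 - q1 * p1 * s1) = 0 := by
      linear_combination (-s0 + q1 * s1) * hW - p0 * e1
    have h1 : k1 * (p0 * s1 + p1 * s0 - q1 * p1 * s1) = 0 := by
      linear_combination s1 * hW - p1 * e1
    linear_combination (p0 * s1 + p1 * s0 - q1 * p1 * s1) * e0 + s0 * h0 - q0 * s1 * h1
  have hy := rem_form q hq hq2 (φ * s)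
  rw [hy1, Polynomial.C_0, zero_mul, add_zero] at hy
  refine ⟨((φ * s) %ₘ q).coeff 0, ((φ * s) /ₘ q) * κ + t * φ, ?_⟩
  linear_combination -φ * hst + κ * hy

theorem coprime_of_local {k : Type*} [Field k] (ρ : A →+* k) (hρ : ∀ a, ρ a ≠ 0 → IsUnit a)
    (q : Polynomial A) (hq : q.Monic) (hq2 : q.natDegree = 2) (κ : Polynomial A)
    (hc : IsCoprime (κ.map ρ) (q.map ρ)) : IsCoprime κ q := by
  let N := (κ %ₘ q).coeff 0 ^ 2 - q.coeff 1 * (κ %ₘ q).coeff 0 * (κ %ₘ q).coeff 1 + q.coeff 0 * (κ %ₘ q).coeff 1 ^ 2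
  have hN : IsUnit N := by
    apply hρ
    obtain ⟨s, t, hst⟩ := hc
    have hqm : (q.map ρ).Monic := hq.map ρ
    have hqm2 : (q.map ρ).natDegree = 2 := by rw [hq.natDegree_map, hq2]
    obtain ⟨e0, e1⟩ := rem_mul (q.map ρ) hqm hqm2 s (κ.map ρ)
    obtain ⟨o0, o1⟩ := rem_uniq (q.map ρ) hqm hqm2 (s * κ.map ρ) (-t) 1 0 (by
      simp only [Polynomial.C_1, Polynomial.C_0]; linear_combination hst)
    rw [o0, ← Polynomial.map_modByMonic _ hq] at e0; rw [o1, ← Polynomial.map_modByMonic _ hq] at e1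
    simp only [Polynomial.coeff_map] at e0 e1
    have hNρ : ρ N = ρ ((κ %ₘ q).coeff 0) ^ 2 - ρ (q.coeff 1) * ρ ((κ %ₘ q).coeff 0) * ρ ((κ %ₘ q).coeff 1) +
      ρ (q.coeff 0) * ρ ((κ %ₘ q).coeff 1) ^ 2 := by simp [N]
    rw [hNρ]
    generalize ρ ((κ %ₘ q).coeff 0) = k0 at *
    generalize ρ ((κ %ₘ q).coeff 1) = k1 at *
    generalize (s %ₘ (q.map ρ)).coeff 0 = s0 at *
    generalize (s %ₘ (q.map ρ)).coeff 1 = s1 at *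
    generalize ρ (q.coeff 0) = q0 at *
    generalize ρ (q.coeff 1) = q1 at *
    intro h0
    have : (1 : k) = 0 := by
      linear_combination (1 + (s0 * k0 - q0 * s1 * k1) - q1 * (s0*k1+s1*k0-q1*s1*k1)) * e0 + q0 * (s0*k1+s1*k0-q1*s1*k1) * e1 - q1 * e1 + (s0^2 - q1 * s0 * s1 + q0 * s1^2) * h0
    exact one_ne_zero this
  obtain ⟨N', hN'⟩ := hN.exists_right_inv
  have ha := rem_form q hq hq2 κ
  have hqf := q_form q hq hq2
  have hNN := congrArg Polynomial.C hN'
  simp only [N, Polynomial.C_mul, Polynomial.C_add, Polynomial.C_sub, Polynomial.C_pow, Polynomial.C_1] at hNN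
  generalize (κ %ₘ q).coeff 0 = k0 at *
  generalize (κ %ₘ q).coeff 1 = k1 at *
  generalize (κ /ₘ q) = κ' at *
  generalize q.coeff 0 = q0 at *
  generalize q.coeff 1 = q1 at *
  refine ⟨Polynomial.C N' * (Polynomial.C k0 - Polynomial.C q1 * Polynomial.C k1 - Polynomial.C k1 * Polynomial.X),
    Polynomial.C N' * (Polynomial.C k1 ^ 2 - κ' * (Polynomial.C k0 - Polynomial.C q1 * Polynomial.C k1 - Polynomial.C k1 * Polynomial.X)), ?_⟩
  linear_combination hNN + Polynomial.C N' * (Polynomial.C k0 - Polynomial.C q1 * Polynomial.C k1 - Polynomial.C k1 * Polynomial.X) * ha + Polynomial.C N' * Polynomial.C k1 ^ 2 * hqf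
end modq
end P8


section P9
variable {K : Type*} [Field K] [IsAlgClosed K] {n : ℕ} {f : Fin 3 → MvPolynomial (Fin 2) K}
  {F : MvPolynomial (Fin 3) K}
set_option linter.unusedSectionVars false

theorem exists_c (p : Fin 3 → K) (hp : p ≠ 0) : ∃ c, p c ≠ 0 := by
  by_contra h
  push Not at h
  exact hp (funext h)

theorem f_factor (H : CurH n f F) (p : Fin 3 → K) (c : Fin 3) (hc : p c ≠ 0)
    (G : MvPolynomial (Fin 2) K) (hG : IsGcdOfCross f p G) (hG2 : G.IsHomogeneous 2) :
    ∃ P : Fin 3 → MvPolynomial (Fin 2) K, (∀ u, (P u).IsHomogeneous (n - 2)) ∧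
      ∀ u, f u = C (p u / p c) * f c + G * P u := by
  obtain ⟨d, A, hdn, hGh, hG0, hA, hfA, hcop⟩ := gcd_struct H p c hc G hG
  have hd : d = 2 := hGh.inj_right hG2 hG0
  subst hd
  have : ∀ u, ∃ P : MvPolynomial (Fin 2) K, P.IsHomogeneous (n - 2) ∧ f u = C (p u / p c) * f c + G * P := by
    have h3 : ∀ i, f (chartEmb c i) = C (p (chartEmb c i) / p c) * f c + G * A i := by
      intro i
      rw [← hfA]; simp only [fp, affOf]; ring
    intro u
    rcases chartEmb_cases c u with h | h | h
    · rw [h]; exact ⟨0, isHomogeneous_zero _ _ _, by rw [div_self hc]; simp⟩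
    · rw [h]; exact ⟨A 0, hA 0, h3 0⟩
    · rw [h]; exact ⟨A 1, hA 1, h3 1⟩
  choose P hP using this
  exact ⟨P, fun u => (hP u).1, fun u => (hP u).2⟩

theorem qt_K (v w : Fin 2 → K) (x : Fin 3 → K) : qt v w x = tl v w (formOf 2 x) := by
  rw [tl_formOf]
  simp [qt, monoA]

theorem gcd_hom2 (H : CurH n f F) (hm2 : ∀ q : Fin 3 → K, q ≠ 0 → multAt F q ≤ 2)
    (p : Fin 3 → K) (hp : p ≠ 0) (h2 : 2 ≤ multAt F p)
    (G : MvPolynomial (Fin 2) K) (hG : IsGcdOfCross f p G) : G.IsHomogeneous 2 ∧ G ≠ 0 := by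
  obtain ⟨c, hc⟩ := exists_c p hp
  have := deg_eq_mult H hm2 p c hc G hG
  rw [le_antisymm (hm2 p hp) h2] at this
  obtain ⟨d, A, hdn, hGh, hG0, hA, hfA, hcop⟩ := gcd_struct H p c hc G hG
  exact ⟨this, hG0⟩

theorem bullet1 (H : CurH n f F) (hm2 : ∀ q : Fin 3 → K, q ≠ 0 → multAt F q ≤ 2)
    (p : Fin 3 → K) (hp : p ≠ 0) (h2 : 2 ≤ multAt F p)
    (G : MvPolynomial (Fin 2) K) (hG : IsGcdOfCross f p G) :
    ∃ x ∈ XkSet n 2 f, ∃ c : K, c ≠ 0 ∧ formOf 2 x.rep = MvPolynomial.C c * G := by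
  have := IsAlgClosed.instInfinite (K := K)
  obtain ⟨hG2, hG0⟩ := gcd_hom2 H hm2 p hp h2 G hG
  obtain ⟨c, hc⟩ := exists_c p hp
  obtain ⟨P, hP, hfP⟩ := f_factor H p c hc G hG hG2
  have hx0 : bcoeff 2 G ≠ 0 := by
    intro h
    apply hG0
    rw [← formOf_bcoeff 2 G hG2, h]
    simp [formOf]
  let x := Projectivization.mk K (bcoeff 2 G) hx0
  obtain ⟨a, ha⟩ := Projectivization.exists_smul_eq_mk_rep K (bcoeff 2 G) hx0
  have hform : formOf 2 x.rep = C (a : K) * G := by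
    conv_rhs => rw [← formOf_bcoeff 2 G hG2]
    have : x.rep = a • bcoeff 2 G := ha.symm
    rw [this]
    simp only [formOf, Finset.mul_sum]
    refine Finset.sum_congr rfl fun i _ => ?_
    rw [Pi.smul_apply, Units.smul_def, smul_eq_mul, C_mul]
    ring
  refine ⟨x, ?_, a, a.ne_zero, hform⟩
  obtain ⟨v, w, hb, hv⟩ := good_basis G hG0
  have hm : minv n f x.rep := by
    refine minv_of_factor v w hb n H.hn f H.hf.homog x.rep (tl v w (f c)) (fun u => p u / p c)
      (fun u => Polynomial.C ((a : K)⁻¹) * tl v w (P u)) ?_ ?_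
    · intro u
      exact (Polynomial.natDegree_C_mul_le _ _).trans (natDegree_tl_le v w _ _ (hP u))
    · intro u
      have e1 : phA K v w (f u) = tl v w (f u) := by simp [phA]
      rw [e1, qt_K, hform]
      conv_lhs => rw [hfP u]
      have hC : ∀ b : K, tl v w (C b) = Polynomial.C b := by intro b; simp [tl, Polynomial.algebraMap_eq]
      simp only [map_add, map_mul, hC]
      have : Polynomial.C (a : K) * Polynomial.C ((a : K)⁻¹) = 1 := by
        rw [← Polynomial.C_mul, mul_inv_cancel₀ a.ne_zero, Polynomial.C_1]
      linear_combination (- tl v w G * tl v w (P u)) * this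
  intro g hg
  have := hm g hg
  rwa [aeval_eq_eval] at this

theorem bullet2 (H : CurH n f F) (hm2 : ∀ q : Fin 3 → K, q ≠ 0 → multAt F q ≤ 2)
    (p q : Fin 3 → K) (hp : p ≠ 0) (hq : q ≠ 0) (h2 : 2 ≤ multAt F p)
    (G G' : MvPolynomial (Fin 2) K) (hG : IsGcdOfCross f p G) (hG' : IsGcdOfCross f q G')
    (hGG : ∃ c : K, c ≠ 0 ∧ G' = MvPolynomial.C c * G) : ∃ d : K, d ≠ 0 ∧ q = d • p := by
  obtain ⟨hG2, hG0⟩ := gcd_hom2 H hm2 p hp h2 G hG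
  obtain ⟨r, hr, hr0⟩ := exists_zero 2 (by norm_num) G hG2
  obtain ⟨c, hc, rfl⟩ := hGG
  have key : ∀ (p : Fin 3 → K), p ≠ 0 → ∀ D : MvPolynomial (Fin 2) K, IsGcdOfCross f p D → eval r D = 0 →
      ∃ a : K, a ≠ 0 ∧ ∀ u, eval r (f u) = a * p u := by
    intro p hp D hD hDr
    obtain ⟨c, hc⟩ := exists_c p hp
    have h0 : ∀ i, eval r (fp f p c i) = 0 := by
      intro i
      obtain ⟨e, he⟩ := (dvd_cross_iff f p c hc D).1 hD.1 i
      rw [he, map_mul, hDr, zero_mul]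
    exact ⟨_, div_ne_zero (fc_ne H p c hc r hr h0) hc, f_prop p c hc r h0⟩
  obtain ⟨a, ha, h1⟩ := key p hp G hG hr0
  obtain ⟨b, hb, h1'⟩ := key q hq _ hG' (by rw [map_mul, hr0, mul_zero])
  refine ⟨b⁻¹ * a, mul_ne_zero (inv_ne_zero hb) ha, ?_⟩
  ext u
  rw [Pi.smul_apply, smul_eq_mul, mul_assoc, ← h1, h1', inv_mul_cancel_left₀ hb]

theorem exists_mu (H : CurH n f F) (v w : Fin 2 → K) (hb : bdet v w ≠ 0) (q : Polynomial K) (hq : q ≠ 0) :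
    ∃ μ : Fin 3 → K, IsCoprime (∑ u, Polynomial.C (μ u) * tl v w (f u)) q := by
  classical
  have := IsAlgClosed.instInfinite (K := K)
  let Pr : MvPolynomial (Fin 3) K := ∏ r ∈ q.roots.toFinset, ∑ u, C ((tl v w (f u)).eval r) * X u
  have hPr : Pr ≠ 0 := by
    rw [Finset.prod_ne_zero_iff]
    intro r _ h0
    apply H.hf.no_common_zero _ (line_ne_zero v w hb r)
    ext u
    have := congrArg (coeff (Finsupp.single u 1)) h0
    simp only [coeff_sum, coeff_C_mul, coeff_X, coeff_zero] at this
    simp only [evalVec, ← eval_tl, Pi.zero_apply]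
    rw [Finset.sum_eq_single u] at this
    · simpa using this
    · intro b _ hb
      rw [if_neg, mul_zero]
      intro h
      exact hb (Finsupp.single_left_injective one_ne_zero h)
    · simp
  obtain ⟨μ, hμ⟩ := exists_eval_ne Pr hPr
  refine ⟨μ, ?_⟩
  rw [Polynomial.isCoprime_iff_aeval_ne_zero_of_isAlgClosed K K]
  intro r
  by_cases hr : q.eval r = 0
  · left
    have h1 : r ∈ q.roots.toFinset := by simp [hq, hr]
    rw [map_prod, Finset.prod_ne_zero_iff] at hμ
    have h2 := hμ r h1
    rw [map_sum] at h2
    convert h2 using 1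
    simp only [Polynomial.aeval_def, Polynomial.eval₂_id, Algebra.algebraMap_self, Polynomial.eval₂_finsetSum]
    refine Finset.sum_congr rfl fun u _ => ?_
    simp [mul_comm]
  · right
    simpa using hr

theorem bullet3 (H : CurH n f F) (hm2 : ∀ q : Fin 3 → K, q ≠ 0 → multAt F q ≤ 2)
    (x : Projectivization K (Fin (2 + 1) → K)) (hx : x ∈ XkSet n 2 f) :
    ∃ p : Fin 3 → K, p ≠ 0 ∧ 2 ≤ multAt F p ∧
      ∃ G : MvPolynomial (Fin 2) K, IsGcdOfCross f p G ∧
        ∃ c : K, c ≠ 0 ∧ formOf 2 x.rep = MvPolynomial.C c * G := by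
  have := IsAlgClosed.instInfinite (K := K)
  set Q := formOf 2 x.rep with hQ
  have hQh : Q.IsHomogeneous 2 := formOf_homog 2 _
  have hQ0 : Q ≠ 0 := by
    intro h
    apply x.rep_nonzero
    ext i
    have := bcoeff_formOf 2 x.rep i
    rw [← hQ, h] at this
    rw [← this]; simp [bcoeff]
  obtain ⟨v, w, hb, hv⟩ := good_basis Q hQ0
  have hmx : minv n f x.rep := by
    intro g hg
    rw [aeval_eq_eval]; exact hx g hg
  let q : Polynomial K := Polynomial.C (eval v Q)⁻¹ * tl v w Q
  have hqt : qt v w x.rep = Polynomial.C ((Units.mk0 _ hv : Kˣ) : K) * q := by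
    rw [qt_K]
    simp only [q, Units.val_mk0]
    rw [← mul_assoc, ← Polynomial.C_mul, mul_inv_cancel₀ hv, Polynomial.C_1, one_mul]
  have hnd := natDegree_tl v w 2 Q hQh hv
  have hlc : (tl v w Q).leadingCoeff = eval v Q := by
    rw [Polynomial.leadingCoeff, hnd, coeff_tl_top v w 2 Q hQh]
  have hqm : q.Monic := by
    rw [Polynomial.Monic, Polynomial.leadingCoeff_mul, hlc, Polynomial.leadingCoeff_C, inv_mul_cancel₀ hv]
  have hq2 : q.natDegree = 2 := by
    rw [Polynomial.natDegree_C_mul (inv_ne_zero hv), hnd]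
  obtain ⟨μ, hμ⟩ := exists_mu H v w hb q hqm.ne_zero
  have hW := W_eq_zero v w hb n H.hn f H.hf.homog x.rep hmx (Units.mk0 _ hv) q hqm hq2 hqt
  have hph : ∀ u, phA K v w (f u) = tl v w (f u) := by intro u; simp [phA]
  simp only [hph] at hW
  have hmod : (∑ u, Polynomial.C (μ u) * tl v w (f u)) %ₘ q = ∑ u, Polynomial.C (μ u) * (tl v w (f u) %ₘ q) := by
    have := map_sum (Polynomial.modByMonicHom q) (fun u => Polynomial.C (μ u) * tl v w (f u)) Finset.univ
    simp only [Polynomial.modByMonicHom_apply] at this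
    rw [this]
    refine Finset.sum_congr rfl fun u _ => ?_
    rw [← Polynomial.smul_eq_C_mul, ← Polynomial.smul_eq_C_mul, Polynomial.smul_modByMonic]
  have hex : ∀ u, ∃ l : K, ∃ P, tl v w (f u) = Polynomial.C l * (∑ u, Polynomial.C (μ u) * tl v w (f u)) + q * P := by
    intro u
    apply exists_scalar q hqm hq2 _ _ hμ
    rw [hmod]
    simp only [Polynomial.finsetSum_coeff, Polynomial.coeff_C_mul, Finset.mul_sum, ← Finset.sum_sub_distrib]
    apply Finset.sum_eq_zero
    intro u' _
    linear_combination μ u' * hW u u'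
  choose p P hpP using hex
  have hp : p ≠ 0 := by
    intro hp
    have hd : q ∣ ∑ u, Polynomial.C (μ u) * tl v w (f u) := by
      apply Finset.dvd_sum
      intro u _
      rw [hpP u, hp]
      simp only [Pi.zero_apply, Polynomial.C_0, zero_mul, zero_add]
      exact ((dvd_mul_right _ _).mul_left _)
    have := hμ.symm.isUnit_of_dvd hd
    have := Polynomial.natDegree_eq_zero_of_isUnit this
    omega
  obtain ⟨c, hc⟩ := exists_c p hp
  obtain ⟨G, hG⟩ := exists_gcd f p
  have hC : ∀ b : K, tl v w (C b) = Polynomial.C b := by intro b; simp [tl, Polynomial.algebraMap_eq]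
  have hQG : Q ∣ G := by
    apply hG.2
    intro i j _
    refine hom_dvd v w hb 2 n Q _ hQh ?_ hv ?_
    · have h1 := H.hf.homog
      have := ((isHomogeneous_C (Fin 2) (p i)).mul (h1 j)).sub ((isHomogeneous_C (Fin 2) (p j)).mul (h1 i))
      rw [zero_add] at this
      exact this
    · have : tl v w (crossDiff f p i j) = q * (Polynomial.C (p i) * P j - Polynomial.C (p j) * P i) := by
        simp only [crossDiff, map_sub, map_mul, hC]
        linear_combination Polynomial.C (p i) * hpP j - Polynomial.C (p j) * hpP i
      rw [this]
      refine Dvd.dvd.mul_right ?_ _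
      refine ⟨Polynomial.C (eval v Q)⁻¹, ?_⟩
      simp only [q]; ring
  have hGm := deg_eq_mult H hm2 p c hc G hG
  obtain ⟨d, A, hdn, hGh, hG0, hA, hfA, hcop⟩ := gcd_struct H p c hc G hG
  obtain ⟨R, hR⟩ := hQG
  have hR0 : R ≠ 0 := by rintro rfl; rw [mul_zero] at hR; exact hG0 hR
  have hdeg := hGm.totalDegree hG0
  rw [hR, totalDegree_mul_of_isDomain hQ0 hR0, hQh.totalDegree hQ0] at hdeg
  have hm := hm2 p hp
  have hRd : R.totalDegree = 0 := by omega
  rw [totalDegree_eq_zero_iff_eq_C] at hRd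
  refine ⟨p, hp, by omega, G, hG, (coeff 0 R)⁻¹, ?_, ?_⟩
  · apply inv_ne_zero
    intro h; rw [h, C_0] at hRd; exact hR0 hRd
  · have : coeff 0 R ≠ 0 := by
      intro h; rw [h, C_0] at hRd; exact hR0 hRd
    rw [hR]
    have h2 : (C (coeff 0 R)⁻¹ : MvPolynomial (Fin 2) K) * R = 1 := by
      conv_lhs => rw [hRd]
      rw [coeff_C, if_pos rfl, ← C_mul, inv_mul_cancel₀ this, C_1]
    linear_combination (-Q) * h2
end P9


section P10
variable {K : Type*} [Field K]

/-- polynomials inside rational functions -/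
def io : Polynomial K →ₐ[K] RatFunc K := IsScalarTower.toAlgHom K (Polynomial K) (RatFunc K)

theorem io_inj : Function.Injective (io : Polynomial K →ₐ[K] RatFunc K) :=
  RatFunc.algebraMap_injective K

theorem io_ne {P : Polynomial K} (h : P ≠ 0) : io P ≠ 0 := fun h0 => h (io_inj (by rw [h0, map_zero]))

/-- the semilocal ring of rational functions with denominators prime to `G` -/
def BB (G : Polynomial K) : Subalgebra K (RatFunc K) where
  carrier := {y | ∃ P b : Polynomial K, IsCoprime b G ∧ y * io b = io P}
  mul_mem' := by
    rintro y y' ⟨P, b, hb, h⟩ ⟨P', b', hb', h'⟩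
    exact ⟨P * P', b * b', hb.mul_left hb', by rw [map_mul, map_mul, ← h, ← h']; ring⟩
  add_mem' := by
    rintro y y' ⟨P, b, hb, h⟩ ⟨P', b', hb', h'⟩
    exact ⟨P * b' + P' * b, b * b', hb.mul_left hb', by simp only [map_mul, map_add, ← h, ← h']; ring⟩
  algebraMap_mem' := fun r => ⟨Polynomial.C r, 1, isCoprime_one_left, by
    rw [map_one, mul_one, ← Polynomial.algebraMap_eq, AlgHom.commutes]⟩

theorem mem_BB {G : Polynomial K} {y : RatFunc K} :
    y ∈ BB G ↔ ∃ P b : Polynomial K, IsCoprime b G ∧ y * io b = io P := Iff.rfl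

theorem io_mem (G P : Polynomial K) : io P ∈ BB G :=
  ⟨P, 1, isCoprime_one_left, by rw [map_one, mul_one]⟩

theorem cop_ne {G b : Polynomial K} (hG : 0 < G.natDegree) (h : IsCoprime b G) : b ≠ 0 := by
  rintro rfl
  rw [isCoprime_zero_left] at h
  have := Polynomial.natDegree_eq_zero_of_isUnit h
  omega

theorem inv_mem_BB {G b : Polynomial K} (hG : 0 < G.natDegree) (h : IsCoprime b G) : (io b)⁻¹ ∈ BB G :=
  ⟨1, b, h, by rw [map_one, inv_mul_cancel₀ (io_ne (cop_ne hG h))]⟩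

theorem dvd_of_BB {G P : Polynomial K} (k : ℕ) (y : RatFunc K) (hy : y ∈ BB G)
    (h : io P = io G ^ k * y) : G ^ k ∣ P := by
  obtain ⟨Q, b, hb, hQ⟩ := hy
  have h1 : P * b = G ^ k * Q := by
    apply io_inj
    rw [map_mul, map_mul, map_pow, h, ← hQ]; ring
  exact (hb.symm.pow_left (m := k)).dvd_of_dvd_mul_right (Dvd.intro _ h1.symm)

theorem BB_approx {G : Polynomial K} (hG : 0 < G.natDegree) (k : ℕ) (y : RatFunc K) (hy : y ∈ BB G) :
    ∃ P : Polynomial K, ∃ y' ∈ BB G, y = io P + io G ^ k * y' := by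
  obtain ⟨P, b, hb, hP⟩ := hy
  obtain ⟨s, t, hst⟩ := hb.pow_right (n := k)
  have hb0 := io_ne (cop_ne hG hb)
  refine ⟨P * s, io (t * P) * (io b)⁻¹, mul_mem (io_mem _ _) (inv_mem_BB hG hb), ?_⟩
  have h1 := congrArg io hst
  simp only [map_add, map_mul, map_pow, map_one] at h1
  apply mul_right_cancel₀ hb0
  rw [hP, add_mul, map_mul, map_mul]
  have h2 : io G ^ k * (io t * io P * (io b)⁻¹) * io b = io G ^ k * (io t * io P) := by
    field_simp
  rw [h2]
  linear_combination (- io P) * h1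

/-- every nonzero polynomial divides a power of `G` times something prime to `G` -/
theorem dvd_pow_mul {G : Polynomial K} (P : Polynomial K) (hP : P ≠ 0) :
    ∃ N b, IsCoprime b G ∧ P ∣ G ^ N * b := by
  classical
  induction hd : P.natDegree using Nat.strong_induction_on generalizing P with
  | _ d ih =>
  by_cases hc : IsCoprime P G
  · exact ⟨0, P, hc, by rw [pow_zero, one_mul]⟩
  · let D := EuclideanDomain.gcd P G
    have hDu : ¬ IsUnit D := fun h => hc (EuclideanDomain.gcd_isUnit_iff.1 h)
    obtain ⟨Q, hQ⟩ := EuclideanDomain.gcd_dvd_left P G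
    have hQ0 : Q ≠ 0 := by rintro rfl; rw [mul_zero] at hQ; exact hP hQ
    have hD0 : D ≠ 0 := by
      intro h; apply hP; rw [hQ]; change D * Q = 0; rw [h, zero_mul]
    have hDd : 0 < D.natDegree := by
      rw [Nat.pos_iff_ne_zero]
      intro h
      exact hDu (Polynomial.isUnit_iff_degree_eq_zero.2 (by rw [Polynomial.degree_eq_natDegree hD0, h]; rfl))
    have hdeg : P.natDegree = D.natDegree + Q.natDegree := by
      conv_lhs => rw [hQ]
      exact Polynomial.natDegree_mul hD0 hQ0
    obtain ⟨N, b, hb, hd'⟩ := ih Q.natDegree (by omega) Q hQ0 rfl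
    refine ⟨N + 1, b, hb, ?_⟩
    rw [hQ, pow_succ, mul_comm (G ^ N) G, mul_assoc]
    exact mul_dvd_mul (EuclideanDomain.gcd_dvd_right P G) hd'

section absO
variable {O : Type*} [CommRing O] [IsLocalRing O] [Algebra K O] [Algebra O (RatFunc K)]
  [IsScalarTower K O (RatFunc K)]

theorem aeval_z (P : Polynomial K) : Polynomial.aeval (io (Polynomial.X : Polynomial K)) P = io P := by
  rw [Polynomial.aeval_algHom_apply, Polynomial.aeval_X_left_apply]

theorem z_integral (ξ : O) (hξ : ξ ∈ IsLocalRing.maximalIdeal O) (n : ℕ) (P κ : Polynomial K) (hP : P.natDegree = n)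
    (hP0 : P ≠ 0) (hκ : κ.natDegree ≤ n) (h : algebraMap O (RatFunc K) ξ * io κ = io P) :
    IsIntegral O (io (Polynomial.X : Polynomial K)) := by
  let T : Polynomial O := P.map (algebraMap K O) - Polynomial.C ξ * κ.map (algebraMap K O)
  have hTd : T.natDegree ≤ n := by
    refine (Polynomial.natDegree_sub_le _ _).trans (max_le ?_ ?_)
    · exact Polynomial.natDegree_map_le.trans hP.le
    · exact (Polynomial.natDegree_C_mul_le _ _).trans (Polynomial.natDegree_map_le.trans hκ)
  have hTn : IsUnit (T.coeff n) := by
    simp only [T, Polynomial.coeff_sub, Polynomial.coeff_C_mul, Polynomial.coeff_map]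
    by_contra hnu
    have h1 : algebraMap K O (P.coeff n) - ξ * algebraMap K O (κ.coeff n) ∈ IsLocalRing.maximalIdeal O := hnu
    have h2 := Ideal.mul_mem_right (algebraMap K O (κ.coeff n)) _ hξ
    have h3 := add_mem h1 h2
    rw [sub_add_cancel] at h3
    apply h3
    apply IsUnit.map
    rw [isUnit_iff_ne_zero, ← hP]
    exact Polynomial.leadingCoeff_ne_zero.2 hP0
  obtain ⟨u, hu⟩ := hTn.exists_left_inv
  refine ⟨Polynomial.C u * T, ?_, ?_⟩
  · apply Polynomial.monic_of_natDegree_le_of_coeff_eq_one n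
    · exact (Polynomial.natDegree_C_mul_le _ _).trans hTd
    · rw [Polynomial.coeff_C_mul, hu]
  · rw [Polynomial.eval₂_mul, ← Polynomial.aeval_def, ← Polynomial.aeval_def]
    have : Polynomial.aeval (io (Polynomial.X : Polynomial K)) T = 0 := by
      simp only [T, map_sub, map_mul, Polynomial.aeval_map_algebraMap, aeval_z, Polynomial.aeval_C]
      rw [h, sub_self]
    rw [this, mul_zero]

theorem io_integral (hz : IsIntegral O (io (Polynomial.X : Polynomial K))) (P : Polynomial K) :
    IsIntegral O (io P) := by
  rw [← aeval_z, ← Polynomial.aeval_map_algebraMap O]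
  have h1 : Algebra.adjoin O {(io (Polynomial.X : Polynomial K))} ≤ integralClosure O (RatFunc K) :=
    Algebra.adjoin_le (Set.singleton_subset_iff.2 hz)
  exact h1 (Polynomial.aeval_mem_adjoin_singleton _ _)

theorem inv_mem_adjoin (G : Polynomial K) (ξ : Fin 2 → O) (hξ : ∀ i, ξ i ∈ IsLocalRing.maximalIdeal O)
    (A : Fin 2 → Polynomial K) (κ : Polynomial K)
    (hz : IsIntegral O (io (Polynomial.X : Polynomial K)))
    (hA : ∀ i, algebraMap O (RatFunc K) (ξ i) * io κ = io (G * A i)) (hcop : IsCoprime (A 0) (A 1))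
    (b : Polynomial K) (hb : IsCoprime b G) (hG : 0 < G.natDegree) :
    (io b)⁻¹ ∈ Algebra.adjoin O {(io (Polynomial.X : Polynomial K))} := by
  set N := Algebra.adjoin O {(io (Polynomial.X : Polynomial K))} with hN
  have hio : ∀ P : Polynomial K, io P ∈ N := by
    intro P
    rw [← aeval_z, ← Polynomial.aeval_map_algebraMap O]
    exact Polynomial.aeval_mem_adjoin_singleton _ _
  have hintg : Algebra.IsIntegral O N := by
    constructor
    intro y
    have : N ≤ integralClosure O (RatFunc K) := Algebra.adjoin_le (Set.singleton_subset_iff.2 hz)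
    have h1 : IsIntegral O (y : RatFunc K) := this y.2
    exact (isIntegral_algHom_iff N.val Subtype.val_injective).1 h1
  let b' : N := ⟨io b, hio b⟩
  have hu : IsUnit b' := by
    by_contra hnu
    obtain ⟨M, hM, hbM⟩ := exists_max_ideal_of_mem_nonunits hnu
    have hcm : (M.comap (algebraMap O N)).IsMaximal := Ideal.isMaximal_comap_of_isIntegral_of_isMaximal M
    have hcm' := IsLocalRing.eq_maximalIdeal hcm
    have hξM : ∀ i, algebraMap O N (ξ i) ∈ M := fun i => by
      have : ξ i ∈ M.comap (algebraMap O N) := by rw [hcm']; exact hξ i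
      exact this
    obtain ⟨s, t, hst⟩ := hb
    obtain ⟨r0, r1, hr⟩ := hcop
    have hkey : (1 : N) = ⟨io s, hio s⟩ * b' + ⟨io (t * r0 * κ), hio _⟩ * algebraMap O N (ξ 0)
        + ⟨io (t * r1 * κ), hio _⟩ * algebraMap O N (ξ 1) := by
      apply Subtype.ext
      change (1 : RatFunc K) = io s * io b + io (t * r0 * κ) * algebraMap O (RatFunc K) (ξ 0) + io (t * r1 * κ) * algebraMap O (RatFunc K) (ξ 1)
      have h1 := congrArg io hst
      have h2 := congrArg io hr
      have e0 := hA 0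
      have e1 := hA 1
      simp only [map_add, map_mul, map_one] at h1 h2 e0 e1 ⊢
      linear_combination -h1 - io t * io r0 * e0 - io t * io r1 * e1 - io t * io G * h2
    apply hM.ne_top
    rw [Ideal.eq_top_iff_one, hkey]
    exact add_mem (add_mem (M.mul_mem_left _ hbM) (M.mul_mem_left _ (hξM 0))) (M.mul_mem_left _ (hξM 1))
  obtain ⟨y, hy⟩ := hu.exists_right_inv
  have hy' : io b * (y : RatFunc K) = 1 := congrArg Subtype.val hy
  rw [inv_eq_of_mul_eq_one_right hy']
  exact y.2

theorem conductor_BB [IsFractionRing O (RatFunc K)] (G : Polynomial K) (ξ : Fin 2 → O) (hξ : ∀ i, ξ i ∈ IsLocalRing.maximalIdeal O)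
    (A : Fin 2 → Polynomial K) (κ : Polynomial K)
    (hz : IsIntegral O (io (Polynomial.X : Polynomial K)))
    (hA : ∀ i, algebraMap O (RatFunc K) (ξ i) * io κ = io (G * A i)) (hcop : IsCoprime (A 0) (A 1))
    (hG : 0 < G.natDegree) (hOB : ∀ o : O, algebraMap O (RatFunc K) o ∈ BB G) :
    ∃ N, ∀ y ∈ BB G, ∃ o : O, algebraMap O (RatFunc K) o = io G ^ N * y := by
  classical
  set N := Algebra.adjoin O {(io (Polynomial.X : Polynomial K))} with hN
  have hio : ∀ P : Polynomial K, io P ∈ N := by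
    intro P
    rw [← aeval_z, ← Polynomial.aeval_map_algebraMap O]
    exact Polynomial.aeval_mem_adjoin_singleton _ _
  have hBN : ∀ y ∈ BB G, y ∈ N := by
    rintro y ⟨P, b, hb, h⟩
    have : y = io P * (io b)⁻¹ := by rw [← h, mul_assoc, mul_inv_cancel₀ (io_ne (cop_ne hG hb)), mul_one]
    rw [this]
    exact mul_mem (hio P) (inv_mem_adjoin G ξ hξ A κ hz hA hcop b hb hG)
  obtain ⟨S, hS⟩ := hz.fg_adjoin_singleton
  obtain ⟨d, hd⟩ := IsLocalization.exist_integer_multiples_of_finset (nonZeroDivisors O) S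
  have hdN : ∀ y ∈ N, ∃ o : O, algebraMap O (RatFunc K) o = algebraMap O (RatFunc K) d * y := by
    intro y hy
    have hy' : y ∈ Submodule.span O (S : Set (RatFunc K)) := by rw [hS]; exact hy
    induction hy' using Submodule.span_induction with
    | mem y h =>
      obtain ⟨o, ho⟩ := hd y h
      exact ⟨o, by rw [ho, Algebra.smul_def]⟩
    | zero => exact ⟨0, by simp⟩
    | add y y' h h' i i' =>
      have e1 : y ∈ N := by rw [hS] at h; exact h
      have e2 : y' ∈ N := by rw [hS] at h'; exact h'
      obtain ⟨o, ho⟩ := i e1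
      obtain ⟨o', ho'⟩ := i' e2
      exact ⟨o + o', by rw [map_add, ho, ho', mul_add]⟩
    | smul a y h i =>
      have e1 : y ∈ N := by rw [hS] at h; exact h
      obtain ⟨o, ho⟩ := i e1
      exact ⟨a * o, by rw [map_mul, ho, Algebra.smul_def]; ring⟩
  have hd0 : algebraMap O (RatFunc K) d ≠ 0 := IsFractionRing.to_map_ne_zero_of_mem_nonZeroDivisors d.2
  obtain ⟨P, b, hb, hP⟩ := hOB d
  have hb0 := io_ne (cop_ne hG hb)
  have hP0 : P ≠ 0 := by
    rintro rfl
    rw [map_zero] at hP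
    exact (mul_ne_zero hd0 hb0) hP
  obtain ⟨M, b2, hb2, Q, hQ⟩ := dvd_pow_mul (G := G) P hP0
  refine ⟨M, fun y hy => ?_⟩
  have hb20 := io_ne (cop_ne hG hb2)
  obtain ⟨o, ho⟩ := hdN (io (b * Q) * (io b2)⁻¹ * y) (hBN _ (mul_mem (mul_mem (io_mem _ _) (inv_mem_BB hG hb2)) hy))
  refine ⟨o, ?_⟩
  rw [ho]
  have h1 := congrArg io hQ
  simp only [map_mul, map_pow] at h1
  rw [← hP] at h1
  rw [map_mul]
  field_simp
  linear_combination (-y) * h1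

theorem integral_mem_BB (G : Polynomial K) (hG : 0 < G.natDegree)
    (hOB : ∀ o : O, algebraMap O (RatFunc K) o ∈ BB G) (y : RatFunc K) (hy : IsIntegral O y) : y ∈ BB G := by
  let M : Submonoid (Polynomial K) :=
    { carrier := {b | IsCoprime b G}
      mul_mem' := fun h h' => IsCoprime.mul_left h h'
      one_mem' := isCoprime_one_left }
  have hM : M ≤ nonZeroDivisors (Polynomial K) := fun b hb => mem_nonZeroDivisors_of_ne_zero (cop_ne hG hb)
  let B := Localization.subalgebra.ofField (RatFunc K) M hM
  have hB : ∀ y ∈ BB G, y ∈ B := by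
    rintro y ⟨P, b, hb, h⟩
    refine ⟨P, b, hb, ?_⟩
    change y = io P * (io b)⁻¹
    rw [← h, mul_assoc, mul_inv_cancel₀ (io_ne (cop_ne hG hb)), mul_one]
  let g : O →+* B := (algebraMap O (RatFunc K)).codRestrict B.toSubring (fun o => hB _ (hOB o))
  obtain ⟨p, hp, hp0⟩ := hy
  have hyB : IsIntegral B y := by
    refine ⟨p.map g, hp.map _, ?_⟩
    rw [Polynomial.eval₂_map]
    exact hp0
  obtain ⟨m, hm⟩ := IsIntegral.exists_multiple_integral_of_isLocalization (R := Polynomial K) (Rₘ := B) M y hyB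
  obtain ⟨P, hP⟩ := IsIntegrallyClosed.isIntegral_iff.1 hm
  refine ⟨P, m, m.2, ?_⟩
  change _ = algebraMap _ _ P
  rw [hP, Submonoid.smul_def, Algebra.smul_def, mul_comm]
  rfl
end absO
end P10

section P11
variable {K : Type*} [Field K]
set_option linter.unusedSectionVars false

section absD
variable {O : Type*} [CommRing O] [IsLocalRing O] [Algebra K O] [Algebra O (RatFunc K)]
  [IsScalarTower K O (RatFunc K)] [IsFractionRing O (RatFunc K)]

theorem delta_abs {L : Type*} [Field L] [Algebra O L] [IsFractionRing O L] [Algebra K L] [IsScalarTower K O L]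
    (G : Polynomial K) (hz : IsIntegral O (io (Polynomial.X : Polynomial K)))
    (hG : 0 < G.natDegree) (hOB : ∀ o : O, algebraMap O (RatFunc K) o ∈ BB G)
    (N : ℕ) (hN : ∀ y ∈ BB G, ∃ o : O, algebraMap O (RatFunc K) o = io G ^ N * y)
    {R : Type*} [AddCommGroup R] [Module K R] (β : Polynomial K →ₗ[K] R) (hβ : Function.Surjective β)
    (hk : ∀ P, β P = 0 ↔ ∃ o : O, algebraMap O (RatFunc K) o = io P) :
    Module.finrank K ((integralClosure O L) ⧸
      LinearMap.range ((Algebra.linearMap O (integralClosure O L)).restrictScalars K)) = Module.finrank K R := by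
  let e : RatFunc K ≃ₐ[O] L := IsLocalization.algEquiv (nonZeroDivisors O) (RatFunc K) L
  have heK : ∀ (r : K) (y : RatFunc K), e (r • y) = r • e y := by
    intro r y
    rw [← IsScalarTower.algebraMap_smul O r y, map_smul, IsScalarTower.algebraMap_smul]
  let j : Polynomial K →ₗ[K] integralClosure O L :=
    { toFun := fun P => ⟨e (io P), (io_integral hz P).map e.toAlgHom⟩
      map_add' := fun P Q => Subtype.ext (by simp)
      map_smul' := fun r P => Subtype.ext (by simp [heK]) }
  let S := LinearMap.range ((Algebra.linearMap O (integralClosure O L)).restrictScalars K)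
  let α : Polynomial K →ₗ[K] (integralClosure O L ⧸ S) := S.mkQ ∘ₗ j
  have hα : Function.Surjective α := by
    intro y
    obtain ⟨y, rfl⟩ := S.mkQ_surjective y
    have h1 : IsIntegral O (e.symm y.1) := IsIntegral.map e.symm.toAlgHom y.2
    obtain ⟨P, y', hy', hP⟩ := BB_approx hG N _ (integral_mem_BB G hG hOB _ h1)
    obtain ⟨o, ho⟩ := hN y' hy'
    refine ⟨P, ?_⟩
    change S.mkQ (j P) = _
    rw [← sub_eq_zero, ← map_sub, Submodule.mkQ_apply, Submodule.Quotient.mk_eq_zero]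
    refine ⟨-o, ?_⟩
    apply Subtype.ext
    change algebraMap O L (-o) = e (io P) - y.1
    have h2 : y.1 = e (io P) + algebraMap O L o := by
      rw [← e.commutes o, ho, ← map_add, ← hP, e.apply_symm_apply]
    rw [h2, map_neg]; ring
  have hker : LinearMap.ker α = LinearMap.ker β := by
    ext P
    rw [LinearMap.mem_ker, LinearMap.mem_ker, hk]
    change S.mkQ (j P) = 0 ↔ _
    rw [Submodule.mkQ_apply, Submodule.Quotient.mk_eq_zero]
    constructor
    · rintro ⟨o, ho⟩
      refine ⟨o, e.injective ?_⟩
      rw [e.commutes]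
      exact congrArg Subtype.val ho
    · rintro ⟨o, ho⟩
      refine ⟨o, Subtype.ext ?_⟩
      change algebraMap O L o = e (io P)
      rw [← ho, e.commutes]
  have e1 := (LinearMap.quotKerEquivOfSurjective α hα).finrank_eq
  have e2 := (LinearMap.quotKerEquivOfSurjective β hβ).finrank_eq
  rw [hker] at e1
  exact e1.symm.trans e2
end absD
end P11

section P12
variable {K : Type*} [Field K]
set_option linter.unusedSectionVars false

/-- the multiplicative set -/
abbrev lM (I : Ideal (MvPolynomial (Fin 2) K)) (a : Fin 2 → K) : Submonoid (MvPolynomial (Fin 2) K ⧸ I) :=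
  ((RingHom.ker (MvPolynomial.eval a : MvPolynomial (Fin 2) K →+* K)).primeCompl).map (Ideal.Quotient.mk I)

/-- the structure map to the local ring -/
def lmk (I : Ideal (MvPolynomial (Fin 2) K)) (a : Fin 2 → K) : MvPolynomial (Fin 2) K →ₐ[K] LocalRingAt I a :=
  (IsScalarTower.toAlgHom K (MvPolynomial (Fin 2) K ⧸ I) (Localization (lM I a))).comp (Ideal.Quotient.mkₐ K I)

theorem lmk_surj (I : Ideal (MvPolynomial (Fin 2) K)) (a : Fin 2 → K) (r : LocalRingAt I a) :
    ∃ H H', eval a H' ≠ 0 ∧ r * lmk I a H' = lmk I a H := by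
  obtain ⟨⟨x, s⟩, h⟩ := IsLocalization.surj (S := Localization (lM I a)) (lM I a) r
  obtain ⟨_, H', hH', rfl⟩ := s
  obtain ⟨H, rfl⟩ := Ideal.Quotient.mk_surjective x
  exact ⟨H, H', hH', h⟩

theorem lmk_unit (I : Ideal (MvPolynomial (Fin 2) K)) (a : Fin 2 → K) (H : MvPolynomial (Fin 2) K)
    (h : eval a H ≠ 0) : IsUnit (lmk I a H) := by
  exact IsLocalization.map_units (Localization (lM I a)) (⟨Ideal.Quotient.mk I H, H, h, rfl⟩ : lM I a)

theorem lmk_zero (I : Ideal (MvPolynomial (Fin 2) K)) (a : Fin 2 → K) (H : MvPolynomial (Fin 2) K)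
    (h : H ∈ I) : lmk I a H = 0 := by
  have h1 : Ideal.Quotient.mk I H = 0 := Ideal.Quotient.eq_zero_iff_mem.2 h
  change algebraMap (MvPolynomial (Fin 2) K ⧸ I) (Localization (lM I a)) (Ideal.Quotient.mk I H) = 0
  rw [h1, map_zero]

theorem lmk_lift (I : Ideal (MvPolynomial (Fin 2) K)) (a : Fin 2 → K) {A : Type*} [CommRing A] [Algebra K A]
    (θ : MvPolynomial (Fin 2) K →ₐ[K] A) (h0 : ∀ H ∈ I, θ H = 0) (hu : ∀ H, eval a H ≠ 0 → IsUnit (θ H)) :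
    ∃ τ : LocalRingAt I a →ₐ[K] A, ∀ H, τ (lmk I a H) = θ H := by
  let θ' : (MvPolynomial (Fin 2) K ⧸ I) →ₐ[K] A := Ideal.Quotient.liftₐ I θ h0
  have hu' : ∀ y : lM I a, IsUnit (θ' y) := by
    rintro ⟨_, H, hH, rfl⟩
    exact hu H hH
  let τ : Localization (lM I a) →ₐ[K] A := IsLocalization.liftAlgHom (M := lM I a) (S := Localization (lM I a)) (f := θ') hu'
  refine ⟨τ, fun H => ?_⟩
  change τ (algebraMap _ _ (Ideal.Quotient.mk I H)) = _
  exact IsLocalization.lift_eq (M := lM I a) (g := (θ' : (MvPolynomial (Fin 2) K ⧸ I) →+* A)) hu' _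

theorem lmk_res (I : Ideal (MvPolynomial (Fin 2) K)) (a : Fin 2 → K) (hI : ∀ H ∈ I, eval a H = 0) :
    ∃ τ : LocalRingAt I a →ₐ[K] K, (∀ H, τ (lmk I a H) = eval a H) ∧ (∀ r, τ r ≠ 0 → IsUnit r) := by
  obtain ⟨τ, hτ⟩ := lmk_lift I a (aeval a) (fun H h => by rw [aeval_eq_eval]; exact hI H h)
    (fun H h => by rw [aeval_eq_eval]; exact isUnit_iff_ne_zero.2 h)
  have hτ' : ∀ H, τ (lmk I a H) = eval a H := fun H => by rw [hτ, aeval_eq_eval]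
  refine ⟨τ, hτ', fun r hr => ?_⟩
  obtain ⟨H, H', hH', h⟩ := lmk_surj I a r
  have h1 : eval a H ≠ 0 := by
    rw [← hτ', ← h, map_mul, hτ']
    exact mul_ne_zero hr hH'
  have := lmk_unit I a H h1
  rw [← h] at this
  exact isUnit_of_mul_isUnit_left this

theorem local_of_res {R : Type*} [CommRing R] [Algebra K R] (τ : R →ₐ[K] K) (h : ∀ r, τ r ≠ 0 → IsUnit r) :
    IsLocalRing R := by
  have : Nontrivial R := τ.toRingHom.domain_nontrivial
  have hu : ∀ r, ¬ IsUnit r ↔ τ r = 0 := fun r => ⟨fun h1 => by by_contra h2; exact h1 (h r h2), fun h1 h2 => by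
    have := h2.map τ
    rw [h1] at this
    exact not_isUnit_zero this⟩
  refine IsLocalRing.of_nonunits_add (fun x y hx hy => ?_)
  rw [mem_nonunits_iff, hu] at *
  rw [map_add, hx, hy, add_zero]

end P12

section P13
variable {K : Type*} [Field K]
set_option linter.unusedSectionVars false

/-- the data of the parameterization near a point -/
structure PD (n : ℕ) (G κ : Polynomial K) (A : Fin 2 → Polynomial K) (a : Fin 2 → K) (x : Fin 2 → RatFunc K)
    (Φ : MvPolynomial (Fin 2) K) : Prop where
  hG : G.Monic
  hG2 : G.natDegree = 2
  hA : IsCoprime (A 0) (A 1)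
  hκ : IsCoprime κ G
  hκn : κ.natDegree ≤ n
  hA0 : A 0 ≠ 0
  hGA : (G * A 0).natDegree = n
  hx : ∀ i, x i * io κ = io (Polynomial.C (a i) * κ + G * A i)
  hker : ∀ H, aeval x H = 0 ↔ Φ ∣ H
  hbir : ∀ S : IntermediateField K (RatFunc K), (∀ i, x i ∈ S) → S = ⊤

variable {n : ℕ} {G κ : Polynomial K} {A : Fin 2 → Polynomial K} {a : Fin 2 → K} {x : Fin 2 → RatFunc K}
    {Φ : MvPolynomial (Fin 2) K}

theorem PD.pos (D : PD n G κ A a x Φ) : 0 < G.natDegree := by rw [D.hG2]; norm_num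

theorem PD.κ0 (D : PD n G κ A a x Φ) : io κ ≠ 0 := io_ne (cop_ne D.pos D.hκ)

theorem ev_mod (D : PD n G κ A a x Φ) (H : MvPolynomial (Fin 2) K) :
    ∃ y ∈ BB G, aeval x H = io (Polynomial.C (eval a H)) + io G * y := by
  have hxi : ∀ i, x i = io (Polynomial.C (a i)) + io G * (io (A i) * (io κ)⁻¹) := by
    intro i
    have := D.hx i
    have h0 := D.κ0
    rw [map_add, map_mul, map_mul] at this
    field_simp
    rw [this]
  induction H using MvPolynomial.induction_on with
  | C r => exact ⟨0, zero_mem _, by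
      rw [mul_zero, add_zero, eval_C, algHom_C, ← Polynomial.algebraMap_eq, AlgHom.commutes]⟩
  | add p q hp hq =>
    obtain ⟨y, hy, e⟩ := hp
    obtain ⟨y', hy', e'⟩ := hq
    exact ⟨y + y', add_mem hy hy', by rw [map_add, e, e', map_add, map_add, map_add]; ring⟩
  | mul_X p i hp =>
    obtain ⟨y, hy, e⟩ := hp
    refine ⟨y * x i + io (Polynomial.C (eval a p)) * (io (A i) * (io κ)⁻¹), ?_, ?_⟩
    · have h2 : io (A i) * (io κ)⁻¹ ∈ BB G := mul_mem (io_mem _ _) (inv_mem_BB D.pos D.hκ)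
      have h1 : x i ∈ BB G := by
        rw [hxi]
        exact add_mem (io_mem _ _) (mul_mem (io_mem _ _) h2)
      exact add_mem (mul_mem hy h1) (mul_mem (io_mem _ _) h2)
    · rw [map_mul, aeval_X, e, map_mul, eval_X, map_mul, map_mul]
      have := hxi i
      linear_combination (io (Polynomial.C (eval a p))) * this

theorem ev_ne (D : PD n G κ A a x Φ) (H : MvPolynomial (Fin 2) K) (h : eval a H ≠ 0) : aeval x H ≠ 0 := by
  intro h0
  obtain ⟨y, hy, e⟩ := ev_mod D H
  rw [h0] at e
  have h1 : io (Polynomial.C (eval a H)) = io G ^ 1 * (-y) := by linear_combination -e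
  have h2 := dvd_of_BB 1 (-y) (neg_mem hy) h1
  rw [pow_one] at h2
  have h3 := Polynomial.natDegree_le_of_dvd h2 (Polynomial.C_ne_zero.2 h)
  rw [D.hG2, Polynomial.natDegree_C] at h3
  omega

/-- the local ring as a subset of rational functions -/
def OO (x : Fin 2 → RatFunc K) (a : Fin 2 → K) : Set (RatFunc K) :=
  {y | ∃ H H' : MvPolynomial (Fin 2) K, eval a H' ≠ 0 ∧ y * aeval x H' = aeval x H}

theorem exists_psi (D : PD n G κ A a x Φ) :
    ∃ (ψ : LocalRingAt (Ideal.span {Φ}) a →ₐ[K] RatFunc K), (∀ H, ψ (lmk _ a H) = aeval x H) ∧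
      (∀ y, y ∈ OO x a ↔ ∃ o, ψ o = y) ∧ (∀ o, ψ o ∈ BB G) ∧ IsLocalRing (LocalRingAt (Ideal.span {Φ}) a) ∧
      (∀ H, eval a H = 0 → ¬ IsUnit (lmk (Ideal.span {Φ}) a H)) ∧
      @IsFractionRing (LocalRingAt (Ideal.span {Φ}) a) _ (RatFunc K) _ ψ.toRingHom.toAlgebra := by
  obtain ⟨ψ, hψ⟩ := lmk_lift (Ideal.span {Φ}) a (aeval x)
    (fun H h => (D.hker H).2 (Ideal.mem_span_singleton.1 h)) (fun H h => isUnit_iff_ne_zero.2 (ev_ne D H h))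
  have hev : ∀ H ∈ Ideal.span {Φ}, eval a H = 0 := by
    intro H hH
    by_contra h
    exact ev_ne D H h ((D.hker H).2 (Ideal.mem_span_singleton.1 hH))
  obtain ⟨τ, hτ, hτu⟩ := lmk_res (Ideal.span {Φ}) a hev
  have hOO : ∀ y, y ∈ OO x a ↔ ∃ o, ψ o = y := by
    intro y
    constructor
    · rintro ⟨H, H', hH', h⟩
      obtain ⟨u, hu⟩ := (lmk_unit (Ideal.span {Φ}) a H' hH').exists_right_inv
      refine ⟨lmk _ a H * u, ?_⟩
      have h1 := congrArg ψ hu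
      rw [map_mul, hψ, map_one] at h1
      rw [map_mul, hψ, ← h, mul_assoc, h1, mul_one]
    · rintro ⟨o, rfl⟩
      obtain ⟨H, H', hH', h⟩ := lmk_surj _ _ o
      exact ⟨H, H', hH', by rw [← hψ, ← hψ, ← h, map_mul]⟩
  have hBB : ∀ o, ψ o ∈ BB G := by
    intro o
    obtain ⟨H, H', hH', h⟩ := lmk_surj _ _ o
    have h1 := congrArg ψ h
    rw [map_mul, hψ, hψ] at h1
    obtain ⟨y, hy, e⟩ := ev_mod D H
    obtain ⟨y', ⟨P, b, hb, hP⟩, e'⟩ := ev_mod D H'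
    have hHB : aeval x H ∈ BB G := by rw [e]; exact add_mem (io_mem _ _) (mul_mem (io_mem _ _) hy)
    have hcop : IsCoprime (Polynomial.C (eval a H') * b + G * P) G := by
      have h2 : IsCoprime (Polynomial.C (eval a H') * b) G := by
        refine IsCoprime.mul_left ?_ hb
        exact ⟨Polynomial.C (eval a H')⁻¹, 0, by rw [zero_mul, add_zero, ← Polynomial.C_mul, inv_mul_cancel₀ hH', Polynomial.C_1]⟩
      exact IsCoprime.add_mul_left_left h2 P
    have h3 : ψ o = aeval x H * io b * (io (Polynomial.C (eval a H') * b + G * P))⁻¹ := by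
      have h4 := io_ne (cop_ne D.pos hcop)
      rw [eq_mul_inv_iff_mul_eq₀ h4, ← h1, e', map_add, map_mul, map_mul, ← hP]
      ring
    rw [h3]
    exact mul_mem (mul_mem hHB (io_mem _ _)) (inv_mem_BB D.pos hcop)
  refine ⟨ψ, hψ, hOO, hBB, local_of_res τ hτu, ?_, ?_⟩
  · intro H h hu
    have := hu.map τ
    rw [hτ, h] at this
    exact not_isUnit_zero this
  · let inst1 := ψ.toRingHom.toAlgebra
    have hinj : Function.Injective ψ := by
      rw [injective_iff_map_eq_zero]
      intro o ho
      obtain ⟨H, H', hH', h⟩ := lmk_surj _ _ o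
      have h1 := congrArg ψ h
      rw [map_mul, ho, zero_mul, hψ] at h1
      have h2 := (D.hker H).1 h1.symm
      rw [lmk_zero _ _ _ (Ideal.mem_span_singleton.2 h2)] at h
      exact ((lmk_unit _ _ H' hH').mul_left_eq_zero).1 h
    have hf : FaithfulSMul (LocalRingAt (Ideal.span {Φ}) a) (RatFunc K) :=
      (faithfulSMul_iff_algebraMap_injective _ _).2 hinj
    refine IsFractionRing.of_field _ _ (fun z => ?_)
    have hS := D.hbir (IntermediateField.adjoin K (Set.range x))
      (fun i => IntermediateField.subset_adjoin _ _ ⟨i, rfl⟩)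
    have hz : z ∈ IntermediateField.adjoin K (Set.range x) := by rw [hS]; trivial
    rw [IntermediateField.mem_adjoin_iff_div] at hz
    obtain ⟨r, hr, s, hs, rfl⟩ := hz
    rw [Algebra.adjoin_range_eq_range_aeval] at hr hs
    obtain ⟨H, rfl⟩ := hr
    obtain ⟨H', rfl⟩ := hs
    exact ⟨lmk _ a H, lmk _ a H', by
      change _ = ψ _ / ψ _
      rw [hψ, hψ]; rfl⟩

theorem conc_int (D : PD n G κ A a x Φ) (ψ : LocalRingAt (Ideal.span {Φ}) a →ₐ[K] RatFunc K)
    (hψ : ∀ H, ψ (lmk _ a H) = aeval x H) (hloc : IsLocalRing (LocalRingAt (Ideal.span {Φ}) a))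
    (hnu : ∀ H, eval a H = 0 → ¬ IsUnit (lmk (Ideal.span {Φ}) a H)) :
    @IsIntegral (LocalRingAt (Ideal.span {Φ}) a) (RatFunc K) _ _ ψ.toRingHom.toAlgebra (io Polynomial.X) ∧
    (∀ i, (lmk (Ideal.span {Φ}) a (X i - C (a i))) ∈ IsLocalRing.maximalIdeal (LocalRingAt (Ideal.span {Φ}) a)) ∧
    (∀ i, ψ (lmk (Ideal.span {Φ}) a (X i - C (a i))) * io κ = io (G * A i)) := by
  let inst1 := ψ.toRingHom.toAlgebra
  have h1 : ∀ i, (lmk (Ideal.span {Φ}) a (X i - C (a i))) ∈ IsLocalRing.maximalIdeal (LocalRingAt (Ideal.span {Φ}) a) := by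
    intro i
    apply hnu
    simp
  have h2 : ∀ i, ψ (lmk (Ideal.span {Φ}) a (X i - C (a i))) * io κ = io (G * A i) := by
    intro i
    have h3 := D.hx i
    rw [hψ, map_sub, aeval_X, algHom_C, sub_mul, h3, map_add, map_mul, ← Polynomial.algebraMap_eq, AlgHom.commutes]
    ring
  refine ⟨?_, h1, h2⟩
  have htow : IsScalarTower K (LocalRingAt (Ideal.span {Φ}) a) (RatFunc K) :=
    IsScalarTower.of_algebraMap_eq (fun r => (ψ.commutes r).symm)
  exact z_integral (lmk (Ideal.span {Φ}) a (X 0 - C (a 0))) (h1 0) n (G * A 0) κ D.hGA (mul_ne_zero D.hG.ne_zero D.hA0) D.hκn (h2 0)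

theorem conc_cond (D : PD n G κ A a x Φ) : ∃ N, ∀ y ∈ BB G, io G ^ N * y ∈ OO x a := by
  obtain ⟨ψ, hψ, hOO, hBB, hloc, hnu, hfr⟩ := exists_psi D
  obtain ⟨hz, h1, h2⟩ := conc_int D ψ hψ hloc hnu
  let inst1 := ψ.toRingHom.toAlgebra
  have htow : IsScalarTower K (LocalRingAt (Ideal.span {Φ}) a) (RatFunc K) :=
    IsScalarTower.of_algebraMap_eq (fun r => (ψ.commutes r).symm)
  obtain ⟨N, hN⟩ := conductor_BB (O := LocalRingAt (Ideal.span {Φ}) a) G (fun i => lmk (Ideal.span {Φ}) a (X i - C (a i))) h1 A κ hz h2 D.hA D.pos hBB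
  exact ⟨N, fun y hy => (hOO _).2 (hN y hy)⟩

theorem conc_delta (D : PD n G κ A a x Φ) (L : Type*) [Field L] [Algebra (LocalRingAt (Ideal.span {Φ}) a) L]
    [IsFractionRing (LocalRingAt (Ideal.span {Φ}) a) L] [Algebra K L]
    [IsScalarTower K (LocalRingAt (Ideal.span {Φ}) a) L]
    {R : Type*} [AddCommGroup R] [Module K R] (β : Polynomial K →ₗ[K] R) (hβ : Function.Surjective β)
    (hk : ∀ P, β P = 0 ↔ io P ∈ OO x a) : deltaAt (Ideal.span {Φ}) a L = Module.finrank K R := by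
  obtain ⟨ψ, hψ, hOO, hBB, hloc, hnu, hfr⟩ := exists_psi D
  obtain ⟨hz, h1, h2⟩ := conc_int D ψ hψ hloc hnu
  let inst1 := ψ.toRingHom.toAlgebra
  have htow : IsScalarTower K (LocalRingAt (Ideal.span {Φ}) a) (RatFunc K) :=
    IsScalarTower.of_algebraMap_eq (fun r => (ψ.commutes r).symm)
  obtain ⟨N, hN⟩ := conductor_BB (O := LocalRingAt (Ideal.span {Φ}) a) G (fun i => lmk (Ideal.span {Φ}) a (X i - C (a i))) h1 A κ hz h2 D.hA D.pos hBB
  exact delta_abs G hz D.pos hBB N hN β hβ (fun P => (hk P).trans (hOO _))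

end P13

section P14
variable {K : Type*} [Field K]
set_option linter.unusedSectionVars false

theorem exists_gam [IsAlgClosed K] (A : Fin 2 → Polynomial K) (hA : IsCoprime (A 0) (A 1)) (G : Polynomial K) (hG : G ≠ 0) :
    ∃ t : K, IsCoprime (A 0 + Polynomial.C t * A 1) G := by
  classical
  have := IsAlgClosed.instInfinite (K := K)
  let Pr : Polynomial K := ∏ r ∈ G.roots.toFinset, (Polynomial.C ((A 0).eval r) + Polynomial.C ((A 1).eval r) * Polynomial.X)
  have hPr : Pr ≠ 0 := by
    rw [Finset.prod_ne_zero_iff]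
    intro r _ h0
    have h1 := congrArg (fun P => Polynomial.coeff P 0) h0
    have h2 := congrArg (fun P => Polynomial.coeff P 1) h0
    simp [Polynomial.coeff_C] at h1 h2
    obtain ⟨s, t, hst⟩ := hA
    have := congrArg (Polynomial.eval r) hst
    simp [h1, h2] at this
  obtain ⟨t, ht⟩ : ∃ t, Pr.eval t ≠ 0 := by
    by_contra hh
    push Not at hh
    exact hPr (Polynomial.funext (fun r => by rw [hh r, Polynomial.eval_zero]))
  refine ⟨t, ?_⟩
  rw [Polynomial.isCoprime_iff_aeval_ne_zero_of_isAlgClosed K K]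
  intro r
  by_cases hr : G.eval r = 0
  · left
    have h1 : r ∈ G.roots.toFinset := by simp [hG, hr]
    rw [Polynomial.eval_prod, Finset.prod_ne_zero_iff] at ht
    have h2 := ht r h1
    intro h3
    apply h2
    simp at h3 ⊢
    rw [mul_comm]; exact h3
  · right
    simpa using hr

variable {R : Type*} [CommRing R] [Algebra K R]

/-- second coefficient of the remainder modulo `q` -/
def be (q : Polynomial R) : Polynomial K →ₗ[K] R where
  toFun P := ((P.map (algebraMap K R)) %ₘ q).coeff 1
  map_add' P Q := by rw [Polynomial.map_add, Polynomial.add_modByMonic, Polynomial.coeff_add]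
  map_smul' r P := by
    rw [Polynomial.smul_eq_C_mul, Polynomial.map_mul, Polynomial.map_C, ← Polynomial.smul_eq_C_mul,
      Polynomial.smul_modByMonic, Polynomial.coeff_smul, smul_eq_mul, RingHom.id_apply, Algebra.smul_def]

/-- the data for the local ring of the scheme of conics -/
structure RD (G κ : Polynomial K) (A : Fin 2 → Polynomial K) (a : Fin 2 → K) (res : R →ₐ[K] K) (q : Polynomial R)
    (lam : Fin 2 → R) (PP : Fin 2 → Polynomial R) : Prop where
  hu : ∀ r, res r ≠ 0 → IsUnit r
  hq : q.Monic
  hq2 : q.natDegree = 2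
  hres : q.map (res : R →+* K) = G
  hlam : ∀ i, (Polynomial.C (a i) * κ + G * A i).map (algebraMap K R)
    = Polynomial.C (lam i) * κ.map (algebraMap K R) + q * PP i
  hgen : ∀ g0 : R, (∀ j, g0 ∣ (G.map (algebraMap K R) - q).coeff j) → ∀ r, res r = 0 → g0 ∣ r
  huniv : ∀ e : ℕ, 0 < e → ∀ q' : Polynomial (Polynomial K ⧸ Ideal.span {(Polynomial.X : Polynomial K) ^ e}), q'.Monic → q'.natDegree = 2 →
    (∀ i, ∃ l P, (Polynomial.C (a i) * κ + G * A i).map (algebraMap K _) = Polynomial.C l * κ.map (algebraMap K _) + q' * P) →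
    (∀ j, IsNilpotent ((G.map (algebraMap K _) - q').coeff j)) →
    ∃ τ : R →ₐ[K] (Polynomial K ⧸ Ideal.span {(Polynomial.X : Polynomial K) ^ e}), q.map (τ : R →+* _) = q'

variable {n : ℕ} {G κ : Polynomial K} {A : Fin 2 → Polynomial K} {a : Fin 2 → K} {x : Fin 2 → RatFunc K}
    {Φ : MvPolynomial (Fin 2) K} {res : R →ₐ[K] K} {q : Polynomial R}
    {lam : Fin 2 → R} {PP : Fin 2 → Polynomial R}

theorem map_map_res (res : R →ₐ[K] K) (P : Polynomial K) : (P.map (algebraMap K R)).map (res : R →+* K) = P := by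
  rw [Polynomial.map_map, AlgHom.comp_algebraMap, Algebra.algebraMap_self, Polynomial.map_id]

theorem cop_lift (E : RD G κ A a res q lam PP) (b : Polynomial K) (hb : IsCoprime b G) :
    IsCoprime (b.map (algebraMap K R)) q := by
  apply coprime_of_local (res : R →+* K) E.hu q E.hq E.hq2
  rw [map_map_res, E.hres]
  exact hb

theorem res_lam (D : PD n G κ A a x Φ) (E : RD G κ A a res q lam PP) (i : Fin 2) : res (lam i) = a i := by
  have h1 := congrArg (Polynomial.map (res : R →+* K)) (E.hlam i)
  rw [map_map_res, Polynomial.map_add, Polynomial.map_mul, Polynomial.map_mul, map_map_res, E.hres, Polynomial.map_C] at h1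
  have h2 : G ∣ Polynomial.C (a i - res (lam i)) * κ := by
    refine ⟨(PP i).map (res : R →+* K) - A i, ?_⟩
    rw [Polynomial.C_sub]
    simp only [RingHom.coe_coe] at h1
    linear_combination h1
  have h3 := D.hκ.symm.dvd_of_dvd_mul_right h2
  by_contra hne
  have h4 := Polynomial.natDegree_le_of_dvd h3 (Polynomial.C_ne_zero.2 (sub_ne_zero.2 (Ne.symm hne)))
  rw [D.hG2, Polynomial.natDegree_C] at h4
  omega

theorem be_zero_iff (E : RD G κ A a res q lam PP) (P : Polynomial K) :
    be q P = 0 ↔ ∃ r, q ∣ P.map (algebraMap K R) - Polynomial.C r := by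
  constructor
  · intro h
    have h1 := rem_form q E.hq E.hq2 (P.map (algebraMap K R))
    change ((P.map (algebraMap K R)) %ₘ q).coeff 1 = 0 at h
    rw [h, Polynomial.C_0, zero_mul, add_zero] at h1
    exact ⟨_, _, by rw [sub_eq_iff_eq_add, add_comm]; exact h1⟩
  · rintro ⟨r, Q, h⟩
    exact (rem_uniq q E.hq E.hq2 _ Q r 0 (by rw [Polynomial.C_0, zero_mul, add_zero, ← h]; ring)).2

theorem ev_clear (D : PD n G κ A a x Φ) (E : RD G κ A a res q lam PP) (H : MvPolynomial (Fin 2) K) :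
    ∃ N Q, aeval x H * io κ ^ N = io Q ∧
      q ∣ Q.map (algebraMap K R) - Polynomial.C (aeval lam H) * κ.map (algebraMap K R) ^ N := by
  induction H using MvPolynomial.induction_on with
  | C r => exact ⟨0, Polynomial.C r, by
      rw [pow_zero, mul_one, algHom_C, ← Polynomial.algebraMap_eq, AlgHom.commutes], by
      rw [pow_zero, mul_one, algHom_C, Polynomial.map_C, sub_self]; exact dvd_zero _⟩
  | add p p' hp hq =>
    obtain ⟨N, Q, h1, T, h2⟩ := hp
    obtain ⟨N', Q', h1', T', h2'⟩ := hq
    refine ⟨N + N', Q * κ ^ N' + Q' * κ ^ N, ?_, T * κ.map (algebraMap K R) ^ N' + T' * κ.map (algebraMap K R) ^ N, ?_⟩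
    · simp only [map_add, map_mul, map_pow, ← h1, ← h1']; ring
    · simp only [map_add, Polynomial.map_add, Polynomial.map_mul, Polynomial.map_pow]
      rw [sub_eq_iff_eq_add] at h2 h2'
      rw [h2, h2']; ring
  | mul_X p i hp =>
    obtain ⟨N, Q, h1, T, h2⟩ := hp
    refine ⟨N + 1, Q * (Polynomial.C (a i) * κ + G * A i), ?_, ?_⟩
    · rw [map_mul, map_mul, ← h1, ← D.hx, aeval_X]; ring
    · rw [Polynomial.map_mul, E.hlam, map_mul, aeval_X, Polynomial.C_mul]
      rw [sub_eq_iff_eq_add] at h2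
      rw [h2]
      refine ⟨T * (Polynomial.C (lam i) * κ.map (algebraMap K R) + q * PP i) + Polynomial.C (aeval lam p) * κ.map (algebraMap K R) ^ N * PP i, ?_⟩
      ring

theorem II1 (D : PD n G κ A a x Φ) (E : RD G κ A a res q lam PP) (P : Polynomial K) (hP : io P ∈ OO x a) :
    be q P = 0 := by
  obtain ⟨H, H', hH', h⟩ := hP
  obtain ⟨N, Q, h1, T, h2⟩ := ev_clear D E H
  obtain ⟨N', Q', h1', T', h2'⟩ := ev_clear D E H'
  have hu : IsUnit (aeval lam H') := by
    apply E.hu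
    have h3 : res (aeval lam H') = aeval (fun i => res (lam i)) H' := by
      rw [← AlgHom.comp_apply, comp_aeval]
    rw [h3, show (fun i => res (lam i)) = a from funext (res_lam D E), aeval_eq_eval]
    exact hH'
  obtain ⟨u, hu⟩ := hu.exists_left_inv
  have h3 : P * Q' * κ ^ N = Q * κ ^ N' := by
    apply io_inj
    simp only [map_mul, map_pow, ← h1, ← h1', ← h]; ring
  have h4 := congrArg (Polynomial.map (algebraMap K R)) h3
  simp only [Polynomial.map_mul, Polynomial.map_pow] at h4
  rw [sub_eq_iff_eq_add] at h2 h2'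
  rw [h2, h2'] at h4
  rw [be_zero_iff E]
  refine ⟨u * aeval lam H, ?_⟩
  have hcop : IsCoprime q (κ.map (algebraMap K R) ^ (N + N')) := ((cop_lift E κ D.hκ).symm).pow_right
  have h5 : q ∣ (P.map (algebraMap K R) * Polynomial.C (aeval lam H') - Polynomial.C (aeval lam H)) * κ.map (algebraMap K R) ^ (N + N') := by
    refine ⟨T * κ.map (algebraMap K R) ^ N' - P.map (algebraMap K R) * T' * κ.map (algebraMap K R) ^ N, ?_⟩
    rw [pow_add]
    linear_combination h4
  have h6 := hcop.dvd_of_dvd_mul_right h5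
  have h7 := h6.mul_left (Polynomial.C u)
  have h8 := congrArg Polynomial.C hu
  rw [Polynomial.C_mul, Polynomial.C_1] at h8
  convert h7 using 1
  rw [Polynomial.C_mul]
  linear_combination (- P.map (algebraMap K R)) * h8

end P14

section P15
variable {K : Type*} [Field K]
set_option linter.unusedSectionVars false
variable {R : Type*} [CommRing R] [Algebra K R]
variable {n : ℕ} {G κ : Polynomial K} {A : Fin 2 → Polynomial K} {a : Fin 2 → K} {x : Fin 2 → RatFunc K}
    {Φ : MvPolynomial (Fin 2) K} {res : R →ₐ[K] K} {q : Polynomial R}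
    {lam : Fin 2 → R} {PP : Fin 2 → Polynomial R}

theorem res_be (E : RD G κ A a res q lam PP) (P : Polynomial K) :
    res (be q P) = (P %ₘ G).coeff 1 := by
  change res ((P.map (algebraMap K R) %ₘ q).coeff 1) = _
  have h := Polynomial.map_modByMonic (f := (res : R →+* K)) (p := P.map (algebraMap K R)) E.hq
  rw [map_map_res, E.hres] at h
  rw [← h, Polynomial.coeff_map]
  rfl

theorem be_cong (E : RD G κ A a res q lam PP) (P : Polynomial K) (Q : Polynomial K) (r : R)
    (h : q ∣ P.map (algebraMap K R) - Polynomial.C r * Q.map (algebraMap K R)) : be q P = r * be q Q := by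
  obtain ⟨S, hS⟩ := h
  have h1 := rem_form q E.hq E.hq2 (Q.map (algebraMap K R))
  refine (rem_uniq q E.hq E.hq2 (P.map (algebraMap K R)) (S + Polynomial.C r * (Q.map (algebraMap K R) /ₘ q))
    (r * (Q.map (algebraMap K R) %ₘ q).coeff 0) (r * (Q.map (algebraMap K R) %ₘ q).coeff 1) ?_).2
  rw [Polynomial.C_mul, Polynomial.C_mul]
  rw [sub_eq_iff_eq_add] at hS
  rw [hS]
  linear_combination (Polynomial.C r) * h1

/-- solve a congruence -/
theorem solve (hκ : IsCoprime κ G) (hG : G.Monic) (hG2 : G.natDegree = 2) (k : ℕ) (c : K) :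
    ∃ P, ((κ ^ k * P) %ₘ G).coeff 1 = c := by
  obtain ⟨s, t, hst⟩ := hκ.pow_left (m := k)
  refine ⟨s * (Polynomial.C c * Polynomial.X), ?_⟩
  refine (rem_uniq G hG hG2 _ (-t * (Polynomial.C c * Polynomial.X)) 0 c ?_).2
  rw [Polynomial.C_0]
  linear_combination (Polynomial.C c * Polynomial.X) * hst

theorem II2 [IsAlgClosed K] (D : PD n G κ A a x Φ) (E : RD G κ A a res q lam PP) : Function.Surjective (be (K := K) q) := by
  obtain ⟨t, ht⟩ := exists_gam A D.hA G D.hG.ne_zero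
  set γ := A 0 + Polynomial.C t * A 1 with hγ
  let g0 : R := (lam 0 - algebraMap K R (a 0)) + algebraMap K R t * (lam 1 - algebraMap K R (a 1))
  let ι := algebraMap K R
  have hnt : Nontrivial R := res.toRingHom.domain_nontrivial
  have hGg : q ∣ (G * γ).map ι - Polynomial.C g0 * κ.map ι := by
    refine ⟨PP 0 + Polynomial.C (ι t) * PP 1, ?_⟩
    have e0 := E.hlam 0
    have e1 := E.hlam 1
    simp only [hγ, g0, Polynomial.map_add, Polynomial.map_mul, Polynomial.map_C, Polynomial.C_add, Polynomial.C_sub, Polynomial.C_mul] at e0 e1 ⊢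
    simp only [ι]
    linear_combination e0 + Polynomial.C (algebraMap K R t) * e1
  have hpow : ∀ k P, be q (G ^ k * (γ ^ k * P)) = g0 ^ k * be q (κ ^ k * P) := by
    intro k P
    apply be_cong E
    have h1 : q ∣ (G * γ).map ι ^ k - (Polynomial.C g0 * κ.map ι) ^ k := hGg.trans (sub_dvd_pow_sub_pow _ _ _)
    have h2 := h1.mul_right (P.map ι)
    convert h2 using 1
    simp only [Polynomial.map_mul, Polynomial.map_pow, Polynomial.C_pow, ι]
    ring
  have hker : ∀ r, res r = 0 → g0 ∣ r := by
    apply E.hgen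
    obtain ⟨s, s', hs⟩ := cop_lift E γ ht
    obtain ⟨S, hS⟩ := hGg
    have h1 := rem_form q E.hq E.hq2 (κ.map ι * s)
    set d0 := ((κ.map ι * s) %ₘ q).coeff 0
    set d1 := ((κ.map ι * s) %ₘ q).coeff 1
    have hG3 : G.map ι = q * (s' * G.map ι + S * s + Polynomial.C g0 * ((κ.map ι * s) /ₘ q)) + Polynomial.C g0 * (Polynomial.C d0 + Polynomial.C d1 * Polynomial.X) := by
      rw [Polynomial.map_mul] at hS
      simp only [ι] at *
      linear_combination -(G.map (algebraMap K R)) * hs + s * hS + Polynomial.C g0 * h1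
    have hGf := q_form (G.map ι) (D.hG.map _) (by rw [Polynomial.Monic.natDegree_map D.hG, D.hG2])
    have hqf := q_form q E.hq E.hq2
    have hGq : G.map ι = Polynomial.C ((G.map ι).coeff 0 - q.coeff 0) + Polynomial.C ((G.map ι).coeff 1 - q.coeff 1) * Polynomial.X + q * 1 := by
      rw [Polynomial.C_sub, Polynomial.C_sub]
      linear_combination hGf - hqf
    have u1 := rem_uniq q E.hq E.hq2 _ _ _ _ hGq
    have u2 := rem_uniq q E.hq E.hq2 (G.map ι) (s' * G.map ι + S * s + Polynomial.C g0 * ((κ.map ι * s) /ₘ q)) (g0 * d0) (g0 * d1) (by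
      rw [Polynomial.C_mul, Polynomial.C_mul]; linear_combination hG3)
    have hd : G.map ι - q = Polynomial.C (g0 * d0) + Polynomial.C (g0 * d1) * Polynomial.X := by
      rw [← u2.1, ← u2.2, u1.1, u1.2]; linear_combination hGq
    intro j
    change g0 ∣ (G.map ι - q).coeff j
    rw [hd, show Polynomial.C (g0 * d0) + Polynomial.C (g0 * d1) * Polynomial.X = Polynomial.C g0 * (Polynomial.C d0 + Polynomial.C d1 * Polynomial.X) by
      rw [Polynomial.C_mul, Polynomial.C_mul]; ring, Polynomial.coeff_C_mul]
    exact Dvd.intro _ rfl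
  obtain ⟨N, hN⟩ := conc_cond D
  have hnil : g0 ^ N = 0 := by
    obtain ⟨P, hP⟩ := solve D.hκ D.hG D.hG2 N 1
    have h1 := hpow N P
    rw [II1 D E _ (by rw [map_mul, map_pow]; exact hN _ (io_mem _ _))] at h1
    have hu : IsUnit (be q (κ ^ N * P)) := E.hu _ (by rw [res_be E, hP]; exact one_ne_zero)
    exact (hu.mul_left_eq_zero).1 h1.symm
  have hind : ∀ k, ∀ r, ∃ P : Polynomial K, g0 ^ k ∣ r - be q P := by
    intro k
    induction k with
    | zero => intro r; exact ⟨0, by rw [pow_zero]; exact one_dvd _⟩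
    | succ k ih =>
      intro r
      obtain ⟨P, s, hs⟩ := ih r
      obtain ⟨P', hP'⟩ := solve D.hκ D.hG D.hG2 k (res s)
      obtain ⟨w, hw⟩ := hker (s - be q (κ ^ k * P')) (by rw [map_sub, res_be E, hP', sub_self])
      refine ⟨P + G ^ k * (γ ^ k * P'), w, ?_⟩
      rw [map_add, hpow]
      linear_combination hs + g0 ^ k * hw
  intro r
  obtain ⟨P, w, hw⟩ := hind N r
  refine ⟨P, ?_⟩
  rw [hnil, zero_mul, sub_eq_zero] at hw
  exact hw.symm

end P15

section P16
variable {K : Type*} [Field K]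
set_option linter.unusedSectionVars false

/-- abbreviation for the parameter -/
abbrev zz : RatFunc K := io (Polynomial.X : Polynomial K)

theorem io_C (r : K) : io (Polynomial.C r) = algebraMap K (RatFunc K) r := by
  rw [← Polynomial.algebraMap_eq, AlgHom.commutes]

section gg
variable {G : Polynomial K} {g w : RatFunc K}



theorem g_ne (hG : G.Monic) (hG2 : G.natDegree = 2) (hg : g = io G * w)
    (hw : w ∈ BB G) (hw' : w⁻¹ ∈ BB G) (hw0 : w ≠ 0) : g ≠ 0 := by rw [hg]; exact mul_ne_zero (io_ne hG.ne_zero) hw0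

theorem gBB (hG : G.Monic) (hG2 : G.natDegree = 2) (hg : g = io G * w)
    (hw : w ∈ BB G) (hw' : w⁻¹ ∈ BB G) (hw0 : w ≠ 0) : g ∈ BB G := by rw [hg]; exact mul_mem (io_mem _ _) hw

theorem expand_one (hG : G.Monic) (hG2 : G.natDegree = 2) (hg : g = io G * w)
    (hw : w ∈ BB G) (hw' : w⁻¹ ∈ BB G) (hw0 : w ≠ 0) (y : RatFunc K) (hy : y ∈ BB G) : ∃ c d : K, ∃ y' ∈ BB G,
    y = algebraMap K _ c + algebraMap K _ d * zz + g * y' := by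
  obtain ⟨P, y', hy', e⟩ := BB_approx (by omega) 1 y hy
  have h1 := rem_form G hG hG2 P
  refine ⟨(P %ₘ G).coeff 0, (P %ₘ G).coeff 1, w⁻¹ * (y' + io (P /ₘ G)), mul_mem hw' (add_mem hy' (io_mem _ _)), ?_⟩
  have h2 := congrArg io h1
  simp only [map_add, map_mul, io_C] at h2
  have h3 : g * (w⁻¹ * (y' + io (P /ₘ G))) = io G * (y' + io (P /ₘ G)) := by
    rw [hg]; field_simp
  rw [e, h3]
  linear_combination h2

theorem expand (hG : G.Monic) (hG2 : G.natDegree = 2) (hg : g = io G * w)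
    (hw : w ∈ BB G) (hw' : w⁻¹ ∈ BB G) (hw0 : w ≠ 0) (k : ℕ) (y : RatFunc K) (hy : y ∈ BB G) : ∃ c d : Polynomial K, ∃ y' ∈ BB G,
    y = Polynomial.aeval g c + Polynomial.aeval g d * zz + g ^ k * y' := by
  induction k with
  | zero => exact ⟨0, 0, y, hy, by simp⟩
  | succ k ih =>
    obtain ⟨c, d, y', hy', e⟩ := ih
    obtain ⟨c', d', y'', hy'', e'⟩ := expand_one hG hG2 hg hw hw' hw0 y' hy'
    refine ⟨c + Polynomial.C c' * Polynomial.X ^ k, d + Polynomial.C d' * Polynomial.X ^ k, y'', hy'', ?_⟩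
    simp only [map_add, map_mul, map_pow, Polynomial.aeval_X, Polynomial.aeval_C]
    rw [e]
    linear_combination g ^ k * e'

theorem const_zero (hG : G.Monic) (hG2 : G.natDegree = 2) (hg : g = io G * w)
    (hw : w ∈ BB G) (hw' : w⁻¹ ∈ BB G) (hw0 : w ≠ 0) (c d : K) (y : RatFunc K) (hy : y ∈ BB G)
    (h : algebraMap K _ c + algebraMap K _ d * zz = g * y) : c = 0 ∧ d = 0 := by
  have h1 : io (Polynomial.C c + Polynomial.C d * Polynomial.X) = io G ^ 1 * (w * y) := by
    rw [map_add, map_mul, io_C, io_C, h, hg]; ring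
  have h2 := dvd_of_BB 1 _ (mul_mem hw hy) h1
  rw [pow_one] at h2
  have h3 : Polynomial.C c + Polynomial.C d * Polynomial.X = 0 := by
    by_contra hne
    have h4 := Polynomial.natDegree_le_of_dvd h2 hne
    have h5 : (Polynomial.C c + Polynomial.C d * Polynomial.X).natDegree ≤ 1 := by
      rw [add_comm]; exact Polynomial.natDegree_linear_le
    omega
  have e0 := congrArg (fun P => Polynomial.coeff P 0) h3
  have e1 := congrArg (fun P => Polynomial.coeff P 1) h3
  simp [Polynomial.coeff_C] at e0 e1
  exact ⟨e0, e1⟩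

theorem div_const (hG : G.Monic) (hG2 : G.natDegree = 2) (hg : g = io G * w)
    (hw : w ∈ BB G) (hw' : w⁻¹ ∈ BB G) (hw0 : w ≠ 0) (c : Polynomial K) : ∃ c' : Polynomial K, c = Polynomial.C (c.coeff 0) + Polynomial.X * c' :=
  ⟨c.divX, by rw [add_comm]; exact (Polynomial.X_mul_divX_add c).symm⟩

theorem ord (hG : G.Monic) (hG2 : G.natDegree = 2) (hg : g = io G * w)
    (hw : w ∈ BB G) (hw' : w⁻¹ ∈ BB G) (hw0 : w ≠ 0) (k : ℕ) (c d : Polynomial K) (y : RatFunc K) (hy : y ∈ BB G)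
    (h : Polynomial.aeval g c + Polynomial.aeval g d * zz = g ^ k * y) :
    Polynomial.X ^ k ∣ c ∧ Polynomial.X ^ k ∣ d := by
  induction k generalizing c d with
  | zero => simp
  | succ k ih =>
    obtain ⟨c', hc⟩ := div_const hG hG2 hg hw hw' hw0 c
    obtain ⟨d', hd⟩ := div_const hG hG2 hg hw hw' hw0 d
    have hgB := gBB hG hG2 hg hw hw' hw0
    have hgP : ∀ P : Polynomial K, Polynomial.aeval g P ∈ BB G := fun P => by
      have := Polynomial.aeval_mem_adjoin_singleton (p := P) K g
      exact (Algebra.adjoin_le (Set.singleton_subset_iff.2 hgB) : Algebra.adjoin K {g} ≤ BB G) this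
    have hz : zz ∈ BB G := io_mem _ _
    have h0 : c.coeff 0 = 0 ∧ d.coeff 0 = 0 := by
      apply const_zero hG hG2 hg hw hw' hw0 _ _ (g ^ k * y - Polynomial.aeval g c' - Polynomial.aeval g d' * zz)
      · exact sub_mem (sub_mem (mul_mem (pow_mem hgB k) hy) (hgP _)) (mul_mem (hgP _) hz)
      · rw [hc, hd] at h
        simp only [map_add, map_mul, Polynomial.aeval_X, Polynomial.aeval_C] at h
        linear_combination h
    rw [h0.1, Polynomial.C_0, zero_add] at hc
    rw [h0.2, Polynomial.C_0, zero_add] at hd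
    have h1 := ih c' d' (by
      apply mul_left_cancel₀ (g_ne hG hG2 hg hw hw' hw0)
      rw [hc, hd] at h
      simp only [map_mul, Polynomial.aeval_X] at h
      linear_combination h)
    rw [hc, hd, pow_succ']
    exact ⟨mul_dvd_mul_left _ h1.1, mul_dvd_mul_left _ h1.2⟩

/-- evaluation -/
def Ev (g : RatFunc K) : Polynomial (Polynomial K) →+* RatFunc K :=
  Polynomial.eval₂RingHom (Polynomial.aeval g : Polynomial K →ₐ[K] RatFunc K).toRingHom zz

theorem Ev_BB (hG : G.Monic) (hG2 : G.natDegree = 2) (hg : g = io G * w)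
    (hw : w ∈ BB G) (hw' : w⁻¹ ∈ BB G) (hw0 : w ≠ 0) (Q : Polynomial (Polynomial K)) : Ev g Q ∈ BB G := by
  have hgB := gBB hG hG2 hg hw hw' hw0
  have hgP : ∀ P : Polynomial K, Polynomial.aeval g P ∈ BB G := fun P => by
    have := Polynomial.aeval_mem_adjoin_singleton (p := P) K g
    exact (Algebra.adjoin_le (Set.singleton_subset_iff.2 hgB) : Algebra.adjoin K {g} ≤ BB G) this
  have hz : (zz : RatFunc K) ∈ BB G := io_mem _ _
  change Polynomial.eval₂ _ _ Q ∈ _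
  rw [Polynomial.eval₂_eq_sum_range]
  exact sum_mem fun i _ => mul_mem (hgP _) (pow_mem hz i)

end gg

theorem Ev_C (g : RatFunc K) (p : Polynomial K) : Ev g (Polynomial.C p) = Polynomial.aeval g p := by
  change Polynomial.eval₂ _ _ _ = _
  rw [Polynomial.eval₂_C]; rfl

theorem Ev_X (g : RatFunc K) : Ev g Polynomial.X = zz := by
  change Polynomial.eval₂ _ _ _ = _
  rw [Polynomial.eval₂_X]

theorem Ev_io (g : RatFunc K) (P : Polynomial K) : Ev g (P.map Polynomial.C) = io P := by
  change Polynomial.eval₂ _ _ _ = _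
  rw [Polynomial.eval₂_map, ← aeval_z, Polynomial.aeval_def]
  congr 1
  ext r
  simp

end P16

section P17
variable {K : Type*} [Field K]
set_option linter.unusedSectionVars false
variable {R : Type*} [CommRing R] [Algebra K R]
variable {n : ℕ} {G κ : Polynomial K} {A : Fin 2 → Polynomial K} {a : Fin 2 → K} {x : Fin 2 → RatFunc K}
    {Φ : MvPolynomial (Fin 2) K} {res : R →ₐ[K] K} {q : Polynomial R}
    {lam : Fin 2 → R} {PP : Fin 2 → Polynomial R}

theorem OO_sub (D : PD n G κ A a x Φ) : ∃ S : Subalgebra K (RatFunc K), (∀ y, y ∈ S ↔ y ∈ OO x a) ∧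
    (∀ i, x i ∈ S) ∧ (∀ (c : K) (y : RatFunc K), c ≠ 0 → y ∈ BB G → algebraMap K _ c + io G * y ∈ S →
      (algebraMap K _ c + io G * y)⁻¹ ∈ S) := by
  obtain ⟨ψ, hψ, hOO, hBB, hloc, hnu, hfr⟩ := exists_psi D
  have hS : ∀ y, y ∈ ψ.range ↔ y ∈ OO x a := fun y => (hOO y).symm
  refine ⟨ψ.range, hS, fun i => ⟨lmk _ a (X i), ?_⟩, ?_⟩
  · change ψ _ = _
    rw [hψ, aeval_X]
  · intro c y hc hy h
    rw [hS] at h ⊢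
    obtain ⟨H, H', hH', e⟩ := h
    have hHa : eval a H ≠ 0 := by
      intro h0
      obtain ⟨y1, hy1, e1⟩ := ev_mod D H
      obtain ⟨y2, hy2, e2⟩ := ev_mod D H'
      rw [e1, e2, h0, Polynomial.C_0, map_zero, io_C] at e
      have h1 : io (Polynomial.C (c * eval a H')) = io G ^ 1 * (y1 - algebraMap K _ c * y2 - y * (algebraMap K _ (eval a H') + io G * y2)) := by
        rw [io_C, map_mul]
        linear_combination e
      have h2 := dvd_of_BB 1 _ (sub_mem (sub_mem hy1 (mul_mem (algebraMap_mem _ _) hy2)) (mul_mem hy (add_mem (algebraMap_mem _ _) (mul_mem (io_mem _ _) hy2)))) h1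
      rw [pow_one] at h2
      have h4 := Polynomial.natDegree_le_of_dvd h2 (Polynomial.C_ne_zero.2 (mul_ne_zero hc hH'))
      rw [D.hG2, Polynomial.natDegree_C] at h4
      omega
    refine ⟨H', H, hHa, ?_⟩
    have h0 : algebraMap K _ c + io G * y ≠ 0 := by
      intro h0
      rw [h0, zero_mul] at e
      exact ev_ne D H hHa e.symm
    rw [← e, inv_mul_cancel_left₀ h0]

theorem II3 [IsAlgClosed K] (D : PD n G κ A a x Φ) (E : RD G κ A a res q lam PP) (P : Polynomial K)
    (hP : be q P = 0) : io P ∈ OO x a := by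
  classical
  obtain ⟨S, hS, hxS, hinv⟩ := OO_sub D
  rw [← hS]
  obtain ⟨N, hN⟩ := conc_cond D
  obtain ⟨t, ht⟩ := exists_gam A D.hA G D.hG.ne_zero
  set γ := A 0 + Polynomial.C t * A 1 with hγ
  have hκ0 := D.κ0
  have hγ0 : io γ ≠ 0 := io_ne (cop_ne D.pos ht)
  set w : RatFunc K := io γ * (io κ)⁻¹ with hw
  have hwB : w ∈ BB G := mul_mem (io_mem _ _) (inv_mem_BB D.pos D.hκ)
  have hwB' : w⁻¹ ∈ BB G := by
    rw [hw, mul_inv, inv_inv]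
    exact mul_mem (inv_mem_BB D.pos ht) (io_mem _ _)
  have hw0 : w ≠ 0 := mul_ne_zero hγ0 (inv_ne_zero hκ0)
  obtain ⟨g, hg⟩ : ∃ g, g = io G * w := ⟨_, rfl⟩
  have hgB := gBB D.hG D.hG2 hg hwB hwB' hw0
  have hg0 := g_ne D.hG D.hG2 hg hwB hwB' hw0
  have hgS : g ∈ S := by
    have h1 : g = (x 0 - algebraMap K _ (a 0)) + algebraMap K _ t * (x 1 - algebraMap K _ (a 1)) := by
      have e0 := D.hx 0
      have e1 := D.hx 1
      simp only [map_add, map_mul, io_C] at e0 e1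
      apply mul_right_cancel₀ hκ0
      rw [hg, hw, show io G * (io γ * (io κ)⁻¹) * io κ = io G * io γ by field_simp, hγ, map_add, map_mul, io_C]
      linear_combination -e0 - algebraMap K _ t * e1
    rw [h1]
    exact add_mem (sub_mem (hxS 0) (algebraMap_mem _ _)) (mul_mem (algebraMap_mem _ _) (sub_mem (hxS 1) (algebraMap_mem _ _)))
  have hgP : ∀ P : Polynomial K, Polynomial.aeval g P ∈ S := fun P => by
    have := Polynomial.aeval_mem_adjoin_singleton (p := P) K g
    exact (Algebra.adjoin_le (Set.singleton_subset_iff.2 hgS) : Algebra.adjoin K {g} ≤ S) this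
  have hgPB : ∀ P : Polynomial K, Polynomial.aeval g P ∈ BB G := fun P => by
    have := Polynomial.aeval_mem_adjoin_singleton (p := P) K g
    exact (Algebra.adjoin_le (Set.singleton_subset_iff.2 hgB) : Algebra.adjoin K {g} ≤ BB G) this
  have hzB : (zz : RatFunc K) ∈ BB G := io_mem _ _
  have hNS : ∀ y ∈ BB G, g ^ N * y ∈ S := by
    intro y hy
    rw [hS, hg, mul_pow, mul_assoc]
    exact hN _ (mul_mem (pow_mem hwB _) hy)
  have hex : ∃ e, g ^ e * zz ∈ S := ⟨N, hNS _ hzB⟩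
  set e := Nat.find hex with he
  have heS : g ^ e * zz ∈ S := Nat.find_spec hex
  have hmin : ∀ m, g ^ m * zz ∈ S → e ≤ m := fun m hm => Nat.find_min' hex hm
  have heB : ∀ y ∈ BB G, g ^ e * y ∈ S := by
    intro y hy
    obtain ⟨c, d, y', hy', ey⟩ := expand D.hG D.hG2 hg hwB hwB' hw0 N y hy
    rw [ey, show g ^ e * (Polynomial.aeval g c + Polynomial.aeval g d * zz + g ^ N * y') =
      g ^ e * Polynomial.aeval g c + Polynomial.aeval g d * (g ^ e * zz) + g ^ e * (g ^ N * y') by ring]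
    exact add_mem (add_mem (mul_mem (pow_mem hgS _) (hgP _)) (mul_mem (hgP _) heS)) (mul_mem (pow_mem hgS _) (hNS _ hy'))
  have hdvd : ∀ r : Polynomial K, Polynomial.aeval g r * zz ∈ S → Polynomial.X ^ e ∣ r := by
    intro r hr
    by_cases hr0 : r = 0
    · rw [hr0]; exact dvd_zero _
    obtain ⟨r', hr', hnd⟩ := Polynomial.exists_eq_pow_rootMultiplicity_mul_and_not_dvd r hr0 0
    set m := r.rootMultiplicity 0
    rw [Polynomial.C_0, sub_zero] at hr' hnd
    have hc : r'.coeff 0 ≠ 0 := fun h => hnd (Polynomial.X_dvd_iff.2 h)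
    obtain ⟨r'', hr''⟩ := div_const D.hG D.hG2 hg hwB hwB' hw0 r'
    have hv : Polynomial.aeval g r' = algebraMap K _ (r'.coeff 0) + io G * (w * Polynomial.aeval g r'') := by
      conv_lhs => rw [hr'']
      simp only [map_add, map_mul, Polynomial.aeval_X, Polynomial.aeval_C]
      rw [hg]; ring
    have hi : (Polynomial.aeval g r')⁻¹ ∈ S := by
      have h1 := hgP r'
      rw [hv] at h1 ⊢
      exact hinv _ _ hc (mul_mem hwB (hgPB _)) h1
    have hne : Polynomial.aeval g r' ≠ 0 := by
      intro h0
      have hx := ord D.hG D.hG2 hg hwB hwB' hw0 1 r' 0 0 (zero_mem _) (by rw [h0]; simp)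
      rw [pow_one] at hx
      exact hnd hx.1
    have hm : g ^ m * zz ∈ S := by
      have h2 := mul_mem hi hr
      rw [hr', map_mul, map_pow, Polynomial.aeval_X] at h2
      convert h2 using 1
      field_simp
    rw [hr']
    exact (pow_dvd_pow _ (hmin m hm)).mul_right _
  rcases Nat.eq_zero_or_pos e with he0 | hepos
  · have := heB (io P) (io_mem _ _)
    rw [he0, pow_zero, one_mul] at this
    exact this
  obtain ⟨p, r, y2, hy2, ez⟩ := expand D.hG D.hG2 hg hwB hwB' hw0 e (zz ^ 2) (pow_mem hzB 2)
  let qe : Polynomial (Polynomial K) := Polynomial.X ^ 2 - Polynomial.C r * Polynomial.X - Polynomial.C p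
  have hqe : qe = Polynomial.X ^ 2 + (Polynomial.C (-r) * Polynomial.X + Polynomial.C (-p)) := by
    simp only [qe, Polynomial.C_neg]; ring
  have hdl : (Polynomial.C (-r) * Polynomial.X + Polynomial.C (-p) : Polynomial (Polynomial K)).degree < ((2 : ℕ) : WithBot ℕ) :=
    lt_of_le_of_lt Polynomial.degree_linear_le (by norm_num)
  have hqm : qe.Monic := by rw [hqe]; exact Polynomial.monic_X_pow_add hdl
  have hqd : qe.natDegree = 2 := by
    apply Polynomial.natDegree_eq_of_degree_eq_some
    rw [hqe, Polynomial.degree_add_eq_left_of_degree_lt (by rw [Polynomial.degree_X_pow]; exact hdl), Polynomial.degree_X_pow]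
  have hEq : Ev g qe = g ^ e * y2 := by
    simp only [qe, map_sub, map_mul, map_pow, Ev_C, Ev_X]
    linear_combination ez
  -- division in K[ε][Z]
  have hdiv : ∀ T : Polynomial (Polynomial K), ∃ Q d0 d1, T = Polynomial.C d0 + Polynomial.C d1 * Polynomial.X + qe * Q ∧
      Ev g T = Polynomial.aeval g d0 + Polynomial.aeval g d1 * zz + g ^ e * (y2 * Ev g Q) ∧ y2 * Ev g Q ∈ BB G := by
    intro T
    refine ⟨_, _, _, rem_form qe hqm hqd T, ?_, ?_⟩
    · conv_lhs => rw [rem_form qe hqm hqd T]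
      rw [map_add, map_add, map_mul, map_mul, hEq, Ev_C, Ev_C, Ev_X]
      ring
    · exact mul_mem hy2 (Ev_BB D.hG D.hG2 hg hwB hwB' hw0 _)
  let π : Polynomial K →ₐ[K] (Polynomial K ⧸ Ideal.span {(Polynomial.X : Polynomial K) ^ e}) := Ideal.Quotient.mkₐ K _
  have hπ : ∀ d, π d = 0 ↔ Polynomial.X ^ e ∣ d := fun d => by
    change Ideal.Quotient.mk _ d = 0 ↔ _
    rw [Ideal.Quotient.eq_zero_iff_mem, Ideal.mem_span_singleton]
  have hnt : Nontrivial (Polynomial K ⧸ Ideal.span {(Polynomial.X : Polynomial K) ^ e}) := by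
    refine ⟨⟨1, 0, fun h => ?_⟩⟩
    rw [← map_one π, hπ] at h
    have := Polynomial.natDegree_le_of_dvd h one_ne_zero
    rw [Polynomial.natDegree_X_pow, Polynomial.natDegree_one] at this
    omega
  have hmm : ∀ T : Polynomial K, (T.map Polynomial.C).map (π : Polynomial K →+* (Polynomial K ⧸ Ideal.span {(Polynomial.X : Polynomial K) ^ e})) = T.map (algebraMap K (Polynomial K ⧸ Ideal.span {(Polynomial.X : Polynomial K) ^ e})) := by
    intro T
    rw [Polynomial.map_map]
    rfl
  let qA := qe.map (π : Polynomial K →+* (Polynomial K ⧸ Ideal.span {(Polynomial.X : Polynomial K) ^ e}))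
  have hqAm : qA.Monic := hqm.map _
  have hqAd : qA.natDegree = 2 := by rw [Polynomial.Monic.natDegree_map hqm, hqd]
  have hfac : ∀ i, ∃ l T, (Polynomial.C (a i) * κ + G * A i).map (algebraMap K _) = Polynomial.C l * κ.map (algebraMap K _) + qA * T := by
    intro i
    obtain ⟨c, d, y', hy', ex⟩ := expand D.hG D.hG2 hg hwB hwB' hw0 e (x i) (by
      obtain ⟨ψ, hψ, hOO, hBB, _⟩ := exists_psi D
      have h1 := (hS _).1 (hxS i)
      obtain ⟨o, ho⟩ := (hOO _).1 h1
      rw [← ho]; exact hBB o)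
    have hd : Polynomial.X ^ e ∣ d := by
      apply hdvd
      have h1 : Polynomial.aeval g d * zz = x i - Polynomial.aeval g c - g ^ e * y' := by rw [ex]; ring
      rw [h1]
      exact sub_mem (sub_mem (hxS i) (hgP _)) (heB _ hy')
    obtain ⟨d', hd'⟩ := hd
    have hx2 : x i - Polynomial.aeval g c = g ^ e * (Polynomial.aeval g d' * zz + y') := by
      rw [ex, hd', map_mul, map_pow, Polynomial.aeval_X]; ring
    obtain ⟨Q, d0, d1, h1, h2, h3⟩ := hdiv ((Polynomial.C (a i) * κ + G * A i).map Polynomial.C - Polynomial.C c * κ.map Polynomial.C)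
    rw [map_sub, map_mul, Ev_io, Ev_io, Ev_C, ← D.hx] at h2
    have h4 := ord D.hG D.hG2 hg hwB hwB' hw0 e d0 d1 ((Polynomial.aeval g d' * zz + y') * io κ - y2 * Ev g Q)
      (sub_mem (mul_mem (add_mem (mul_mem (hgPB _) hzB) hy') (io_mem _ _)) h3) (by
        linear_combination io κ * hx2 - h2)
    have h5 := congrArg (Polynomial.map (π : Polynomial K →+* (Polynomial K ⧸ Ideal.span {(Polynomial.X : Polynomial K) ^ e}))) h1
    simp only [Polynomial.map_sub, Polynomial.map_add, Polynomial.map_mul, Polynomial.map_C, Polynomial.map_X, RingHom.coe_coe,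
      (hπ _).2 h4.1, (hπ _).2 h4.2, hmm, Polynomial.C_0, zero_mul, zero_add] at h5
    refine ⟨π c, Q.map (π : Polynomial K →+* (Polynomial K ⧸ Ideal.span {(Polynomial.X : Polynomial K) ^ e})), ?_⟩
    simp only [Polynomial.map_add, Polynomial.map_mul, Polynomial.map_C]
    have h6 : ∀ r : K, π (Polynomial.C r) = algebraMap K _ r := fun r => rfl
    simp only [h6] at h5
    linear_combination h5
  have hnil : ∀ j, IsNilpotent ((G.map (algebraMap K _) - qA).coeff j) := by
    have hG' := q_form G D.hG D.hG2
    obtain ⟨p', hp'⟩ := div_const D.hG D.hG2 hg hwB hwB' hw0 p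
    obtain ⟨r', hr'⟩ := div_const D.hG D.hG2 hg hwB hwB' hw0 r
    obtain ⟨e', hee⟩ : ∃ e', e = e' + 1 := ⟨e - 1, by omega⟩
    have h0 : G.coeff 0 + p.coeff 0 = 0 ∧ G.coeff 1 + r.coeff 0 = 0 := by
      apply const_zero D.hG D.hG2 hg hwB hwB' hw0 _ _ (w⁻¹ - Polynomial.aeval g p' - Polynomial.aeval g r' * zz - g ^ e' * y2)
      · exact sub_mem (sub_mem (sub_mem hwB' (hgPB _)) (mul_mem (hgPB _) hzB)) (mul_mem (pow_mem hgB _) hy2)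
      · have h1 := congrArg io hG'
        simp only [map_add, map_mul, map_pow, io_C] at h1
        have h2 : g * w⁻¹ = io G := by rw [hg]; field_simp
        rw [hp', hr', hee] at ez
        simp only [map_add, map_mul, Polynomial.aeval_X, Polynomial.aeval_C] at ez
        rw [map_add, map_add, mul_sub, mul_sub, mul_sub, h2]
        linear_combination -h1 - ez
    have hX : IsNilpotent (π Polynomial.X) := ⟨e, by rw [← map_pow, hπ]⟩
    have h3 : G.map (algebraMap K _) - qA = Polynomial.C (π Polynomial.X) * (Polynomial.C (π p') + Polynomial.C (π r') * Polynomial.X) := by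
      have e1 : p = Polynomial.C (-G.coeff 0) + Polynomial.X * p' := by
        rw [← eq_neg_of_add_eq_zero_right h0.1]; exact hp'
      have e2 : r = Polynomial.C (-G.coeff 1) + Polynomial.X * r' := by
        rw [← eq_neg_of_add_eq_zero_right h0.2]; exact hr'
      have h1 := congrArg (Polynomial.map (algebraMap K (Polynomial K ⧸ Ideal.span {(Polynomial.X : Polynomial K) ^ e}))) hG'
      have h6 : ∀ r : K, π (Polynomial.C r) = algebraMap K _ r := fun r => rfl
      simp only [Polynomial.map_add, Polynomial.map_mul, Polynomial.map_pow, Polynomial.map_C, Polynomial.map_X] at h1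
      simp only [qA, qe, Polynomial.map_sub, Polynomial.map_mul, Polynomial.map_pow, Polynomial.map_C, Polynomial.map_X, RingHom.coe_coe]
      rw [e1, e2]
      simp only [map_add π, map_mul π, h6, map_neg π, Polynomial.C_add, Polynomial.C_mul, Polynomial.C_neg]
      linear_combination h1
    intro j
    rw [h3, Polynomial.coeff_C_mul]
    exact Commute.isNilpotent_mul_right (Commute.all _ _) hX
  obtain ⟨τ, hτ⟩ := E.huniv e hepos qA hqAm hqAd hfac hnil
  obtain ⟨s, T, hT⟩ := (be_zero_iff E P).1 hP
  obtain ⟨Q, d0, d1, h1, h2, h3⟩ := hdiv (P.map Polynomial.C)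
  rw [Ev_io] at h2
  have h4 := congrArg (Polynomial.map (τ : R →+* (Polynomial K ⧸ Ideal.span {(Polynomial.X : Polynomial K) ^ e}))) hT
  rw [Polynomial.map_sub, Polynomial.map_map, AlgHom.comp_algebraMap, Polynomial.map_C, Polynomial.map_mul, hτ] at h4
  have h5 := congrArg (Polynomial.map (π : Polynomial K →+* (Polynomial K ⧸ Ideal.span {(Polynomial.X : Polynomial K) ^ e}))) h1
  simp only [Polynomial.map_add, Polynomial.map_mul, Polynomial.map_C, Polynomial.map_X, RingHom.coe_coe, hmm] at h5
  have h4' : P.map (algebraMap K (Polynomial K ⧸ Ideal.span {(Polynomial.X : Polynomial K) ^ e})) = Polynomial.C (τ s) + Polynomial.C 0 * Polynomial.X + qA * T.map (τ : R →+* (Polynomial K ⧸ Ideal.span {(Polynomial.X : Polynomial K) ^ e})) := by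
    rw [Polynomial.C_0, zero_mul, add_zero]; rw [sub_eq_iff_eq_add] at h4; rw [h4, add_comm]; rfl
  have u1 := (rem_uniq qA hqAm hqAd _ _ _ _ h4').2
  have u2 := (rem_uniq qA hqAm hqAd _ _ _ _ h5).2
  rw [u1] at u2
  obtain ⟨d', hd'⟩ := (hπ _).1 u2.symm
  rw [h2, hd', map_mul, map_pow, Polynomial.aeval_X, mul_assoc]
  exact add_mem (add_mem (hgP _) (heB _ (mul_mem (hgPB _) hzB))) (heB _ h3)

end P17

section P18
variable {K : Type*} [Field K] [IsAlgClosed K] [CharZero K] {n : ℕ} {f : Fin 3 → MvPolynomial (Fin 2) K}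
  {F : MvPolynomial (Fin 3) K}
set_option linter.unusedSectionVars false

theorem exists_PD (H : CurH n f F) (p : Fin 3 → K) (c : Fin 3) (hc : p c ≠ 0) (G : MvPolynomial (Fin 2) K)
    (hG : IsGcdOfCross f p G) (hG2 : G.IsHomogeneous 2) :
    ∃ v w : Fin 2 → K, bdet v w ≠ 0 ∧ eval v G ≠ 0 ∧ ∃ (A : Fin 2 → Polynomial K) (x : Fin 2 → RatFunc K),
      (∀ i, Polynomial.C (affOf p c i) * tl v w (f c) + Polynomial.C (eval v G)⁻¹ * tl v w G * A i = tl v w (f (chartEmb c i))) ∧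
      (∀ i, (A i).natDegree ≤ n - 2) ∧ 
      PD n (Polynomial.C (eval v G)⁻¹ * tl v w G) (tl v w (f c)) A (affOf p c) x (aeval (dehomMap c) F) := by
  have := IsAlgClosed.instInfinite (K := K)
  obtain ⟨d, A, hd, hGd, hG0, hAh, hfA, hcop⟩ := gcd_struct H p c hc G hG
  obtain rfl : d = 2 := hGd.inj_right hG2 hG0
  obtain ⟨h0, hh0, hbir⟩ := birational H
  obtain ⟨v, w, hb, hv⟩ := good_basis (h0 * G * fp f p c 0) (mul_ne_zero (mul_ne_zero hh0 hG0) (fp_ne H p c 0))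
  rw [map_mul, map_mul] at hv
  have hvf := right_ne_zero_of_mul hv
  have hvG := right_ne_zero_of_mul (left_ne_zero_of_mul hv)
  have hvh := left_ne_zero_of_mul (left_ne_zero_of_mul hv)
  have hGA : ∀ i, Polynomial.C (eval v G)⁻¹ * tl v w G * (Polynomial.C (eval v G) * tl v w (A i)) = tl v w (fp f p c i) := by
    intro i
    rw [hfA, map_mul]
    have : Polynomial.C (eval v G)⁻¹ * Polynomial.C (eval v G) = 1 := by rw [← Polynomial.C_mul, inv_mul_cancel₀ hvG, Polynomial.C_1]
    linear_combination tl v w G * tl v w (A i) * this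
  have hfc0 : f c ≠ 0 := by
    intro h
    obtain ⟨r, hr, hr'⟩ := exists_zero 2 (by norm_num) G hG2
    apply fc_ne H p c hc r hr
    · intro i; rw [hfA, map_mul, hr', zero_mul]
    · rw [h, map_zero]
  have hκ0 : tl v w (f c) ≠ 0 := fun h => hfc0 (tl_inj v w hb n _ (H.hf.homog c) h)
  have hioκ : io (tl v w (f c)) ≠ 0 := fun h => hκ0 (io_inj (by rw [h, map_zero]))
  have hsum : ∀ i, Polynomial.C (affOf p c i) * tl v w (f c) + Polynomial.C (eval v G)⁻¹ * tl v w G * (Polynomial.C (eval v G) * tl v w (A i)) = tl v w (f (chartEmb c i)) := by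
    intro i
    rw [hGA, fp, map_sub, map_mul, MvPolynomial.algHom_C]
    change _ + (_ - Polynomial.C _ * _) = _
    ring
  let x : Fin 2 → RatFunc K := fun i => io (tl v w (f (chartEmb c i))) / io (tl v w (f c))
  have hx : ∀ i, x i * io (tl v w (f c)) = io (tl v w (f (chartEmb c i))) := fun i => div_mul_cancel₀ _ hioκ
  have hdG : (tl v w G).natDegree = 2 := natDegree_tl v w 2 G hG2 hvG
  refine ⟨v, w, hb, hvG, fun i => Polynomial.C (eval v G) * tl v w (A i), x, hsum, ?_, ?_⟩
  · intro i
    exact (Polynomial.natDegree_C_mul_le _ _).trans (natDegree_tl_le v w _ _ (hAh i))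
  refine ⟨?_, ?_, ?_, ?_, natDegree_tl_le v w n _ (H.hf.homog c), ?_, ?_, ?_, ?_, ?_⟩
  · rw [Polynomial.Monic, Polynomial.leadingCoeff_mul, Polynomial.leadingCoeff_C, Polynomial.leadingCoeff, hdG, coeff_tl_top v w 2 G hG2,
      inv_mul_cancel₀ hvG]
  · rw [Polynomial.natDegree_C_mul (inv_ne_zero hvG), hdG]
  · have hu : IsUnit (Polynomial.C (eval v G)) := Polynomial.isUnit_C.2 (isUnit_iff_ne_zero.2 hvG)
    exact (isCoprime_mul_unit_left_left hu _ _).2 ((isCoprime_mul_unit_left_right hu _ _).2 (hcop v w hb))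
  · have hu : IsUnit (Polynomial.C (eval v G)⁻¹) := Polynomial.isUnit_C.2 (isUnit_iff_ne_zero.2 (inv_ne_zero hvG))
    refine (isCoprime_mul_unit_left_right hu _ _).2 ?_
    rw [Polynomial.isCoprime_iff_aeval_ne_zero_of_isAlgClosed K K]
    intro r
    by_cases hr : eval (fun i => v i * r + w i) G = 0
    · left
      rw [Polynomial.coe_aeval_eq_eval, eval_tl]
      apply fc_ne H p c hc _ (line_ne_zero v w hb r)
      intro i; rw [hfA, map_mul, hr, zero_mul]
    · right
      rw [Polynomial.coe_aeval_eq_eval, eval_tl]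
      exact hr
  · intro h
    have h1 := hGA 0
    rw [h, mul_zero] at h1
    exact fp_ne H p c 0 (tl_inj v w hb n _ (fp_homog H p c 0) h1.symm)
  · rw [hGA]; exact natDegree_tl v w n _ (fp_homog H p c 0) hvf
  · intro i; rw [hsum]; exact hx i
  · have hrf : ∀ h, rf v w h = io (tl v w h) := fun h => rf_apply v w h
    have hvan : aeval x (aeval (dehomMap c) F : MvPolynomial (Fin 2) K) = 0 := by
      have h1 := aeval_eq_dehom c (fun u => rf v w (f u)) x (fun i => by
        rw [hrf, hrf, mul_comm]; exact (hx i).symm) n F H.hom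
      have h2 : aeval (fun u => rf v w (f u)) F = rf v w (aeval f F) := by
        rw [← MvPolynomial.comp_aeval_apply]
      rw [h2, H.van, map_zero] at h1
      rcases mul_eq_zero.1 h1.symm with h3 | h3
      · rw [hrf] at h3
        exact absurd h3 (pow_ne_zero _ hioκ)
      · exact h3
    intro h
    refine ⟨fun hh => ker_eq_span x ?_ _ (dehom_prime c n (by have := H.hn; omega) F H.hom H.irr) hvan h hh, ?_⟩
    · by_contra hcon
      push Not at hcon
      choose a ha using hcon
      apply not_both_const H c a
      intro i
      apply tl_inj' v w hb n _ _ (H.hf.homog _)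
      · simpa using (MvPolynomial.isHomogeneous_C (Fin 2) (a i)).mul (H.hf.homog c)
      · apply io_inj
        rw [← hx i, ha i, map_mul, MvPolynomial.algHom_C, map_mul, AlgHom.commutes]
    · rintro ⟨h', rfl⟩
      rw [map_mul, hvan, zero_mul]
  · intro S hS
    apply hbir v w hb hvh S c hfc0
    intro u
    rw [rf_apply, rf_apply]
    rcases chartEmb_cases c u with rfl | rfl | rfl
    · have : io (tl v w (f u)) / io (tl v w (f u)) = 1 := div_self hioκ
      change io (tl v w (f u)) / io (tl v w (f u)) ∈ S
      rw [this]; exact one_mem S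
    · exact hS 0
    · exact hS 1

end P18

section P19
variable {K : Type*} [Field K]
set_option linter.unusedSectionVars false
variable {A : Type*} [CommRing A] [Algebra K A]

theorem qt_map {B : Type*} [CommRing B] [Algebra K B] (v w : Fin 2 → K) (τ : A →ₐ[K] B) (x : Fin 3 → A) (y : Fin 3 → B)
    (h : ∀ j, τ (x j) = y j) : (qt v w x).map (τ : A →+* B) = qt v w y := by
  simp only [qt, monoA, Polynomial.map_sum, Polynomial.map_mul, Polynomial.map_C, Polynomial.map_map, AlgHom.comp_algebraMap,
    RingHom.coe_coe, h]

theorem qt_smul (v w : Fin 2 → K) (s : A) (x : Fin 3 → A) : qt v w (fun j => s * x j) = Polynomial.C s * qt v w x := by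
  simp only [qt, Finset.mul_sum, Polynomial.C_mul, mul_assoc]

theorem qt_sub (v w : Fin 2 → K) (x y : Fin 3 → A) : qt v w (fun j => x j - y j) = qt v w x - qt v w y := by
  simp only [qt, ← Finset.sum_sub_distrib, Polynomial.C_sub, sub_mul]

theorem qt_natDegree (v w : Fin 2 → K) (x : Fin 3 → A) : (qt v w x).natDegree ≤ 2 := by
  apply Polynomial.natDegree_sum_le_of_forall_le
  intro j _
  exact (Polynomial.natDegree_C_mul_le _ _).trans (monoA_natDegree v w 2 j)

theorem qt_alg (v w : Fin 2 → K) (x : Fin 3 → K) : qt v w (fun j => algebraMap K A (x j)) = (qt v w x).map (algebraMap K A) := by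
  rw [← qt_map v w (Algebra.ofId K A) x (fun j => algebraMap K A (x j)) (fun j => rfl)]
  rfl

theorem qt_mem (v w : Fin 2 → K) (hb : bdet v w ≠ 0) (I : Ideal A) (x : Fin 3 → A) (h : ∀ l, (qt v w x).coeff l ∈ I) (j : Fin 3) :
    x j ∈ I := by
  have h1 : ∀ l : Fin 3, (qt v w x).coeff l = ∑ k : Fin 3, x k * algebraMap K A (Tmat v w 2 k l) := by
    intro l
    simp only [qt, Polynomial.finsetSum_coeff, Polynomial.coeff_C_mul, monoA, Polynomial.coeff_map, Tmat]
  have h2 : x j = ∑ l : Fin 3, (qt v w x).coeff l * algebraMap K A (Smat v w 2 l j) := by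
    have h3 : ∀ k : Fin 3, ∑ l : Fin 3, Tmat v w 2 k l * Smat v w 2 l j = if k = j then 1 else 0 := by
      intro k
      rw [← Matrix.one_apply, ← T_mul_S v w hb 2, Matrix.mul_apply]
    simp only [h1, Finset.sum_mul]
    rw [Finset.sum_comm]
    simp only [mul_assoc, ← Finset.mul_sum, ← map_mul, ← map_sum, h3]
    simp
  rw [h2]
  exact Ideal.sum_mem _ fun l _ => Ideal.mul_mem_right _ _ (h l)

theorem aeval_mem (I : Ideal A) (x : Fin 2 → A) (y : Fin 2 → K) (h : ∀ i, x i - algebraMap K A (y i) ∈ I)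
    (H : MvPolynomial (Fin 2) K) : aeval x H - algebraMap K A (eval y H) ∈ I := by
  rw [← Ideal.Quotient.eq]
  have h1 : (Ideal.Quotient.mkₐ K I).comp (aeval x) = (Ideal.Quotient.mkₐ K I).comp ((Algebra.ofId K A).comp (aeval y)) := by
    apply MvPolynomial.algHom_ext
    intro i
    simp only [AlgHom.comp_apply, aeval_X]
    exact Ideal.Quotient.eq.2 (h i)
  have := congrArg (fun t : MvPolynomial (Fin 2) K →ₐ[K] A ⧸ I => t H) h1
  simp only [AlgHom.comp_apply, aeval_eq_eval] at this
  exact this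

theorem monic_norm (q1 q2 : Polynomial A) (h1 : q1.Monic) (h2 : q2.Monic) (d : ℕ) (hd1 : q1.natDegree = d) (hd2 : q2.natDegree = d)
    (s t : A) (hs : IsUnit s) (h : Polynomial.C s * q1 = Polynomial.C t * q2) : q1 = q2 := by
  have hst : s = t := by
    have := congrArg (fun P => Polynomial.coeff P d) h
    simp only [Polynomial.coeff_C_mul] at this
    rw [← hd1, h1.coeff_natDegree, hd1, ← hd2, h2.coeff_natDegree, mul_one, mul_one] at this
    exact this
  subst hst
  exact (Polynomial.isUnit_C.2 hs).mul_left_cancel h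

theorem dehom_theta (c : Fin 3) (y : Fin 3 → A) (hy : y c = 1) (j : Fin 3) :
    aeval (fun i => y (chartEmb c i)) (dehomMap (K := K) c j) = y j := by
  rcases chartEmb_cases c j with rfl | rfl | rfl
  · rw [dehomMap_self, map_one, hy]
  · rw [dehomMap_emb, aeval_X]
  · rw [dehomMap_emb, aeval_X]

theorem theta_ideal (n : ℕ) (f : Fin 3 → MvPolynomial (Fin 2) K) (c : Fin 3) (y : Fin 3 → A) (hy : y c = 1) (hm : minv n f y)
    (H : MvPolynomial (Fin 2) K) (hH : H ∈ dehomIdeal c (Ideal.span (minorsSet n 2 f))) :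
    aeval (fun i => y (chartEmb c i)) H = 0 := by
  have h1 : dehomIdeal c (Ideal.span (minorsSet n 2 f)) ≤ RingHom.ker (aeval (fun i => y (chartEmb c i)) : MvPolynomial (Fin 2) K →ₐ[K] A) := by
    unfold dehomIdeal
    rw [Ideal.map_le_iff_le_comap, Ideal.span_le]
    intro g hg
    change aeval (fun i => y (chartEmb c i)) (aeval (dehomMap c) g) = 0
    rw [MvPolynomial.comp_aeval_apply]
    have : (fun i => (aeval (fun i => y (chartEmb c i)) : MvPolynomial (Fin 2) K →ₐ[K] A) (dehomMap c i)) = y := funext (dehom_theta c y hy)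
    rw [this]
    exact hm g hg
  exact h1 hH

end P19

section P20
variable {K : Type*} [Field K] [IsAlgClosed K] {n : ℕ} {f : Fin 3 → MvPolynomial (Fin 2) K}
set_option linter.unusedSectionVars false

theorem exists_RD (hn : 3 ≤ n) (hf : ∀ u, (f u).IsHomogeneous n) (cp cc : Fin 3) (v w : Fin 2 → K) (hb : bdet v w ≠ 0)
    (Gm : Polynomial K) (hGm : Gm.Monic) (hGm2 : Gm.natDegree = 2) (a : Fin 2 → K) (A : Fin 2 → Polynomial K)
    (hfA : ∀ i, Polynomial.C (a i) * tl v w (f cp) + Gm * A i = tl v w (f (chartEmb cp i)))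
    (hAd : ∀ i, (A i).natDegree ≤ n - 2)
    (hcop : IsCoprime (tl v w (f cp)) Gm)
    (y0 : Fin 3 → K) (hy0 : y0 cc = 1) (e0 : K) (he0 : e0 ≠ 0) (hqy : qt v w y0 = Polynomial.C e0 * Gm)
    (b : Fin 2 → K) (hby : ∀ i, b i = y0 (chartEmb cc i)) :
    ∃ (res : LocalRingAt (dehomIdeal cc (Ideal.span (minorsSet n 2 f))) b →ₐ[K] K) (q : Polynomial (LocalRingAt (dehomIdeal cc (Ideal.span (minorsSet n 2 f))) b)) (lam : Fin 2 → LocalRingAt (dehomIdeal cc (Ideal.span (minorsSet n 2 f))) b) (PP : Fin 2 → Polynomial (LocalRingAt (dehomIdeal cc (Ideal.span (minorsSet n 2 f))) b)), RD Gm (tl v w (f cp)) A a res q lam PP := by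
  let I := dehomIdeal cc (Ideal.span (minorsSet n 2 f))
  let R := LocalRingAt I b
  have hb' : b = fun i => y0 (chartEmb cc i) := funext hby
  -- minors over a K-algebra
  have hminv : ∀ (B : Type _) [CommRing B] [Algebra K B] (y : Fin 3 → B) (q' : Polynomial B) (s t : B), q'.Monic → q'.natDegree = 2 →
      qt v w y = Polynomial.C s * q' → s * t = 1 →
      (∀ i, ∃ l P, (Polynomial.C (a i) * tl v w (f cp) + Gm * A i).map (algebraMap K B) = Polynomial.C l * (tl v w (f cp)).map (algebraMap K B) + q' * P) →
      minv n f y := by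
    intro B _ _ y q' s t hq' hq'2 hqt hst hfac
    have hst' : Polynomial.C s * Polynomial.C t = 1 := by rw [← Polynomial.C_mul, hst, Polynomial.C_1]
    have hall : ∀ u, ∃ (l : B) (P : Polynomial B), P.natDegree ≤ n - 2 ∧ phA B v w (f u) = Polynomial.C l * (tl v w (f cp)).map (algebraMap K B) + qt v w y * P := by
      have key : ∀ i, ∃ (l : B) (P : Polynomial B), P.natDegree ≤ n - 2 ∧ phA B v w (f (chartEmb cp i)) = Polynomial.C l * (tl v w (f cp)).map (algebraMap K B) + qt v w y * P := by
        intro i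
        obtain ⟨l, P, h⟩ := hfac i
        rw [hfA] at h
        refine ⟨l, Polynomial.C t * P, (Polynomial.natDegree_C_mul_le _ _).trans ?_, ?_⟩
        · have h1 : (q' * P).natDegree ≤ n := by
            have : q' * P = (tl v w (f (chartEmb cp i))).map (algebraMap K B) - Polynomial.C l * (tl v w (f cp)).map (algebraMap K B) := by
              rw [h]; ring
            rw [this]
            refine (Polynomial.natDegree_sub_le _ _).trans (max_le ?_ ?_)
            · exact Polynomial.natDegree_map_le.trans (natDegree_tl_le v w n _ (hf _))
            · exact (Polynomial.natDegree_C_mul_le _ _).trans (Polynomial.natDegree_map_le.trans (natDegree_tl_le v w n _ (hf _)))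
          by_cases hP : P = 0
          · rw [hP]; simp
          · rw [hq'.natDegree_mul' hP, hq'2] at h1
            omega
        · rw [hqt]
          change Polynomial.map _ _ = _
          rw [h]
          linear_combination (-q' * P) * hst'
      intro u
      rcases chartEmb_cases cp u with rfl | rfl | rfl
      · refine ⟨1, 0, by simp, ?_⟩
        rw [Polynomial.C_1, one_mul, mul_zero, add_zero]; rfl
      · exact key 0
      · exact key 1
    choose l P hP h using hall
    exact minv_of_factor v w hb n hn f hf y _ l P hP h
  have hm0 : minv n f y0 := by
    refine hminv K y0 Gm e0 e0⁻¹ hGm hGm2 hqy (mul_inv_cancel₀ he0) fun i => ⟨a i, A i, ?_⟩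
    simp only [Algebra.algebraMap_self, Polynomial.map_id]
  have hI0 : ∀ H ∈ I, eval b H = 0 := by
    intro H hH
    have := theta_ideal n f cc y0 hy0 hm0 H hH
    rw [aeval_eq_eval, ← hb'] at this
    exact this
  obtain ⟨res, hres, hu⟩ := lmk_res I b hI0
  let X : Fin 3 → R := fun j => lmk I b (dehomMap cc j)
  have hXc : X cc = 1 := by simp only [X]; rw [dehomMap_self, map_one]
  have hXe : ∀ H, lmk I b H = aeval (fun i => X (chartEmb cc i)) H := by
    intro H
    have : lmk I b = aeval (fun i => X (chartEmb cc i)) := by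
      apply MvPolynomial.algHom_ext
      intro i
      rw [aeval_X]
      simp only [X]
      rw [dehomMap_emb]
    rw [this]
  have hXm : minv n f X := by
    intro g hg
    have h1 : aeval X g = lmk I b (aeval (dehomMap cc) g) := (MvPolynomial.comp_aeval_apply _ _ _).symm
    rw [h1]
    exact lmk_zero I b _ (Ideal.mem_map_of_mem _ (Ideal.subset_span hg))
  have hXres : ∀ j, res (X j) = y0 j := by
    intro j
    simp only [X]
    rw [hres]
    have := dehom_theta (K := K) cc y0 hy0 j
    rw [aeval_eq_eval, ← hb'] at this
    exact this
  have hqXres : (qt v w X).map (res : R →+* K) = Polynomial.C e0 * Gm := by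
    rw [qt_map v w res X y0 hXres, hqy]
  have heres : res ((qt v w X).coeff 2) = e0 := by
    have := congrArg (fun P => Polynomial.coeff P 2) hqXres
    simp only [Polynomial.coeff_map, Polynomial.coeff_C_mul] at this
    rw [← hGm2, hGm.coeff_natDegree, mul_one, hGm2] at this
    exact this
  obtain ⟨ε, hε⟩ := hu ((qt v w X).coeff 2) (by rw [heres]; exact he0)
  have hεi : (ε : R) * (ε⁻¹ : Rˣ) = 1 := ε.mul_inv
  have hεC : Polynomial.C (ε : R) * Polynomial.C ((ε⁻¹ : Rˣ) : R) = 1 := by rw [← Polynomial.C_mul, hεi, Polynomial.C_1]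
  have hnt : Nontrivial R := res.toRingHom.domain_nontrivial
  let q : Polynomial R := Polynomial.C ((ε⁻¹ : Rˣ) : R) * qt v w X
  have hqX : qt v w X = Polynomial.C (ε : R) * q := by
    simp only [q]
    linear_combination (-qt v w X) * hεC
  have hqle : q.natDegree ≤ 2 := (Polynomial.natDegree_C_mul_le _ _).trans (qt_natDegree v w X)
  have hq2c : q.coeff 2 = 1 := by
    simp only [q, Polynomial.coeff_C_mul, ← hε]
    exact ε.inv_mul
  have hqm : q.Monic := Polynomial.monic_of_natDegree_le_of_coeff_eq_one 2 hqle hq2c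
  have hqd : q.natDegree = 2 := Polynomial.natDegree_eq_of_le_of_coeff_ne_zero hqle (by rw [hq2c]; exact one_ne_zero)
  have hqres : q.map (res : R →+* K) = Gm := by
    refine monic_norm _ _ (hqm.map _) hGm 2 (by rw [hqm.natDegree_map, hqd]) hGm2 e0 e0 (isUnit_iff_ne_zero.2 he0) ?_
    have h1 : Polynomial.map (res : R →+* K) (Polynomial.C (ε : R) * q) = Polynomial.C e0 * q.map (res : R →+* K) := by
      rw [Polynomial.map_mul, Polynomial.map_C, RingHom.coe_coe, hε, heres]
    rw [← h1, ← hqX]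
    exact hqXres
  have hcopR : IsCoprime (phA R v w (f cp)) q := by
    apply coprime_of_local (res : R →+* K) hu q hqm hqd
    rw [hqres, phA, map_map_res]
    exact hcop
  have hW := W_eq_zero v w hb n hn f hf X hXm ε q hqm hqd hqX
  have hlam : ∀ i, ∃ (l : R) (P : Polynomial R), phA R v w (f (chartEmb cp i)) = Polynomial.C l * phA R v w (f cp) + q * P :=
    fun i => exists_scalar q hqm hqd _ _ hcopR (hW _ _)
  choose lam PP hlam using hlam
  refine ⟨res, q, lam, PP, hu, hqm, hqd, hqres, ?_, ?_, ?_⟩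
  · intro i
    rw [hfA]
    exact hlam i
  · intro g0 hg0 r hr
    let J : Ideal R := Ideal.span {g0}
    have hJ : ∀ l, (qt v w (fun j => X j - (ε * algebraMap K R e0⁻¹) * algebraMap K R (y0 j))).coeff l ∈ J := by
      intro l
      have h1 : qt v w (fun j => X j - (ε * algebraMap K R e0⁻¹) * algebraMap K R (y0 j)) = - (Polynomial.C (ε : R) * (Gm.map (algebraMap K R) - q)) := by
        have h2 : Polynomial.C (algebraMap K R e0⁻¹) * Polynomial.C (algebraMap K R e0) = 1 := by
          rw [← Polynomial.C_mul, ← map_mul, inv_mul_cancel₀ he0, map_one, Polynomial.C_1]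
        rw [qt_sub v w X (fun j => (ε * algebraMap K R e0⁻¹) * algebraMap K R (y0 j)), qt_smul, qt_alg, hqy, hqX, Polynomial.map_mul, Polynomial.map_C, Polynomial.C_mul]
        linear_combination (-Polynomial.C (ε : R) * Gm.map (algebraMap K R)) * h2
      rw [h1, Polynomial.coeff_neg, Polynomial.coeff_C_mul]
      exact J.neg_mem (J.mul_mem_left _ (Ideal.mem_span_singleton.2 (hg0 l)))
    have h3 := fun j => qt_mem v w hb J _ hJ j
    have h4 : ∀ j, X j - algebraMap K R (y0 j) ∈ J := by
      intro j
      have h5 := h3 cc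
      rw [hXc, hy0, map_one, mul_one] at h5
      have h6 := J.sub_mem (h3 j) (J.mul_mem_right (algebraMap K R (y0 j)) h5)
      have h7 : X j - (ε * algebraMap K R e0⁻¹) * algebraMap K R (y0 j) - (1 - ε * algebraMap K R e0⁻¹) * algebraMap K R (y0 j) = X j - algebraMap K R (y0 j) := by ring
      rw [h7] at h6
      exact h6
    obtain ⟨H, H', hH', hrH⟩ := lmk_surj I b r
    have h8 : eval b H = 0 := by
      rw [← hres, ← hrH, map_mul, hr, zero_mul]
    have h9 := aeval_mem J (fun i => X (chartEmb cc i)) b (fun i => by rw [hby]; exact h4 _) H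
    rw [← hXe, h8, map_zero, sub_zero, ← hrH] at h9
    rw [Ideal.mem_span_singleton] at h9
    exact (lmk_unit I b H' hH').dvd_mul_right.1 h9
  · intro e he q' hq' hq'2 hfac hnil
    let B := Polynomial K ⧸ Ideal.span {(Polynomial.X : Polynomial K) ^ e}
    obtain ⟨y', hy'⟩ := exists_B v w hb 2 q' hq'2.le
    have hqy' : qt v w y' = q' := hy'.symm
    let J : Ideal B := nilradical B
    have hJ : ∀ l, (qt v w (fun j => algebraMap K B e0⁻¹ * algebraMap K B (y0 j) - y' j)).coeff l ∈ J := by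
      intro l
      have h2 : Polynomial.C (algebraMap K B e0⁻¹) * Polynomial.C (algebraMap K B e0) = 1 := by
        rw [← Polynomial.C_mul, ← map_mul, inv_mul_cancel₀ he0, map_one, Polynomial.C_1]
      have h1 : qt v w (fun j => algebraMap K B e0⁻¹ * algebraMap K B (y0 j) - y' j) = Gm.map (algebraMap K B) - q' := by
        rw [qt_sub v w (fun j => algebraMap K B e0⁻¹ * algebraMap K B (y0 j)) y', qt_smul, qt_alg, hqy, hqy', Polynomial.map_mul, Polynomial.map_C]
        linear_combination (Gm.map (algebraMap K B)) * h2
      rw [h1]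
      exact mem_nilradical.2 (hnil l)
    have h3 := fun j => qt_mem v w hb J _ hJ j
    have hunit : ∀ (k : K) (z : B), k ≠ 0 → algebraMap K B k - z ∈ J → IsUnit z := by
      intro k z hk hz
      have h5 : IsUnit (algebraMap K B k) := (isUnit_iff_ne_zero.2 hk).map _
      have h6 := (mem_nilradical.1 hz).neg.isUnit_add_left_of_commute h5 (Commute.all _ _)
      have h7 : algebraMap K B k + -(algebraMap K B k - z) = z := by ring
      rw [h7] at h6
      exact h6
    have h4 := h3 cc
    rw [hy0, map_one, mul_one] at h4
    obtain ⟨μ, hμ⟩ := hunit _ _ (inv_ne_zero he0) h4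
    let y : Fin 3 → B := fun j => ((μ⁻¹ : Bˣ) : B) * y' j
    have hyc : y cc = 1 := by simp only [y]; rw [← hμ]; exact μ.inv_mul
    have hyn : ∀ j, y j - algebraMap K B (y0 j) ∈ J := by
      intro j
      have h5 := J.sub_mem (J.mul_mem_right (algebraMap K B (y0 j)) h4) (h3 j)
      have h6 := J.mul_mem_left ((μ⁻¹ : Bˣ) : B) h5
      have h7 : ((μ⁻¹ : Bˣ) : B) * y' cc = 1 := hyc
      have h8 : ((μ⁻¹ : Bˣ) : B) * ((algebraMap K B e0⁻¹ - y' cc) * algebraMap K B (y0 j) - (algebraMap K B e0⁻¹ * algebraMap K B (y0 j) - y' j)) = y j - algebraMap K B (y0 j) := by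
        simp only [y]
        linear_combination (-algebraMap K B (y0 j)) * h7
      rw [h8] at h6
      exact h6
    have hqty : qt v w y = Polynomial.C ((μ⁻¹ : Bˣ) : B) * q' := by
      rw [qt_smul, hqy']
    have hym : minv n f y := hminv B y q' _ (μ : B) hq' hq'2 hqty μ.inv_mul hfac
    obtain ⟨τ, hτ⟩ := lmk_lift I b (aeval (fun i => y (chartEmb cc i))) (theta_ideal n f cc y hyc hym) (by
      intro H hH
      apply hunit _ _ hH
      have := J.neg_mem (aeval_mem J (fun i => y (chartEmb cc i)) b (fun i => by rw [hby]; exact hyn _) H)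
      rw [neg_sub] at this
      exact this)
    refine ⟨τ, ?_⟩
    have hτX : ∀ j, τ (X j) = y j := fun j => by
      simp only [X]; rw [hτ]; exact dehom_theta cc y hyc j
    have h5 := qt_map v w τ X y hτX
    rw [hqty, hqX, Polynomial.map_mul, Polynomial.map_C] at h5
    have hntB : Nontrivial B := by
      refine ⟨⟨1, 0, fun h => ?_⟩⟩
      have h6 : Ideal.Quotient.mk (Ideal.span {(Polynomial.X : Polynomial K) ^ e}) 1 = 0 := h
      rw [Ideal.Quotient.eq_zero_iff_mem, Ideal.mem_span_singleton] at h6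
      have := Polynomial.natDegree_le_of_dvd h6 one_ne_zero
      rw [Polynomial.natDegree_X_pow, Polynomial.natDegree_one] at this
      omega
    refine monic_norm _ _ (hqm.map _) hq' 2 ((hqm.natDegree_map _).trans hqd) hq'2 _ _ ?_ h5
    exact ε.isUnit.map (τ : R →+* B)

end P20

section P21
variable {K : Type*} [Field K] [IsAlgClosed K] [CharZero K] {n : ℕ} {f : Fin 3 → MvPolynomial (Fin 2) K}
  {F : MvPolynomial (Fin 3) K}
set_option linter.unusedSectionVars false

theorem bullet4 (H : CurH n f F) (hm2 : ∀ q : Fin 3 → K, q ≠ 0 → multAt F q ≤ 2)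
    (p : Fin 3 → K) (hp : p ≠ 0) (h2 : 2 ≤ multAt F p)
    (G : MvPolynomial (Fin 2) K) (hG : IsGcdOfCross f p G) (cc : Fin 3) (hcc : bcoeff 2 G cc ≠ 0)
    (cp : Fin 3) (hcp : p cp ≠ 0) (L : Type*) [Field L]
        [Algebra (LocalRingAt (Ideal.span
              {MvPolynomial.aeval (dehomMap cp) F}) (affOf p cp)) L]
        [IsFractionRing (LocalRingAt (Ideal.span
              {MvPolynomial.aeval (dehomMap cp) F}) (affOf p cp)) L]
        [Algebra K L]
        [IsScalarTower K (LocalRingAt (Ideal.span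
              {MvPolynomial.aeval (dehomMap cp) F}) (affOf p cp)) L] :
        lengthAt (dehomIdeal cc (Ideal.span (minorsSet n 2 f)))
            (affOf (fun i => bcoeff 2 G i) cc)
          = deltaAt (Ideal.span {MvPolynomial.aeval (dehomMap cp) F}) (affOf p cp) L := by
  obtain ⟨hG2, hG0⟩ := gcd_hom2 H hm2 p hp h2 G hG
  obtain ⟨v, w, hb, hv, A, x, hfA, hAd, D⟩ := exists_PD H p cp hcp G hG hG2
  obtain ⟨res, q, lam, PP, E⟩ := exists_RD (K := K) H.hn H.hf.homog cp cc v w hb _ D.hG D.hG2 (affOf p cp) A hfA hAd D.hκ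
    (fun j => (bcoeff 2 G cc)⁻¹ * bcoeff 2 G j) (inv_mul_cancel₀ hcc) ((bcoeff 2 G cc)⁻¹ * eval v G)
    (mul_ne_zero (inv_ne_zero hcc) hv) (by
      have h1 : qt v w (fun j => (bcoeff 2 G cc)⁻¹ * bcoeff 2 G j) = Polynomial.C (bcoeff 2 G cc)⁻¹ * qt v w (bcoeff 2 G) :=
        qt_smul v w _ _
      have h2 : Polynomial.C (eval v G) * Polynomial.C (eval v G)⁻¹ = 1 := by
        rw [← Polynomial.C_mul, mul_inv_cancel₀ hv, Polynomial.C_1]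
      rw [h1, qt_K, formOf_bcoeff 2 G hG2, Polynomial.C_mul]
      linear_combination (-Polynomial.C (bcoeff 2 G cc)⁻¹ * tl v w G) * h2)
    (affOf (fun i => bcoeff 2 G i) cc) (fun i => by simp only [affOf]; rw [div_eq_inv_mul])
  exact (conc_delta D L (be q) (II2 D E) (fun P => ⟨II3 D E P, II1 D E P⟩)).symm

end P21

/-- If every singular point of `C` has multiplicity `2`, then `P ↦ [G_P]` is a bijection from
the singular points of `C` onto `X_2(K)`, and for every singular point `P` the length of the
scheme `X_2` at `[G_P]` equals the delta invariant `δ_P`. -/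
theorem statement_11 {K : Type u} [Field K] [IsAlgClosed K] [CharZero K]
    (n : ℕ) (hn : 3 ≤ n) (f : Fin 3 → MvPolynomial (Fin 2) K)
    (hf : IsProperParam n f)
    (F : MvPolynomial (Fin 3) K) (hFirr : Irreducible F) (hFhom : F.IsHomogeneous n)
    (hFf : MvPolynomial.aeval f F = 0)
    (hmult2 : ∀ q : Fin 3 → K, q ≠ 0 → multAt F q ≤ 2) :
    -- P ↦ [G_P] maps singular points into X_2(K) …
    (∀ p : Fin 3 → K, p ≠ 0 → 2 ≤ multAt F p →
      ∀ G : MvPolynomial (Fin 2) K, IsGcdOfCross f p G →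
        ∃ x ∈ XkSet n 2 f, ∃ c : K, c ≠ 0 ∧ formOf 2 x.rep = MvPolynomial.C c * G) ∧
    -- … injectively …
    (∀ p q : Fin 3 → K, p ≠ 0 → q ≠ 0 → 2 ≤ multAt F p → 2 ≤ multAt F q →
      ∀ G G' : MvPolynomial (Fin 2) K, IsGcdOfCross f p G → IsGcdOfCross f q G' →
        (∃ c : K, c ≠ 0 ∧ G' = MvPolynomial.C c * G) →
        ∃ d : K, d ≠ 0 ∧ q = d • p) ∧
    -- … and surjectively.
    (∀ x ∈ XkSet n 2 f, ∃ p : Fin 3 → K, p ≠ 0 ∧ 2 ≤ multAt F p ∧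
      ∃ G : MvPolynomial (Fin 2) K, IsGcdOfCross f p G ∧
        ∃ c : K, c ≠ 0 ∧ formOf 2 x.rep = MvPolynomial.C c * G) ∧
    -- For each singular point P, the length of X_2 at [G_P] equals δ_P:
    (∀ p : Fin 3 → K, p ≠ 0 → 2 ≤ multAt F p →
      ∀ G : MvPolynomial (Fin 2) K, IsGcdOfCross f p G →
      -- in any affine chart of the x-plane containing [G_P] …
      ∀ cc : Fin 3, bcoeff 2 G cc ≠ 0 →
      -- … and any affine chart of the w-plane containing P …
      ∀ cp : Fin 3, p cp ≠ 0 →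
      -- … and any field of fractions L of the local ring of C at P:
      ∀ (L : Type u) [Field L]
        [Algebra (LocalRingAt (Ideal.span
              {MvPolynomial.aeval (dehomMap cp) F}) (affOf p cp)) L]
        [IsFractionRing (LocalRingAt (Ideal.span
              {MvPolynomial.aeval (dehomMap cp) F}) (affOf p cp)) L]
        [Algebra K L]
        [IsScalarTower K (LocalRingAt (Ideal.span
              {MvPolynomial.aeval (dehomMap cp) F}) (affOf p cp)) L],
        lengthAt (dehomIdeal cc (Ideal.span (minorsSet n 2 f)))
            (affOf (fun i => bcoeff 2 G i) cc)
          = deltaAt (Ideal.span {MvPolynomial.aeval (dehomMap cp) F}) (affOf p cp) L) := by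
  have H : CurH n f F := ⟨hn, hf, hFirr, hFhom, hFf⟩
  refine ⟨?_, ?_, ?_, ?_⟩
  · intro p hp h2 G hG
    exact bullet1 H hmult2 p hp h2 G hG
  · intro p q hp hq h2 _ G G' hG hG' hGG
    exact bullet2 H hmult2 p q hp hq h2 G G' hG hG' hGG
  · intro x hx
    exact bullet3 H hmult2 x hx
  · intro p hp h2 G hG cc hcc cp hcp L _ _ _ _ _
    exact bullet4 H hmult2 p hp h2 G hG cc hcc cp hcp L

end
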